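/- E(𝔹ₙ) is contained in F(𝔹ₙ) and is a dense subset of F(𝔹ₙ), and F(𝔹ₙ) is a relatively closed subset of U(𝔹ₙ), all with respect to the topology of locally uniform convergence. In particular, for n ≥ 2 the closure of E(𝔹ₙ) is a proper subset of U(𝔹ₙ). -/

import Mathlib

open Metric Filter Set MeasureTheory

noncomputable section

/-- ℂⁿ with the Euclidean (Hermitian) norm. -/
abbrev En (n : ℕ) : Type := EuclideanSpace ℂ (Fin n)

/-- The open Euclidean unit ball 𝔹ₙ ⊂ ℂⁿ. -/
def Ball (n : ℕ) : Set (En n) := Metric.ball 0 1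

/-- A map is univalent on 𝔹ₙ if it is holomorphic and injective there. -/
def UnivalentOn (n : ℕ) (f : En n → En n) : Prop :=
  DifferentiableOn ℂ f (Ball n) ∧ Set.InjOn f (Ball n)

/-- A polynomial map ℂⁿ → ℂⁿ: each of the n components is a polynomial in the
n complex coordinates. -/
def IsPolyMap (n : ℕ) (p : En n → En n) : Prop :=
  ∃ q : Fin n → MvPolynomial (Fin n) ℂ,
    ∀ z : En n, ∀ i : Fin n, p z i = MvPolynomial.eval (fun j => z j) (q i)

/-- The Runge approximation property for a set Ω ⊆ ℂⁿ: every holomorphic map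
Ω → ℂⁿ is a locally uniform limit on Ω of polynomial maps. -/
def RungeOn (n : ℕ) (Ω : Set (En n)) : Prop :=
  ∀ g : En n → En n, DifferentiableOn ℂ g Ω →
    ∃ p : ℕ → En n → En n, (∀ k, IsPolyMap n (p k)) ∧
      TendstoLocallyUniformlyOn p g atTop Ω

/-- A Loewner chain on 𝔹ₙ: a family (f_t)_{t ≥ 0} of univalent maps with
increasing images, locally absolutely continuous in t, uniformly on compacta. -/
def IsLoewnerChain (n : ℕ) (f : ℝ → En n → En n) : Prop :=
  (∀ t, 0 ≤ t → UnivalentOn n (f t)) ∧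
  (∀ s t, 0 ≤ s → s ≤ t → f s '' Ball n ⊆ f t '' Ball n) ∧
  (∀ K : Set (En n), K ⊆ Ball n → IsCompact K → ∀ T : ℝ, 0 < T →
    ∃ c : ℝ → ℝ, (∀ τ, 0 ≤ c τ) ∧ IntegrableOn c (Set.Icc 0 T) ∧
      ∀ z ∈ K, ∀ s t : ℝ, 0 ≤ s → s ≤ t → t ≤ T →
        ‖f s z - f t z‖ ≤ ∫ τ in Set.Icc s t, c τ)

/-- The range of a Loewner chain: ⋃_{t ≥ 0} f_t(𝔹ₙ). -/
def ChainRange (n : ℕ) (f : ℝ → En n → En n) : Set (En n) :=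
  ⋃ t ∈ Set.Ici (0 : ℝ), f t '' Ball n

/-- E(𝔹ₙ): univalent maps embeddable as initial element of a Loewner chain
with range all of ℂⁿ. -/
def MemE (n : ℕ) (f : En n → En n) : Prop :=
  UnivalentOn n f ∧ ∃ F : ℝ → En n → En n,
    IsLoewnerChain n F ∧ F 0 = f ∧ ChainRange n F = Set.univ

/-- F(𝔹ₙ): univalent maps whose image is a Runge domain. -/
def MemF (n : ℕ) (f : En n → En n) : Prop :=
  UnivalentOn n f ∧ RungeOn n (f '' Ball n)

noncomputable section

section SCV
variable {E F : Type*} [NormedAddCommGroup E] [NormedSpace ℂ E]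
  [NormedAddCommGroup F] [NormedSpace ℂ F]

theorem scv_fderiv_bound {f : E → F} {c : E} {R M : ℝ} (hR : 0 < R)
    (hf : DifferentiableOn ℂ f (ball c R)) (hM : ∀ z ∈ ball c R, ‖f z‖ ≤ M) :
    ‖fderiv ℂ f c‖ ≤ 2 * M / R := by
  refine Complex.norm_fderiv_le_div_of_mapsTo_ball hf ?_ hR
  intro z hz
  rw [mem_closedBall, dist_eq_norm]
  have := norm_sub_le (f z) (f c)
  have h1 := hM z hz
  have h2 := hM c (mem_ball_self hR)
  linarith

theorem scv_taylor2 {f : E → F} {c : E} {R M : ℝ} (hR : 0 < R)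
    (hf : DifferentiableOn ℂ f (ball c R)) (hM : ∀ z ∈ ball c R, ‖f z‖ ≤ M)
    {z : E} (hz : z ∈ ball c R) :
    ‖f z - f c - fderiv ℂ f c (z - c)‖ ≤ 4 * M / R ^ 2 * ‖z - c‖ ^ 2 := by
  have hdc : DifferentiableAt ℂ f c := hf.differentiableAt (ball_mem_nhds c hR)
  set A := fderiv ℂ f c
  have hA : ‖A‖ ≤ 2 * M / R := scv_fderiv_bound hR hf hM
  set g : E → F := fun w => f w - f c - A (w - c) with hg
  have hgc : g c = 0 := by simp [hg]
  have hgd : DifferentiableOn ℂ g (ball c R) := by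
    refine (hf.sub_const _).sub ?_
    exact (A.differentiable.comp (differentiable_id.sub_const c)).differentiableOn
  have := @Complex.dist_le_mul_div_pow_of_mapsTo_ball_of_isLittleO E F _ _ _ _ g c z R (4 * M) 1 hgd
    ?_ ?_ hz
  · rw [hgc, dist_zero_right, dist_eq_norm] at this
    refine this.trans (le_of_eq ?_)
    rw [div_pow]; ring
  · intro w hw
    rw [hgc, mem_closedBall, dist_zero_right]
    have h1 := hM w hw
    have h2 := hM c (mem_ball_self hR)
    have h3 : ‖A (w - c)‖ ≤ 2 * M / R * R := by
      refine (A.le_opNorm _).trans ?_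
      have : ‖w - c‖ ≤ R := by rw [← dist_eq_norm]; exact (mem_ball.1 hw).le
      exact mul_le_mul hA this (norm_nonneg _) ((norm_nonneg _).trans hA)
    rw [div_mul_cancel₀ _ hR.ne'] at h3
    calc ‖g w‖ ≤ ‖f w - f c‖ + ‖A (w - c)‖ := norm_sub_le _ _
      _ ≤ ‖f w‖ + ‖f c‖ + ‖A (w - c)‖ := by gcongr; exact norm_sub_le _ _
      _ ≤ _ := by linarith
  · have h := hdc.hasFDerivAt.isLittleO
    simp only [hgc, sub_zero, pow_one]
    exact h.norm_right

theorem scv_limit_aux [CompleteSpace F] {ι : Type*} {l : Filter ι} [l.NeBot] {f : ι → E → F} {g : E → F}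
    {c : E} {R M : ℝ} (hR : 0 < R)
    (hf : ∀ᶠ k in l, DifferentiableOn ℂ (f k) (ball c R))
    (hM : ∀ z ∈ ball c R, ‖g z‖ ≤ M)
    (hu : ∀ ε > 0, ∀ᶠ k in l, ∀ z ∈ ball c R, ‖f k z - g z‖ ≤ ε) :
    ∃ A : E →L[ℂ] F, HasFDerivAt g A c ∧ Tendsto (fun k => fderiv ℂ (f k) c) l (nhds A) := by
  have hc : Cauchy (map (fun k => fderiv ℂ (f k) c) l) := by
    rw [Metric.cauchy_iff]
    refine ⟨inferInstance, fun ε hε => ?_⟩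
    have hδ : 0 < ε * R / 8 := by positivity
    refine ⟨_, image_mem_map (hf.and (hu _ hδ)), ?_⟩
    rintro _ ⟨i, ⟨hi, hi'⟩, rfl⟩ _ ⟨j, ⟨hj, hj'⟩, rfl⟩
    have hdi := hi.differentiableAt (ball_mem_nhds c hR)
    have hdj := hj.differentiableAt (ball_mem_nhds c hR)
    rw [dist_eq_norm, ← fderiv_sub hdi hdj]
    have := scv_fderiv_bound (M := ε * R / 4) hR (hi.sub hj) ?_
    · refine this.trans_lt ?_
      rw [div_lt_iff₀ hR]; nlinarith [mul_pos hε hR]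
    · intro z hz
      have h1 := hi' z hz
      have h2 := hj' z hz
      calc ‖f i z - f j z‖ = ‖(f i z - g z) - (f j z - g z)‖ := by congr 1; abel
        _ ≤ ‖f i z - g z‖ + ‖f j z - g z‖ := norm_sub_le _ _
        _ ≤ _ := by linarith
  obtain ⟨A, hA⟩ := CompleteSpace.complete hc
  refine ⟨A, ?_, hA⟩
  have hpt : ∀ z ∈ ball c R, Tendsto (fun k => f k z) l (nhds (g z)) := by
    intro z hz
    rw [Metric.tendsto_nhds]
    intro ε hε
    filter_upwards [hu (ε / 2) (by positivity)] with k hk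
    rw [dist_eq_norm]
    exact (hk z hz).trans_lt (by linarith)
  have hq : ∀ z ∈ ball c R, ‖g z - g c - A (z - c)‖ ≤ 4 * (M + 1) / R ^ 2 * ‖z - c‖ ^ 2 := by
    intro z hz
    have h1 : Tendsto (fun k => ‖f k z - f k c - fderiv ℂ (f k) c (z - c)‖) l
        (nhds ‖g z - g c - A (z - c)‖) := by
      refine (((hpt z hz).sub (hpt c (mem_ball_self hR))).sub ?_).norm
      exact ((ContinuousLinearMap.apply ℂ F (z - c)).continuous.tendsto A).comp hA
    refine le_of_tendsto h1 ?_
    filter_upwards [hf, hu 1 one_pos] with k hk hk1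
    refine scv_taylor2 hR hk (fun w hw => ?_) hz
    have := norm_sub_norm_le (f k w) (g w)
    have := hk1 w hw
    have := hM w hw
    linarith
  rw [hasFDerivAt_iff_isLittleO]
  have hO : (fun z => g z - g c - A (z - c)) =O[nhds c] fun z => ‖z - c‖ ^ 2 := by
    refine Asymptotics.IsBigO.of_bound (4 * (M + 1) / R ^ 2) ?_
    filter_upwards [ball_mem_nhds c hR] with z hz
    rw [norm_pow, norm_norm]; exact hq z hz
  refine hO.trans_isLittleO ?_
  exact Asymptotics.isLittleO_pow_sub_sub c (by norm_num)

theorem scv_fderiv_apply_differentiableAt [CompleteSpace F] {f : E → F} {U : Set E} (hU : IsOpen U)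
    (hf : DifferentiableOn ℂ f U) (v : E) {c : E} (hc : c ∈ U) :
    DifferentiableAt ℂ (fun z => fderiv ℂ f z v) c := by
  have hcont := (hf.differentiableAt (hU.mem_nhds hc)).continuousAt
  have hev : ∀ᶠ z in nhds c, z ∈ U ∧ ‖f z‖ ≤ ‖f c‖ + 1 := by
    refine (hU.eventually_mem hc).and ?_
    have := hcont.norm.eventually (gt_mem_nhds (lt_add_one _))
    filter_upwards [this] with z hz using hz.le
  obtain ⟨r, hr, hball⟩ := Metric.eventually_nhds_iff_ball.1 hev
  set M := ‖f c‖ + 1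
  have hM0 : 0 ≤ M := by positivity
  -- on ball c (r/4)
  have hsub : ∀ z ∈ ball c (r / 4), ball z (r / 4) ⊆ ball c r := by
    intro z hz w hw
    rw [mem_ball] at *
    linarith [dist_triangle w z c]
  have hdz : ∀ z ∈ ball c (r/4), DifferentiableOn ℂ f (ball z (r / 4)) := fun z hz =>
    hf.mono fun w hw => (hball w (hsub z hz hw)).1
  have hmz : ∀ z ∈ ball c (r/4), ∀ w ∈ ball z (r / 4), ‖f w‖ ≤ M := fun z hz w hw =>
    (hball w (hsub z hz hw)).2
  have hr4 : 0 < r / 4 := by positivity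
  have H := scv_limit_aux (l := nhdsWithin (0:ℂ) {0}ᶜ)
    (f := fun t z => t⁻¹ • (f (z + t • v) - f z)) (g := fun z => fderiv ℂ f z v) (c := c)
    (R := r / 4) (M := 2 * M / (r / 4) * ‖v‖) hr4 ?_ ?_ ?_
  · obtain ⟨A, hA, -⟩ := H
    exact hA.differentiableAt
  · have : ∀ᶠ t in nhdsWithin (0:ℂ) {0}ᶜ, ‖t • v‖ < r / 4 := by
      apply eventually_nhdsWithin_of_eventually_nhds
      have : Tendsto (fun t : ℂ => ‖t • v‖) (nhds 0) (nhds ‖(0:ℂ) • v‖) :=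
        (Continuous.tendsto (by fun_prop) _)
      rw [zero_smul, norm_zero] at this
      exact this.eventually (gt_mem_nhds hr4)
    filter_upwards [this] with t ht
    refine DifferentiableOn.const_smul (DifferentiableOn.sub ?_ ?_) _
    · refine hf.comp (differentiable_id.add_const _).differentiableOn ?_
      intro z hz
      refine (hball _ (hsub z hz ?_)).1
      simpa [mem_ball, dist_eq_norm] using ht
    · exact hf.mono fun z hz => (hball z (ball_subset_ball (by linarith) hz)).1
  · intro z hz
    refine (ContinuousLinearMap.le_opNorm _ _).trans ?_
    gcongr
    exact scv_fderiv_bound hr4 (hdz z hz) (hmz z hz)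
  · intro ε hε
    set C := 4 * M / (r / 4) ^ 2 * ‖v‖ ^ 2
    have : ∀ᶠ t in nhdsWithin (0:ℂ) {0}ᶜ, ‖t • v‖ < r / 4 ∧ C * ‖t‖ ≤ ε := by
      apply eventually_nhdsWithin_of_eventually_nhds
      have h1 : Tendsto (fun t : ℂ => ‖t • v‖) (nhds 0) (nhds ‖(0:ℂ) • v‖) :=
        (Continuous.tendsto (by fun_prop) _)
      have h2 : Tendsto (fun t : ℂ => C * ‖t‖) (nhds 0) (nhds (C * ‖(0:ℂ)‖)) :=
        (Continuous.tendsto (by fun_prop) _)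
      rw [zero_smul, norm_zero] at h1
      rw [norm_zero, mul_zero] at h2
      filter_upwards [h1.eventually (gt_mem_nhds hr4), h2.eventually (gt_mem_nhds hε)] with t a b
        using ⟨a, b.le⟩
    filter_upwards [this, self_mem_nhdsWithin] with t ht ht0 z hz
    have ht0' : t ≠ 0 := ht0
    have hq := scv_taylor2 (z := z + t • v) hr4 (hdz z hz) (hmz z hz)
      (by simpa [mem_ball, dist_eq_norm] using ht.1)
    rw [add_sub_cancel_left] at hq
    have : t⁻¹ • (f (z + t • v) - f z) - fderiv ℂ f z v
        = t⁻¹ • (f (z + t • v) - f z - fderiv ℂ f z (t • v)) := by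
      rw [map_smul, smul_sub t⁻¹ (_ - _), smul_smul, inv_mul_cancel₀ ht0', one_smul]
    rw [this, norm_smul, norm_inv]
    have htp : 0 < ‖t‖ := norm_pos_iff.2 ht0'
    rw [inv_mul_le_iff₀ htp]
    refine hq.trans ?_
    rw [norm_smul, mul_pow]
    calc _ = ‖t‖ * (C * ‖t‖) := by simp only [C]; ring
      _ ≤ ‖t‖ * ε := by gcongr; exact ht.2

variable [FiniteDimensional ℂ E] [CompleteSpace F]

theorem scv_fderiv_differentiableOn {f : E → F} {U : Set E} (hU : IsOpen U)
    (hf : DifferentiableOn ℂ f U) : DifferentiableOn ℂ (fderiv ℂ f) U := by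
  intro c hc
  apply DifferentiableAt.differentiableWithinAt
  let b := Module.finBasis ℂ E
  -- write L = Σ (coord i) smulRight (L (b i))
  have key : ∀ z, fderiv ℂ f z = ∑ i, (LinearMap.toContinuousLinearMap (b.coord i)).smulRight
      (fderiv ℂ f z (b i)) := by
    intro z
    ext w
    simp only [_root_.sum_apply, ContinuousLinearMap.smulRight_apply]
    conv_lhs => rw [← b.sum_repr w, map_sum]
    simp
  have : fderiv ℂ f = fun z => ∑ i, (LinearMap.toContinuousLinearMap (b.coord i)).smulRight
      (fderiv ℂ f z (b i)) := funext key
  rw [this]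
  refine DifferentiableAt.fun_sum fun i _ => ?_
  exact ((ContinuousLinearMap.smulRightL ℂ E F
    (LinearMap.toContinuousLinearMap (b.coord i))).differentiableAt).comp c
    (scv_fderiv_apply_differentiableAt hU hf (b i) hc)

theorem scv_contDiffOn {f : E → F} {U : Set E} (hU : IsOpen U)
    (hf : DifferentiableOn ℂ f U) : ContDiffOn ℂ 1 f U := by
  rw [show (1 : WithTop ℕ∞) = 0 + 1 by simp, contDiffOn_succ_iff_fderiv_of_isOpen hU]
  refine ⟨hf, by simp, ?_⟩
  rw [contDiffOn_zero]
  exact (scv_fderiv_differentiableOn hU hf).continuousOn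

theorem scv_contDiffAt {f : E → F} {U : Set E} (hU : IsOpen U)
    (hf : DifferentiableOn ℂ f U) {c : E} (hc : c ∈ U) : ContDiffAt ℂ 1 f c :=
  (scv_contDiffOn hU hf).contDiffAt (hU.mem_nhds hc)

theorem scv_strict {f : E → F} {U : Set E} (hU : IsOpen U)
    (hf : DifferentiableOn ℂ f U) {c : E} (hc : c ∈ U) :
    HasStrictFDerivAt f (fderiv ℂ f c) c :=
  (scv_contDiffAt hU hf hc).hasStrictFDerivAt (by norm_num)

theorem scv_limit {f : ℕ → E → F} {g : E → F} {U : Set E} (hU : IsOpen U)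
    (hf : ∀ k, DifferentiableOn ℂ (f k) U) (h : TendstoLocallyUniformlyOn f g atTop U) :
    DifferentiableOn ℂ g U := by
  intro c hc
  have hgc : ContinuousOn g U :=
    h.continuousOn (Frequently.of_forall fun k => (hf k).continuousOn)
  rw [Metric.tendstoLocallyUniformlyOn_iff] at h
  have hcont := hgc.continuousAt (hU.mem_nhds hc)
  have : ProperSpace E := FiniteDimensional.proper ℂ E
  have h1 : ∀ᶠ z in nhds c, z ∈ U ∧ ‖g z‖ ≤ ‖g c‖ + 1 := by
    refine (hU.eventually_mem hc).and ?_
    have := hcont.norm.eventually (gt_mem_nhds (lt_add_one _))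
    filter_upwards [this] with z hz using hz.le
  obtain ⟨r, hr, hball⟩ := Metric.eventually_nhds_iff_ball.1 h1
  have hcomp : IsCompact (closedBall c (r/2)) := isCompact_closedBall _ _
  have hsub : closedBall c (r/2) ⊆ U := fun z hz => (hball z (by
    rw [mem_closedBall] at hz; rw [mem_ball]; linarith)).1
  have hun := (tendstoLocallyUniformlyOn_iff_tendstoUniformlyOn_of_compact hcomp).1
    ((Metric.tendstoLocallyUniformlyOn_iff.2 h).mono hsub)
  rw [Metric.tendstoUniformlyOn_iff] at hun
  obtain ⟨A, hA, -⟩ := scv_limit_aux (l := atTop) (f := f) (g := g) (c := c) (R := r/2)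
    (M := ‖g c‖ + 1) (by positivity)
    (Eventually.of_forall fun k => (hf k).mono (ball_subset_closedBall.trans hsub))
    (fun z hz => (hball z (ball_subset_ball (by linarith) hz)).2) (fun ε hε => by
      filter_upwards [hun ε hε] with k hk z hz
      have := hk z (ball_subset_closedBall hz)
      rw [dist_comm, dist_eq_norm] at this
      exact this.le)
  exact hA.differentiableAt.differentiableWithinAt

end SCV
end

noncomputable section

theorem en_norm_le_sum {n : ℕ} (x : En n) : ‖x‖ ≤ ∑ i, ‖x i‖ := by
  rw [EuclideanSpace.norm_eq]
  refine Real.sqrt_le_iff.2 ⟨Finset.sum_nonneg fun i _ => norm_nonneg _, ?_⟩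
  exact Finset.sum_sq_le_sq_sum_of_nonneg fun i _ => norm_nonneg _

theorem en_sum_single {n : ℕ} (z : En n) : z = ∑ i, z i • EuclideanSpace.single i (1:ℂ) := by
  ext j
  simp [Finset.sum_apply, Pi.single_apply]

theorem clm_sum_single {n : ℕ} (L : En n →L[ℂ] ℂ) (z : En n) :
    L z = ∑ i, z i * L (EuclideanSpace.single i (1:ℂ)) := by
  conv_lhs => rw [en_sum_single z]
  simp [map_sum]

/-- The polynomial map with prescribed components. -/
def mkPoly {n : ℕ} (q : Fin n → MvPolynomial (Fin n) ℂ) : En n → En n :=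
  fun z => WithLp.toLp 2 fun i => MvPolynomial.eval (fun j => z j) (q i)

theorem mkPoly_isPoly {n : ℕ} (q : Fin n → MvPolynomial (Fin n) ℂ) : IsPolyMap n (mkPoly q) :=
  ⟨q, fun _ _ => rfl⟩

theorem mv_eval_differentiable {n : ℕ} (P : MvPolynomial (Fin n) ℂ) :
    Differentiable ℂ (fun z : En n => MvPolynomial.eval (fun j => z j) P) := by
  induction P using MvPolynomial.induction_on with
  | C a => simp
  | add p q hp hq => simp only [map_add]; exact hp.add hq
  | mul_X p i hp =>
    simp only [map_mul, MvPolynomial.eval_X]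
    exact hp.mul ((EuclideanSpace.proj (𝕜 := ℂ) i).differentiable)

theorem en_differentiable_iff {E : Type*} [NormedAddCommGroup E] [NormedSpace ℂ E] {n : ℕ}
    {f : E → En n} {s : Set E} :
    DifferentiableOn ℂ f s ↔ ∀ i, DifferentiableOn ℂ (fun z => f z i) s :=
  differentiableOn_euclidean

theorem IsPolyMap.eq_mk {n : ℕ} {p : En n → En n} (h : IsPolyMap n p) : ∃ q, p = mkPoly q := by
  obtain ⟨q, hq⟩ := h
  exact ⟨q, funext fun z => by ext i; exact hq z i⟩

theorem IsPolyMap.differentiable {n : ℕ} {p : En n → En n} (h : IsPolyMap n p) :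
    Differentiable ℂ p := by
  obtain ⟨q, rfl⟩ := h.eq_mk
  rw [← differentiableOn_univ, en_differentiable_iff]
  intro i
  exact (mv_eval_differentiable (q i)).differentiableOn

theorem taylor_poly {n : ℕ} {R : ℝ} (hR : 0 < R) (k : ℕ) : ∀ h : En n → ℂ,
    DifferentiableOn ℂ h (ball 0 R) →
    ∃ P : MvPolynomial (Fin n) ℂ, ∀ z : En n,
      iteratedDeriv k (fun l : ℂ => h (l • z)) 0 = MvPolynomial.eval (fun j => z j) P := by
  induction k with
  | zero => intro h _; exact ⟨MvPolynomial.C (h 0), fun z => by simp⟩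
  | succ k ih =>
    intro h hh
    have hd : ∀ i, DifferentiableOn ℂ (fun z => fderiv ℂ h z (EuclideanSpace.single i 1)) (ball 0 R) :=
      fun i c hc => (scv_fderiv_apply_differentiableAt isOpen_ball hh _ hc).differentiableWithinAt
    choose P hP using fun i => ih _ (hd i)
    refine ⟨∑ i, MvPolynomial.X i * P i, fun z => ?_⟩
    have hball : (fun l : ℂ => l • z) ⁻¹' (ball 0 R) ∈ nhds (0:ℂ) := by
      refine (Continuous.continuousAt (by fun_prop)).preimage_mem_nhds ?_
      rw [zero_smul]; exact ball_mem_nhds _ hR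
    have hop : IsOpen ((fun l : ℂ => l • z) ⁻¹' (ball 0 R)) :=
      isOpen_ball.preimage (by fun_prop)
    have hdl : Differentiable ℂ (fun l : ℂ => l • z) := by fun_prop
    rw [iteratedDeriv_succ']
    have heq : deriv (fun l : ℂ => h (l • z)) =ᶠ[nhds 0] fun l => ∑ i, z i *
        fderiv ℂ h (l • z) (EuclideanSpace.single i 1) := by
      filter_upwards [hball] with l hl
      have h1 : HasDerivAt (fun l : ℂ => l • z) z l := by
        simpa using (hasDerivAt_id l).smul_const z
      have h2 := (hh.differentiableAt (isOpen_ball.mem_nhds hl)).hasFDerivAt.comp_hasDerivAt l h1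
      rw [show (fun l : ℂ => h (l • z)) = h ∘ (fun l : ℂ => l • z) from rfl, h2.deriv]
      exact clm_sum_single _ z
    rw [heq.iteratedDeriv_eq]
    have hcd : ∀ i, ContDiffAt ℂ k
        (fun l : ℂ => fderiv ℂ h (l • z) (EuclideanSpace.single i 1)) 0 := by
      intro i
      have : DifferentiableOn ℂ (fun l : ℂ => fderiv ℂ h (l • z) (EuclideanSpace.single i 1))
          ((fun l : ℂ => l • z) ⁻¹' (ball 0 R)) := (hd i).comp hdl.differentiableOn fun l hl => hl
      exact (this.analyticAt hball).contDiffAt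
    rw [iteratedDeriv_fun_sum fun i _ => contDiffAt_const.mul (hcd i)]
    simp only [map_sum, map_mul, MvPolynomial.eval_X]
    refine Finset.sum_congr rfl fun i _ => ?_
    rw [iteratedDeriv_const_mul _ (hcd i), hP]

theorem scalar_poly_approx {n : ℕ} {R r ε : ℝ} (hrR : r < R) (hε : 0 < ε) {h : En n → ℂ}
    (hh : DifferentiableOn ℂ h (ball 0 R)) :
    ∃ P : MvPolynomial (Fin n) ℂ, ∀ z ∈ closedBall (0 : En n) r,
      ‖MvPolynomial.eval (fun j => z j) P - h z‖ ≤ ε := by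
  wlog hr : 0 < r generalizing r
  · rcases le_or_gt R 0 with hR | hR
    · exact ⟨0, fun z hz => by
        rw [mem_closedBall, dist_zero_right] at hz
        linarith [norm_nonneg z]⟩
    · obtain ⟨P, hP⟩ := this (r := R / 2) (by linarith) (by linarith)
      exact ⟨P, fun z hz => hP z (closedBall_subset_closedBall (by linarith) hz)⟩
  have hR : 0 < R := hr.trans hrR
  obtain ⟨R', h1, h2⟩ := exists_between hrR
  have hR' : 0 < R' := hr.trans h1
  obtain ⟨M, hM⟩ := (isCompact_closedBall (0 : En n) R').exists_bound_of_continuousOn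
    (hh.continuousOn.mono (closedBall_subset_ball h2))
  have hM0 : 0 ≤ M := (norm_nonneg _).trans (hM 0 (mem_closedBall_self hR'.le))
  set τ := R' / r
  have hτ : 1 < τ := by rw [one_lt_div hr]; exact h1
  have hτ0 : 0 < τ := one_pos.trans hτ
  choose P hP using fun k => taylor_poly hR k h hh
  have hq : τ⁻¹ < 1 := inv_lt_one_of_one_lt₀ hτ
  have hlim : Tendsto (fun N : ℕ => M * τ⁻¹ ^ N / (1 - τ⁻¹)) atTop (nhds 0) := by
    have := tendsto_pow_atTop_nhds_zero_of_lt_one (inv_nonneg.2 hτ0.le) hq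
    simpa using (this.const_mul M).div_const (1 - τ⁻¹)
  obtain ⟨N, hN⟩ := (hlim.eventually (gt_mem_nhds hε)).exists
  refine ⟨∑ k ∈ Finset.range N, MvPolynomial.C ((k.factorial : ℂ)⁻¹) * P k, fun z hz => ?_⟩
  rw [mem_closedBall, dist_zero_right] at hz
  have hmap : ∀ l : ℂ, ‖l‖ < R / r → l • z ∈ ball (0 : En n) R := by
    intro l hl
    rw [mem_ball, dist_zero_right, norm_smul]
    calc ‖l‖ * ‖z‖ ≤ ‖l‖ * r := by gcongr
      _ < R := by rwa [lt_div_iff₀ hr] at hl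
  have hφ : DifferentiableOn ℂ (fun l : ℂ => h (l • z)) (ball 0 (R / r)) := by
    refine hh.comp (Differentiable.differentiableOn (by fun_prop)) fun l hl => hmap l ?_
    simpa using hl
  have hτR : τ < R / r := by simp only [τ]; gcongr
  have hs := Complex.hasSum_taylorSeries_on_ball hφ (z := 1) (by
    rw [mem_ball, dist_zero_right, norm_one]; exact hτ.trans hτR)
  have hb : ∀ k : ℕ, ‖((k.factorial : ℂ)⁻¹ • ((1:ℂ) - 0) ^ k •
      iteratedDeriv k (fun l : ℂ => h (l • z)) 0)‖ ≤ M * τ⁻¹ ^ k := by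
    intro k
    have := Complex.norm_iteratedDeriv_le_of_forall_mem_sphere_norm_le (C := M) k hτ0
      ((hφ.mono (closedBall_subset_ball hτR)).diffContOnCl_ball subset_rfl) (fun l hl => hM _ (by
        rw [mem_sphere, dist_zero_right] at hl
        rw [mem_closedBall, dist_zero_right, norm_smul, hl]
        calc τ * ‖z‖ ≤ τ * r := by gcongr
          _ = R' := div_mul_cancel₀ _ hr.ne'))
    simp only [sub_zero, one_pow, one_smul, norm_smul, norm_inv, Complex.norm_natCast]
    have hk : (0:ℝ) < k.factorial := by positivity
    rw [inv_mul_le_iff₀ hk]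
    refine this.trans (le_of_eq ?_)
    rw [inv_pow]; ring
  have := norm_sub_le_of_geometric_bound_of_hasSum hq hb hs N
  simp only [one_smul] at this
  refine le_trans (le_of_eq ?_) (this.trans hN.le)
  congr 2
  simp [map_sum, hP]

theorem poly_approx {n : ℕ} {R r ε : ℝ} (hrR : r < R) (hε : 0 < ε) {h : En n → En n}
    (hh : DifferentiableOn ℂ h (ball 0 R)) :
    ∃ p, IsPolyMap n p ∧ ∀ z ∈ closedBall (0 : En n) r, ‖p z - h z‖ ≤ ε := by
  have hh' := en_differentiable_iff.1 hh
  have hε' : 0 < ε / (n + 1) := by positivity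
  choose P hP using fun i => scalar_poly_approx hrR hε' (hh' i)
  refine ⟨mkPoly P, mkPoly_isPoly P, fun z hz => ?_⟩
  refine (en_norm_le_sum _).trans ?_
  calc ∑ i, ‖(mkPoly P z - h z) i‖ ≤ ∑ i : Fin n, ε / (n + 1) := Finset.sum_le_sum fun i _ => hP i z hz
    _ = n * (ε / (n + 1)) := by simp
    _ ≤ ε := by rw [mul_div_assoc', div_le_iff₀ (by positivity)]; nlinarith

end

noncomputable section

theorem persist_min {g : ℂ → ℂ} {c : ℂ} {R m : ℝ} (hR : 0 < R) (hm : 0 < m)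
    (hg : DifferentiableOn ℂ g (closedBall c R)) (hne : ∀ z ∈ closedBall c R, g z ≠ 0)
    (hs : ∀ z ∈ sphere c R, m ≤ ‖g z‖) : m ≤ ‖g c‖ := by
  have hd : DiffContOnCl ℂ (fun z => (g z)⁻¹) (ball c R) :=
    (hg.inv hne).diffContOnCl_ball subset_rfl
  have := Complex.norm_le_of_forall_mem_frontier_norm_le isBounded_ball hd (C := m⁻¹) (fun z hz => by
    rw [frontier_ball c hR.ne'] at hz
    rw [norm_inv]
    exact inv_anti₀ hm (hs z hz)) (subset_closure (mem_ball_self hR))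
  rw [norm_inv] at this
  exact (inv_le_inv₀ (norm_pos_iff.2 (hne c (mem_closedBall_self hR.le))) hm).1 this

theorem persist_zero {g : ℂ → ℂ} {c : ℂ} {R m : ℝ} (hR : 0 < R)
    (hg : DifferentiableOn ℂ g (closedBall c R))
    (hs : ∀ z ∈ sphere c R, m ≤ ‖g z‖) (hc : ‖g c‖ < m) : ∃ z ∈ ball c R, g z = 0 := by
  by_contra! h
  have hm : 0 < m := (norm_nonneg _).trans_lt hc
  have := persist_min hR hm hg (fun z hz => by
    rcases (mem_closedBall.1 hz).lt_or_eq with h1 | h1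
    · exact h z h1
    · intro h0
      have := hs z h1
      rw [h0, norm_zero] at this
      linarith) hs
  linarith

theorem osgood_one {f : ℂ → ℂ} {U : Set ℂ} (hU : IsOpen U) (hf : DifferentiableOn ℂ f U)
    (hi : InjOn f U) {p : ℂ} (hp : p ∈ U) : deriv f p ≠ 0 := by
  intro h0
  obtain ⟨R, hR, hRU⟩ := Metric.nhds_basis_closedBall.mem_iff.1 (hU.mem_nhds hp)
  have hsub : sphere p R ⊆ U := sphere_subset_closedBall.trans hRU
  have hfc : ContinuousOn (fun z => ‖f z - f p‖) (sphere p R) :=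
    ((hf.continuousOn.mono hsub).sub continuousOn_const).norm
  obtain ⟨z0, hz0, hmin⟩ := (isCompact_sphere p R).exists_isMinOn
    (NormedSpace.sphere_nonempty.2 hR.le) hfc
  set m := ‖f z0 - f p‖
  have hm : 0 < m := by
    rw [norm_pos_iff, sub_ne_zero]
    intro he
    have := hi (hsub hz0) hp he
    rw [this, mem_sphere, dist_self] at hz0
    linarith
  have hmin' : ∀ z ∈ sphere p R, m ≤ ‖f z - f p‖ := fun z hz => hmin hz
  have hgd : DifferentiableOn ℂ (dslope f p) U :=
    (Complex.differentiableOn_dslope (hU.mem_nhds hp)).2 hf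
  have hgc : ContinuousAt (dslope f p) p := (hgd.differentiableAt (hU.mem_nhds hp)).continuousAt
  have hg0 : dslope f p p = 0 := by rw [dslope_same, h0]
  have e1 : ∀ᶠ w in nhds p, ‖dslope f p w‖ < m / (4 * R) := by
    have := hgc.norm
    rw [ContinuousAt, hg0, norm_zero] at this
    exact this.eventually (gt_mem_nhds (by positivity))
  have e2 : ∀ᶠ w in nhds p, ‖f w - f p‖ < m / 2 := by
    have : Tendsto (fun w => ‖f w - f p‖) (nhds p) (nhds ‖f p - f p‖) :=
      ((hf.differentiableAt (hU.mem_nhds hp)).continuousAt.sub continuousAt_const).norm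
    rw [sub_self, norm_zero] at this
    exact this.eventually (gt_mem_nhds (by positivity))
  obtain ⟨δ, hδ, hball⟩ := Metric.eventually_nhds_iff_ball.1
    ((e1.and e2).and (ball_mem_nhds p hR))
  -- a nearby point with nonzero derivative
  obtain ⟨w, hw, hdw⟩ : ∃ w ∈ ball p δ, deriv f w ≠ 0 := by
    by_contra! hall
    have hbU : ball p δ ⊆ U := fun w hw => hRU (ball_subset_closedBall (hball w hw).2)
    have hc : ∀ x ∈ ball p δ, ∀ y ∈ ball p δ, f x = f y := fun x hx y hy =>
      IsOpen.is_const_of_deriv_eq_zero (s := ball p δ) isOpen_ball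
      (convex_ball p δ).isPreconnected (hf.mono hbU) (fun w hw => hall w hw) hx hy
    have hq : p + (δ / 2 : ℝ) ∈ ball p δ := by
      rw [mem_ball, dist_eq_norm, add_sub_cancel_left, Complex.norm_real, Real.norm_of_nonneg (by positivity)]
      linarith
    have := hi (hbU hq) hp (hc _ hq _ (mem_ball_self hδ))
    have h2 : ((δ / 2 : ℝ) : ℂ) = 0 := by simpa using this
    rw [Complex.ofReal_eq_zero] at h2
    linarith
  have hwp : w ≠ p := by rintro rfl; exact hdw h0
  obtain ⟨⟨hw1, hw2⟩, hwR⟩ := hball w hw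
  have hwU : w ∈ U := hRU (ball_subset_closedBall hwR)
  have hdd : DifferentiableOn ℂ (dslope f w) (closedBall p R) :=
    ((Complex.differentiableOn_dslope (hU.mem_nhds hwU)).2 hf).mono hRU
  have := persist_min (m := m / (4 * R)) hR (by positivity) hdd ?_ ?_
  · rw [dslope_of_ne _ hwp.symm, slope_comm, ← dslope_of_ne _ hwp] at this
    linarith
  · intro z hz
    by_cases hzw : z = w
    · rw [hzw, dslope_same]; exact hdw
    · rw [dslope_of_ne _ hzw, slope_def_field]
      refine div_ne_zero (sub_ne_zero.2 fun he => hzw (hi (hRU hz) hwU he)) (sub_ne_zero.2 hzw)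
  · intro z hz
    have hzw : z ≠ w := by
      rintro rfl
      rw [mem_sphere] at hz; linarith
    rw [dslope_of_ne _ hzw, slope_def_field, norm_div, div_le_div_iff₀ (by positivity)
      (norm_pos_iff.2 (sub_ne_zero.2 hzw))]
    have h1 : m / 2 ≤ ‖f z - f w‖ := by
      have h3 := hmin' z hz
      have h4 : ‖f z - f p‖ ≤ ‖f z - f w‖ + ‖f w - f p‖ := by
        simpa using norm_add_le (f z - f w) (f w - f p)
      linarith
    have h2 : ‖z - w‖ ≤ 2 * R := by
      rw [← dist_eq_norm]
      have := dist_triangle z p w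
      rw [mem_sphere] at hz; rw [dist_comm] at hwR
      linarith
    nlinarith [norm_nonneg (z - w)]

end

noncomputable section

section Osg
variable {E F : Type*} [NormedAddCommGroup E] [NormedSpace ℂ E] [FiniteDimensional ℂ E]
  [NormedAddCommGroup F] [NormedSpace ℂ F] [FiniteDimensional ℂ F]

theorem scv_local_inverse {f : E → F} {U : Set E} (hU : IsOpen U) (hf : DifferentiableOn ℂ f U)
    {p : E} (hp : p ∈ U) (e : E ≃L[ℂ] F) (he : HasFDerivAt f (e : E →L[ℂ] F) p) :
    ∃ (V : Set F) (θ : F → E), IsOpen V ∧ f p ∈ V ∧ θ (f p) = p ∧ MapsTo θ V U ∧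
      DifferentiableOn ℂ θ V ∧ (∀ y ∈ V, f (θ y) = y) ∧ HasFDerivAt θ (e.symm : F →L[ℂ] E) (f p) := by
  have : CompleteSpace E := FiniteDimensional.complete ℂ E
  have : CompleteSpace F := FiniteDimensional.complete ℂ F
  have hc : ContDiffAt ℂ 1 f p := scv_contDiffAt hU hf hp
  have hn : (1 : WithTop ℕ∞) ≠ 0 := by norm_num
  have hs : HasStrictFDerivAt f (e : E →L[ℂ] F) p := hc.hasStrictFDerivAt' he hn
  set θ := hs.localInverse f e p
  have h0 : θ (f p) = p := hs.localInverse_apply_image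
  have h1 : HasStrictFDerivAt θ (e.symm : F →L[ℂ] E) (f p) := hs.to_localInverse
  have h2 : ∀ᶠ y in nhds (f p), f (θ y) = y := hs.eventually_right_inverse
  have h3 : ContDiffAt ℂ 1 θ (f p) := hc.to_localInverse he hn
  have h4 : ∀ᶠ y in nhds (f p), DifferentiableAt ℂ θ y := by
    filter_upwards [h3.eventually (by simp)] with y hy using hy.differentiableAt hn
  have h5 : ∀ᶠ y in nhds (f p), θ y ∈ U := by
    have := h1.continuousAt
    rw [ContinuousAt, h0] at this
    exact this.eventually (hU.mem_nhds hp)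
  obtain ⟨V, hV, hVo, hpV⟩ := _root_.eventually_nhds_iff.1 (h2.and (h4.and h5))
  exact ⟨V, θ, hVo, hpV, h0, fun y hy => (hV y hy).2.2,
    fun y hy => (hV y hy).2.1.differentiableWithinAt, fun y hy => (hV y hy).1, h1.hasFDerivAt⟩

end Osg

section OsgRank
variable {E F : Type} [NormedAddCommGroup E] [NormedSpace ℂ E] [FiniteDimensional ℂ E]
  [NormedAddCommGroup F] [NormedSpace ℂ F] [FiniteDimensional ℂ F]

/-- The theorem of Osgood in dimension `d`. -/
def OsgoodDim (d : ℕ) : Prop :=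
  ∀ (E F : Type) [NormedAddCommGroup E] [NormedSpace ℂ E] [FiniteDimensional ℂ E]
    [NormedAddCommGroup F] [NormedSpace ℂ F] [FiniteDimensional ℂ F],
    Module.finrank ℂ E = d → Module.finrank ℂ F = d → ∀ (f : E → F) (U : Set E), IsOpen U →
    DifferentiableOn ℂ f U → InjOn f U → ∀ p ∈ U, Function.Injective (fderiv ℂ f p)

theorem osgood_rank {d : ℕ} (hd : OsgoodDim d) (hE : Module.finrank ℂ E = d + 1)
    (hF : Module.finrank ℂ F = d + 1) {f : E → F} {U : Set E} (hU : IsOpen U)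
    (hf : DifferentiableOn ℂ f U) (hi : InjOn f U) {p : E} (hp : p ∈ U)
    (h0 : fderiv ℂ f p ≠ 0) : Function.Injective (fderiv ℂ f p) := by
  set A := fderiv ℂ f p with hA
  have hfp : HasFDerivAt f A p := (hf.differentiableAt (hU.mem_nhds hp)).hasFDerivAt
  obtain ⟨v0, hv0⟩ : ∃ v, A v ≠ 0 := by
    by_contra! h
    exact h0 (ContinuousLinearMap.ext h)
  obtain ⟨ℓ, hℓ⟩ := SeparatingDual.exists_eq_one (R := ℂ) hv0
  set lam : E →L[ℂ] ℂ := ℓ.comp A with hlam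
  have hlv : lam v0 = 1 := hℓ
  set Ψ : E → E := fun z => z + (ℓ (f z) - ℓ (f p) - lam (z - p)) • v0 with hΨ
  have hΨd : DifferentiableOn ℂ Ψ U := by
    refine differentiableOn_id.add (DifferentiableOn.smul_const (DifferentiableOn.sub
      (DifferentiableOn.sub_const (ℓ.differentiable.comp_differentiableOn hf) _) ?_) _)
    exact (lam.differentiable.comp (differentiable_id.sub_const p)).differentiableOn
  have hΨp : Ψ p = p := by simp [hΨ]
  have hΨ' : HasFDerivAt Ψ ((ContinuousLinearEquiv.refl ℂ E : E ≃L[ℂ] E) : E →L[ℂ] E) p := by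
    have h1 : HasFDerivAt (fun z => ℓ (f z)) lam p := ℓ.hasFDerivAt.comp p hfp
    have h2 : HasFDerivAt (fun z => lam (z - p)) lam p :=
      HasFDerivAt.comp (g := lam) p lam.hasFDerivAt ((hasFDerivAt_id p).sub_const p)
    have h3 := (hasFDerivAt_id p).add (((h1.sub_const (ℓ (f p))).sub h2).smul_const v0)
    have h4 : ((ContinuousLinearEquiv.refl ℂ E : E ≃L[ℂ] E) : E →L[ℂ] E) =
        ContinuousLinearMap.id ℂ E + (lam - lam).smulRight v0 := by
      ext w
      simp
    rw [h4]
    exact h3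
  have hlΨ : ∀ z, lam (Ψ z - p) = ℓ (f z) - ℓ (f p) := by
    intro z
    simp only [hΨ]
    rw [show z + (ℓ (f z) - ℓ (f p) - lam (z - p)) • v0 - p
      = (z - p) + (ℓ (f z) - ℓ (f p) - lam (z - p)) • v0 by abel, map_add, map_smul, hlv]
    simp
  obtain ⟨V, θ, hVo, hpV, hθp, hθU, hθd, hΨθ, hθ'⟩ := scv_local_inverse hU hΨd hp _ hΨ'
  rw [hΨp] at hpV hθp hθ'
  have hl0 : lam ≠ 0 := by intro h; rw [h] at hlv; simp at hlv
  have hℓ0 : ℓ ≠ 0 := by intro h; rw [h] at hℓ; simp at hℓ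
  let K := LinearMap.ker (lam : E →ₗ[ℂ] ℂ)
  let L := LinearMap.ker (ℓ : F →ₗ[ℂ] ℂ)
  have hK : Module.finrank ℂ K = d := by
    have := Module.Dual.finrank_ker_add_one_of_ne_zero (f := (lam : E →ₗ[ℂ] ℂ))
      (fun h => hl0 (ContinuousLinearMap.coe_injective h))
    change _ = d
    have h' : Module.finrank ℂ K + 1 = Module.finrank ℂ E := this
    omega
  have hL : Module.finrank ℂ L = d := by
    have := Module.Dual.finrank_ker_add_one_of_ne_zero (f := (ℓ : F →ₗ[ℂ] ℂ))
      (fun h => hℓ0 (ContinuousLinearMap.coe_injective h))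
    have h' : Module.finrank ℂ L + 1 = Module.finrank ℂ F := this
    omega
  let Pi0 : F →L[ℂ] F := ContinuousLinearMap.id ℂ F - ℓ.smulRight (A v0)
  have hPi0 : ∀ y, Pi0 y = y - ℓ y • A v0 := fun y => rfl
  let Pi : F →L[ℂ] L := Pi0.codRestrict L (fun y => by
    change ℓ (Pi0 y) = 0
    rw [hPi0, map_sub, map_smul, hℓ]; simp)
  have hPi : ∀ y, (Pi y : F) = y - ℓ y • A v0 := fun y => rfl
  let ft : K → L := fun k => Pi (f (θ (p + k)) - f p)
  let V' : Set K := (fun k : K => p + (k : E)) ⁻¹' V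
  have hV'o : IsOpen V' := hVo.preimage (by fun_prop)
  have h0V : (0 : K) ∈ V' := by simp [V', hpV]
  have hKd : Differentiable ℂ (fun k : K => p + (k : E)) :=
    (K.subtypeL.differentiable).const_add p
  have hftd : DifferentiableOn ℂ ft V' := by
    refine Pi.differentiable.comp_differentiableOn (DifferentiableOn.sub_const ?_ _)
    refine hf.comp (hθd.comp hKd.differentiableOn fun k hk => hk) fun k hk => hθU hk
  have hℓk : ∀ k ∈ V', ℓ (f (θ (p + k)) - f p) = 0 := by
    intro k hk
    have := hlΨ (θ (p + k))
    rw [hΨθ _ hk, add_sub_cancel_left] at this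
    rw [map_sub, ← this]
    exact k.2
  have hfti : InjOn ft V' := by
    intro k hk k' hk' he
    have h1 : (ft k : F) = ft k' := by rw [he]
    simp only [ft, hPi, hℓk k hk, hℓk k' hk', zero_smul, sub_zero] at h1
    have h2 := hi (hθU hk) (hθU hk') (sub_left_injective h1)
    have h3 : p + (k : E) = p + k' := by
      have a1 : Ψ (θ (p + k)) = p + k := hΨθ _ hk
      have a2 : Ψ (θ (p + k')) = p + k' := hΨθ _ hk'
      rw [← a1, ← a2, h2]
    exact Subtype.ext (add_left_cancel h3)
  have hinj := hd K L hK hL ft V' hV'o hftd hfti 0 h0V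
  have hft' : HasFDerivAt ft (Pi.comp (A.comp K.subtypeL)) 0 := by
    have e1 : HasFDerivAt (fun k : K => p + (k : E)) K.subtypeL 0 :=
      K.subtypeL.hasFDerivAt.const_add p
    have e2 : HasFDerivAt θ (ContinuousLinearMap.id ℂ E) (p + ((0 : K) : E)) := by
      simpa using hθ'
    have e3 := e2.comp (0 : K) e1
    have e4 : HasFDerivAt f A ((θ ∘ fun k : K => p + (k : E)) 0) := by
      simpa [hθp] using hfp
    have e5 := (e4.comp (0 : K) e3).sub_const (f p)
    exact Pi.hasFDerivAt.comp (0 : K) e5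
  rw [hft'.fderiv] at hinj
  rw [injective_iff_map_eq_zero]
  intro w hw
  have hwK : w ∈ K := by
    change ℓ (A w) = 0
    rw [hw, map_zero]
  have := hinj (a₁ := ⟨w, hwK⟩) (a₂ := 0) (by
    change Pi (A w) = Pi (A 0)
    rw [hw, map_zero]; simp)
  exact congrArg Subtype.val this

end OsgRank
end

noncomputable section

section Dir
variable {E : Type*} [NormedAddCommGroup E] [NormedSpace ℂ E]

/-- Iterated directional derivatives. -/
def dirIter (h : E → ℂ) (e : E) : ℕ → E → ℂ
  | 0 => h
  | (j + 1) => fun z => fderiv ℂ (dirIter h e j) z e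

theorem dirIter_diff {h : E → ℂ} {U : Set E} (hU : IsOpen U) (hh : DifferentiableOn ℂ h U) (e : E)
    (j : ℕ) : DifferentiableOn ℂ (dirIter h e j) U := by
  induction j with
  | zero => exact hh
  | succ j ih =>
    intro z hz
    exact (scv_fderiv_apply_differentiableAt hU ih e hz).differentiableWithinAt

theorem line_open {U : Set E} (hU : IsOpen U) (q e : E) : IsOpen {t : ℂ | q + t • e ∈ U} :=
  hU.preimage (f := fun t : ℂ => q + t • e) (by fun_prop)

theorem line_diff {h : E → ℂ} {U : Set E} (hh : DifferentiableOn ℂ h U) (q e : E) :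
    DifferentiableOn ℂ (fun t : ℂ => h (q + t • e)) {t : ℂ | q + t • e ∈ U} :=
  hh.comp (Differentiable.differentiableOn (by fun_prop)) fun _ ht => ht

theorem dirIter_line {h : E → ℂ} {U : Set E} (hU : IsOpen U) (hh : DifferentiableOn ℂ h U) (e q : E)
    (j : ℕ) : ∀ t : ℂ, q + t • e ∈ U →
      iteratedDeriv j (fun t : ℂ => h (q + t • e)) t = dirIter h e j (q + t • e) := by
  induction j with
  | zero => intro t _; simp [dirIter]
  | succ j ih =>
    intro t ht
    rw [iteratedDeriv_succ]
    have heq : iteratedDeriv j (fun t : ℂ => h (q + t • e)) =ᶠ[nhds t]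
        fun t => dirIter h e j (q + t • e) := by
      filter_upwards [(line_open hU q e).mem_nhds ht] with s hs using ih s hs
    rw [heq.deriv_eq]
    have h1 : HasDerivAt (fun t : ℂ => q + t • e) e t := by
      simpa using ((hasDerivAt_id t).smul_const e).const_add q
    exact (((dirIter_diff hU hh e j).differentiableAt (hU.mem_nhds ht)).hasFDerivAt.comp_hasDerivAt
      t h1).deriv

end Dir

section Zero
variable {E F : Type*} [NormedAddCommGroup E] [NormedSpace ℂ E] [FiniteDimensional ℂ E]
  [NormedAddCommGroup F] [NormedSpace ℂ F] [FiniteDimensional ℂ F]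

theorem jac_det {f : E → F} {U : Set E} (hU : IsOpen U) (hf : DifferentiableOn ℂ f U)
    (hdim : Module.finrank ℂ E = Module.finrank ℂ F) (hpos : 0 < Module.finrank ℂ E) :
    ∃ h : E → ℂ, DifferentiableOn ℂ h U ∧ (∀ z, fderiv ℂ f z = 0 → h z = 0) ∧
      ∀ z, h z = 0 → ¬ Function.Injective (fderiv ℂ f z) := by
  have : CompleteSpace F := FiniteDimensional.complete ℂ F
  let bE := Module.finBasis ℂ E
  let bF : Module.Basis (Fin (Module.finrank ℂ E)) ℂ F :=
    (Module.finBasis ℂ F).reindex (finCongr hdim.symm)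
  let M : E → Matrix (Fin (Module.finrank ℂ E)) (Fin (Module.finrank ℂ E)) ℂ :=
    fun z => Matrix.of fun i j => bF.coord i (fderiv ℂ f z (bE j))
  refine ⟨fun z => (M z).det, ?_, ?_, ?_⟩
  · simp only [Matrix.det_apply]
    refine DifferentiableOn.fun_sum fun σ _ => ?_
    have hpr : DifferentiableOn ℂ (fun z => ∏ i, M z (σ i) i) U := ?_
    · exact hpr.const_smul (Equiv.Perm.sign σ)
    have hfac : ∀ i z, z ∈ U → DifferentiableAt ℂ (fun z => M z (σ i) i) z := ?_
    · intro z hz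
      exact (HasFDerivAt.finsetProd (g := fun i z => M z (σ i) i)
        fun i _ => (hfac i z hz).hasFDerivAt).differentiableAt.differentiableWithinAt
    intro i z hz
    exact ((LinearMap.toContinuousLinearMap (bF.coord (σ i))).differentiableAt).comp z
      (scv_fderiv_apply_differentiableAt hU hf (bE i) hz)
  · intro z hz
    have : M z = 0 := by ext i j; simp [M, hz]
    have hne : Nonempty (Fin (Module.finrank ℂ E)) := ⟨⟨0, hpos⟩⟩
    change (M z).det = 0
    rw [this, Matrix.det_zero]
  · intro z hz hinj
    obtain ⟨v, hv, hMv⟩ := Matrix.exists_mulVec_eq_zero_iff.2 hz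
    have h1 : fderiv ℂ f z (∑ j, v j • bE j) = 0 := by
      apply bF.ext_elem
      intro i
      have := congrFun hMv i
      simp only [Matrix.mulVec, dotProduct, M, Matrix.of_apply, Pi.zero_apply] at this
      simp only [map_sum, map_smul, map_zero, Finsupp.coe_zero, Pi.zero_apply]
      rw [← this, Finsupp.finsetSum_apply]
      refine Finset.sum_congr rfl fun j _ => ?_
      simp [mul_comm]
    have h2 := hinj (h1.trans (map_zero _).symm)
    apply hv
    funext j
    exact Fintype.linearIndependent_iff.1 bE.linearIndependent v h2 j

theorem osgood_zero (h2 : 2 ≤ Module.finrank ℂ E) (hdim : Module.finrank ℂ E = Module.finrank ℂ F)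
    {f : E → F} {U : Set E} (hU : IsOpen U)
    (hf : DifferentiableOn ℂ f U) (hi : InjOn f U) 
    (hrank : ∀ q ∈ U, fderiv ℂ f q ≠ 0 → Function.Injective (fderiv ℂ f q))
    {p : E} (hp : p ∈ U) (h0 : fderiv ℂ f p = 0) : False := by
  obtain ⟨h, hhd, hh0, hh1⟩ := jac_det hU hf hdim (by omega)
  have hhz : ∀ q ∈ U, h q = 0 → fderiv ℂ f q = 0 := by
    intro q hq hz
    by_contra hne
    exact hh1 q hz (hrank q hq hne)
  obtain ⟨R, hR, hRU⟩ := Metric.isOpen_iff.1 hU p hp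
  have hnt : Nontrivial E := Module.finrank_pos_iff.1 (by omega : 0 < Module.finrank ℂ E)
  -- a nearby point with nonzero determinant
  obtain ⟨y, hy, hhy⟩ : ∃ y ∈ ball p R, h y ≠ 0 := by
    by_contra! hall
    have hc : ∀ y ∈ ball p R, f y = f p := by
      intro y hy
      refine (convex_ball p R).is_const_of_fderivWithin_eq_zero (𝕜 := ℂ) (hf.mono hRU) ?_ hy (mem_ball_self hR)
      intro z hz
      rw [fderivWithin_of_isOpen isOpen_ball hz]
      exact hhz z (hRU hz) (hall z hz)
    obtain ⟨v, hv⟩ := exists_ne (0 : E)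
    have hvn : 0 < ‖v‖ := norm_pos_iff.2 hv
    have hy : p + ((R / 2 / ‖v‖ : ℝ) : ℂ) • v ∈ ball p R := by
      rw [mem_ball, dist_eq_norm, add_sub_cancel_left, norm_smul, Complex.norm_real,
        Real.norm_of_nonneg (by positivity), div_mul_cancel₀ _ hvn.ne']
      linarith
    have := hi (hRU hy) hp (hc _ hy)
    have h3 : ((R / 2 / ‖v‖ : ℝ) : ℂ) • v = 0 := by simpa using this
    rcases smul_eq_zero.1 h3 with h4 | h4
    · rw [Complex.ofReal_eq_zero] at h4
      have : 0 < R / 2 / ‖v‖ := by positivity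
      linarith
    · exact hv h4
  have hph : h p = 0 := hh0 p h0
  set e := y - p with he
  have hen : 0 < ‖e‖ := by
    rw [norm_pos_iff, he, sub_ne_zero]
    rintro rfl; exact hhy hph
  have hex : ∃ j, ∃ q ∈ U, h q = 0 ∧ dirIter h e j q ≠ 0 := by
    by_contra! hall
    have hd : DifferentiableOn ℂ (fun t : ℂ => h (p + t • e)) (ball 0 (R / ‖e‖)) := by
      refine (line_diff hhd p e).mono fun t ht => hRU ?_
      rw [mem_ball, dist_zero_right, lt_div_iff₀ hen] at ht
      rwa [mem_ball, dist_eq_norm, add_sub_cancel_left, norm_smul]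
    have hs := Complex.hasSum_taylorSeries_on_ball hd (z := 1) (by
      rw [mem_ball, dist_zero_right, norm_one, lt_div_iff₀ hen, one_mul, he, ← dist_eq_norm]
      exact hy)
    have hz : ∀ j, iteratedDeriv j (fun t : ℂ => h (p + t • e)) 0 = 0 := by
      intro j
      rw [dirIter_line hU hhd e p j 0 (by simpa using hp)]
      simpa using hall j p hp hph
    simp only [hz, smul_zero] at hs
    have := hs.unique hasSum_zero
    rw [one_smul, he, add_sub_cancel] at this
    exact hhy this
  classical
  obtain ⟨q, hq, hhq, hgm⟩ := Nat.find_spec hex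
  have hmin : ∀ j < Nat.find hex, ∀ q ∈ U, h q = 0 → dirIter h e j q = 0 := by
    intro j hj q hq hz
    by_contra hne
    exact Nat.find_min hex hj ⟨q, hq, hz, hne⟩
  rcases hm : Nat.find hex with _ | m
  · rw [hm] at hgm; exact hgm hhq
  rw [hm] at hgm hmin
  set G := dirIter h e m with hG
  have hGd : DifferentiableOn ℂ G U := dirIter_diff hU hhd e m
  have hGz : ∀ q ∈ U, h q = 0 → G q = 0 := hmin m (Nat.lt_succ_self m)
  have hGe : fderiv ℂ G q e ≠ 0 := hgm
  set B := fderiv ℂ G q with hB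
  have hstrict : HasStrictFDerivAt G B q := scv_strict hU hGd hq
  -- second direction
  obtain ⟨e', he'⟩ : ∃ e' : E, e' ∉ Submodule.span ℂ {e} := by
    by_contra! hall
    have htop : Submodule.span ℂ {e} = ⊤ := Submodule.eq_top_iff'.2 hall
    have := finrank_span_singleton (K := ℂ) (norm_pos_iff.1 hen)
    rw [htop, finrank_top] at this
    omega
  set c := ‖B e‖ with hc
  have hcp : 0 < c := norm_pos_iff.2 hGe
  -- strict differentiability with constant η
  set η := c / (2 * ‖e‖) with hη
  have hηp : 0 < η := by positivity
  have hst := hstrict.isLittleO.def hηp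
  rw [nhds_prod_eq] at hst
  obtain ⟨W, hW, hWW⟩ := (Filter.eventually_prod_self_iff (r := fun x y => ‖G x - G y - B (x - y)‖ ≤ η * ‖x - y‖)).1 hst
  obtain ⟨r, hr, hrW⟩ := Metric.mem_nhds_iff.1 (Filter.inter_mem hW (hU.mem_nhds hq))
  -- isolated zero on the line
  have hline : AnalyticAt ℂ (fun t : ℂ => h (q + t • e)) 0 :=
    (line_diff hhd q e).analyticAt ((line_open hU q e).mem_nhds (by simpa using hq))
  have hiso : ∀ᶠ t in nhdsWithin (0:ℂ) {0}ᶜ, h (q + t • e) ≠ 0 := by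
    rcases hline.eventually_eq_zero_or_eventually_ne_zero with hz | hz
    · exfalso
      have h1 : (fun t : ℂ => h (q + t • e)) =ᶠ[nhds 0] fun _ => 0 := hz
      have h2 := h1.iteratedDeriv_eq (m + 1)
      rw [dirIter_line hU hhd e q (m + 1) 0 (by simpa using hq)] at h2
      apply hgm
      simpa [iteratedDeriv_const] using h2
    · exact hz
  rw [eventually_nhdsWithin_iff, Metric.eventually_nhds_iff_ball] at hiso
  obtain ⟨δ0, hδ0, hiso⟩ := hiso
  set τ := min (δ0 / 2) (r / (4 * ‖e‖)) with hτ
  have hτ0 : 0 < τ := lt_min (by positivity) (by positivity)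
  have hτ1 : τ < δ0 := (min_le_left _ _).trans_lt (by linarith)
  have hτ2 : τ * ‖e‖ ≤ r / 4 := by
    have : τ ≤ r / (4 * ‖e‖) := min_le_right _ _
    calc τ * ‖e‖ ≤ r / (4 * ‖e‖) * ‖e‖ := by gcongr
      _ = r / 4 := by field_simp
  have he'n : 0 < ‖e'‖ := by
    rw [norm_pos_iff]; rintro rfl; exact he' (zero_mem _)
  have hin : ∀ s t : ℂ, ‖s‖ * ‖e'‖ ≤ r / 4 → ‖t‖ ≤ τ → q + s • e' + t • e ∈ ball q r := by
    intro s t hs ht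
    rw [mem_ball, dist_eq_norm, show q + s • e' + t • e - q = s • e' + t • e by abel]
    have h1 : ‖t‖ * ‖e‖ ≤ r / 4 := le_trans (by gcongr) hτ2
    calc ‖s • e' + t • e‖ ≤ ‖s • e'‖ + ‖t • e‖ := norm_add_le _ _
      _ ≤ r / 4 + r / 4 := by rw [norm_smul, norm_smul]; linarith
      _ < r := by linarith
  have hcontU : ContinuousOn h U := hhd.continuousOn
  -- minimum on the circle
  have hcs : ContinuousOn (fun t : ℂ => ‖h (q + t • e)‖) (sphere 0 τ) := by
    refine (hcontU.comp (Continuous.continuousOn (by fun_prop)) fun t ht => ?_).norm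
    have := hin 0 t (by simp; positivity) (by simpa using ht.le)
    simp only [zero_smul, add_zero] at this
    exact (hrW this).2
  obtain ⟨t0, ht0, htmin⟩ := (isCompact_sphere (0:ℂ) τ).exists_isMinOn
    (NormedSpace.sphere_nonempty.2 hτ0.le) hcs
  set m0 := ‖h (q + t0 • e)‖ with hm0
  have hm0p : 0 < m0 := by
    rw [hm0, norm_pos_iff]
    rw [mem_sphere, dist_zero_right] at ht0
    refine hiso t0 (by rw [mem_ball, dist_zero_right, ht0]; exact hτ1) ?_
    intro h
    have : t0 = 0 := h
    rw [this, norm_zero] at ht0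
    linarith
  -- uniform continuity in s
  have hunif : ∀ᶠ s in nhds (0:ℂ), ∀ t ∈ closedBall (0:ℂ) τ,
      ‖h (q + s • e' + t • e) - h (q + t • e)‖ < m0 / 2 := by
    refine IsCompact.eventually_forall_of_forall_eventually (isCompact_closedBall _ _) ?_
    intro t ht
    have hmem : q + t • e ∈ U := by
      have := hin 0 t (by simp; positivity) (by simpa using ht)
      simp only [zero_smul, add_zero] at this
      exact (hrW this).2
    have hca : ContinuousAt h (q + t • e) := hcontU.continuousAt (hU.mem_nhds hmem)
    have h1 : ContinuousAt (fun x : ℂ × ℂ => h (q + x.1 • e' + x.2 • e)) (0, t) := by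
      refine ContinuousAt.comp (g := h) (f := fun x : ℂ × ℂ => q + x.1 • e' + x.2 • e) ?_ (by fun_prop)
      simpa using hca
    have h2 : ContinuousAt (fun x : ℂ × ℂ => h (q + x.2 • e)) (0, t) :=
      ContinuousAt.comp (g := h) (f := fun x : ℂ × ℂ => q + x.2 • e) hca (by fun_prop)
    have h3 := (h1.sub h2).norm
    have h4 : ‖h (q + (0:ℂ) • e' + t • e) - h (q + t • e)‖ < m0 / 2 := by
      simp; positivity
    exact h3.eventually (gt_mem_nhds h4)
  obtain ⟨δ, hδ, hδu⟩ := Metric.eventually_nhds_iff_ball.1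
    (hunif.and (ball_mem_nhds (0:ℂ) (show 0 < r / (4 * ‖e'‖) by positivity)))
  have hsr : ∀ s ∈ ball (0:ℂ) δ, ‖s‖ * ‖e'‖ ≤ r / 4 := by
    intro s hs
    have := (hδu s hs).2
    rw [dist_zero_right] at this
    calc ‖s‖ * ‖e'‖ ≤ r / (4 * ‖e'‖) * ‖e'‖ := by gcongr
      _ = r / 4 := by field_simp
  have hzero : ∀ s ∈ ball (0:ℂ) δ, ∃ t ∈ ball (0:ℂ) τ, h (q + s • e' + t • e) = 0 := by
    intro s hs
    refine persist_zero (g := fun t => h (q + s • e' + t • e)) (m := m0 / 2) hτ0 ?_ ?_ ?_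
    · refine (line_diff hhd (q + s • e') e).mono fun t ht => ?_
      exact (hrW (hin s t (hsr s hs) (by simpa using ht))).2
    · intro t ht
      have h1 := (hδu s hs).1 t (sphere_subset_closedBall ht)
      have h2 : m0 ≤ ‖h (q + t • e)‖ := htmin ht
      have h3 := norm_sub_norm_le (h (q + t • e)) (h (q + s • e' + t • e))
      rw [norm_sub_rev] at h3
      linarith
    · have h1 := (hδu s hs).1 0 (mem_closedBall_self hτ0.le)
      simpa [hhq] using h1
  choose! T hT hTz using hzero
  set γ : ℂ → E := fun s => q + s • e' + T s • e with hγ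
  have hγr : ∀ s ∈ ball (0:ℂ) δ, γ s ∈ ball q r := fun s hs =>
    hin s (T s) (hsr s hs) (by have := hT s hs; rw [mem_ball, dist_zero_right] at this; exact this.le)
  have hγU : ∀ s ∈ ball (0:ℂ) δ, γ s ∈ U := fun s hs => (hrW (hγr s hs)).2
  have hTlip : ∃ C : ℝ, 0 ≤ C ∧ ∀ s ∈ ball (0:ℂ) δ, ∀ s' ∈ ball (0:ℂ) δ, ‖T s - T s'‖ ≤ C * ‖s - s'‖ := by
    refine ⟨(‖B e'‖ + η * ‖e'‖) / (c / 2), by positivity, fun s hs s' hs' => ?_⟩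
    have h1 := hWW (γ s) (hrW (hγr s hs)).1 (γ s') (hrW (hγr s' hs')).1
    simp only [hGz _ (hγU s hs) (hTz s hs), hGz _ (hγU s' hs') (hTz s' hs')] at h1
    have h2 : γ s - γ s' = (s - s') • e' + (T s - T s') • e := by
      simp only [hγ]; module
    rw [h2, map_add, map_smul, map_smul, sub_zero, zero_sub, norm_neg] at h1
    have h3 : ‖(T s - T s') • B e‖ ≤ ‖(s - s') • B e' + (T s - T s') • B e‖ + ‖(s - s') • B e'‖ := by
      have := norm_sub_le ((s - s') • B e' + (T s - T s') • B e) ((s - s') • B e')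
      rwa [add_sub_cancel_left] at this
    have h4 := norm_add_le ((s - s') • e') ((T s - T s') • e)
    rw [norm_smul (T s - T s') (B e), norm_smul (s - s') (B e')] at h3
    rw [norm_smul, norm_smul] at h4
    have h5 : η * ‖e‖ = c / 2 := by simp only [hη]; field_simp
    have h6 : η * ‖(s - s') • e' + (T s - T s') • e‖ ≤ η * (‖s - s'‖ * ‖e'‖) + ‖T s - T s'‖ * (c / 2) := by
      calc _ ≤ η * (‖s - s'‖ * ‖e'‖ + ‖T s - T s'‖ * ‖e‖) := by gcongr
        _ = _ := by rw [← h5]; ring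
    rw [div_mul_eq_mul_div, le_div_iff₀ (by positivity)]
    change ‖T s - T s'‖ * c ≤ _ at h3
    nlinarith
  obtain ⟨C, hC0, hC⟩ := hTlip
  have hγlip : ∀ s ∈ ball (0:ℂ) δ, ∀ s' ∈ ball (0:ℂ) δ,
      ‖γ s - γ s'‖ ≤ (‖e'‖ + C * ‖e‖) * ‖s - s'‖ := by
    intro s hs s' hs'
    have h2 : γ s - γ s' = (s - s') • e' + (T s - T s') • e := by
      simp only [hγ]; module
    rw [h2]
    refine (norm_add_le _ _).trans ?_
    rw [norm_smul, norm_smul]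
    have := mul_le_mul_of_nonneg_right (hC s hs s' hs') hen.le
    nlinarith
  have hder : ∀ s ∈ ball (0:ℂ) δ, HasDerivAt (fun s => f (γ s)) 0 s := by
    intro s hs
    rw [hasDerivAt_iff_isLittleO]
    have hD : HasFDerivAt f (0 : E →L[ℂ] F) (γ s) := by
      rw [← hhz _ (hγU s hs) (hTz s hs)]
      exact (hf.differentiableAt (hU.mem_nhds (hγU s hs))).hasFDerivAt
    have hO : (fun s' => γ s' - γ s) =O[nhds s] fun s' => s' - s := by
      refine Asymptotics.IsBigO.of_bound (‖e'‖ + C * ‖e‖) ?_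
      filter_upwards [isOpen_ball.mem_nhds hs] with s' hs' using hγlip s' hs' s hs
    have hct : Tendsto γ (nhds s) (nhds (γ s)) := by
      rw [← sub_self s |> fun _ => tendsto_sub_nhds_zero_iff]
      refine hO.trans_tendsto ?_
      rw [tendsto_sub_nhds_zero_iff]; exact tendsto_id
    have := (hD.isLittleO.comp_tendsto hct).trans_isBigO hO
    simpa [Function.comp_def] using this
  have hconst : f (γ 0) = f (γ ((δ / 2 : ℝ) : ℂ)) := by
    refine IsOpen.is_const_of_deriv_eq_zero (𝕜 := ℂ) (f := fun s => f (γ s)) (s := ball (0:ℂ) δ)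
      isOpen_ball (convex_ball _ _).isPreconnected
      (fun s hs => (hder s hs).differentiableAt.differentiableWithinAt)
      (fun s hs => (hder s hs).deriv) (mem_ball_self hδ) ?_
    rw [mem_ball, dist_zero_right, Complex.norm_real, Real.norm_of_nonneg (by positivity)]
    linarith
  have hmem2 : ((δ / 2 : ℝ) : ℂ) ∈ ball (0:ℂ) δ := by
    rw [mem_ball, dist_zero_right, Complex.norm_real, Real.norm_of_nonneg (by positivity)]
    linarith
  have heq := hi (hγU 0 (mem_ball_self hδ)) (hγU _ hmem2) hconst
  simp only [hγ, zero_smul, add_zero] at heq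
  have h5 : ((δ / 2 : ℝ) : ℂ) • e' = (T 0 - T ((δ / 2 : ℝ) : ℂ)) • e := by
    rw [sub_smul, eq_sub_iff_add_eq]
    have : q + T 0 • e = q + (((δ / 2 : ℝ) : ℂ) • e' + T ((δ / 2 : ℝ) : ℂ) • e) := by
      rw [heq]; abel
    exact (add_left_cancel this).symm
  have hne : ((δ / 2 : ℝ) : ℂ) ≠ 0 := by
    rw [Ne, Complex.ofReal_eq_zero]; linarith
  apply he'
  rw [Submodule.mem_span_singleton]
  refine ⟨((δ / 2 : ℝ) : ℂ)⁻¹ * (T 0 - T ((δ / 2 : ℝ) : ℂ)), ?_⟩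
  rw [mul_smul, ← h5, smul_smul, inv_mul_cancel₀ hne, one_smul]

end Zero

theorem osgood (d : ℕ) : OsgoodDim d := by
  induction d with
  | zero =>
    intro E F _ _ _ _ _ _ hE hF f U hU hf hi p hp
    have := Module.finrank_zero_iff.1 hE
    exact Function.injective_of_subsingleton _
  | succ d ih =>
    intro E F _ _ _ _ _ _ hE hF f U hU hf hi p hp
    have hr : ∀ q ∈ U, fderiv ℂ f q ≠ 0 → Function.Injective (fderiv ℂ f q) := fun q hq =>
      osgood_rank ih hE hF hU hf hi hq
    refine hr p hp fun h0 => ?_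
    rcases Nat.eq_zero_or_pos d with hd | hd
    · subst hd
      simp only [zero_add] at hE hF
      let a : ℂ ≃L[ℂ] E := ContinuousLinearEquiv.ofFinrankEq (by simp [hE])
      let b : F ≃L[ℂ] ℂ := ContinuousLinearEquiv.ofFinrankEq (by simp [hF])
      have h1 : DifferentiableOn ℂ (fun z => b (f (a z))) (a ⁻¹' U) :=
        b.differentiable.comp_differentiableOn (hf.comp a.differentiable.differentiableOn fun z hz => hz)
      have h2 : InjOn (fun z => b (f (a z))) (a ⁻¹' U) := fun z hz w hw he =>
        a.injective (hi hz hw (b.injective he))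
      have hap : a (a.symm p) = p := a.apply_symm_apply p
      refine osgood_one (hU.preimage a.continuous) h1 h2 (p := a.symm p) (by simpa using hp) ?_
      have hD : HasFDerivAt f (0 : E →L[ℂ] F) (a (a.symm p)) := by
        rw [hap, ← h0]
        exact (hf.differentiableAt (hU.mem_nhds hp)).hasFDerivAt
      have h3 : HasFDerivAt (fun z => b (f (a z))) ((b : F →L[ℂ] ℂ).comp ((0 : E →L[ℂ] F).comp
        (a : ℂ →L[ℂ] E))) (a.symm p) :=
        b.hasFDerivAt.comp _ (hD.comp _ a.hasFDerivAt)
      rw [h3.hasDerivAt.deriv]; simp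
    · exact osgood_zero (by omega) (by omega) hU hf hi hr hp h0

end

noncomputable section

section Univ
variable {E : Type} [NormedAddCommGroup E] [NormedSpace ℂ E] [FiniteDimensional ℂ E]

theorem univ_equiv {f : E → E} {U : Set E} (hU : IsOpen U) (hf : DifferentiableOn ℂ f U)
    (hi : InjOn f U) {p : E} (hp : p ∈ U) :
    ∃ e : E ≃L[ℂ] E, HasFDerivAt f (e : E →L[ℂ] E) p ∧ (e : E →L[ℂ] E) = fderiv ℂ f p := by
  have hinj := osgood _ E E rfl rfl f U hU hf hi p hp
  have hD := (hf.differentiableAt (hU.mem_nhds hp)).hasFDerivAt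
  let l : E ≃ₗ[ℂ] E := LinearEquiv.ofInjectiveEndo (fderiv ℂ f p : E →ₗ[ℂ] E) hinj
  have : ((l.toContinuousLinearEquiv : E ≃L[ℂ] E) : E →L[ℂ] E) = fderiv ℂ f p := by
    ext v; rfl
  exact ⟨l.toContinuousLinearEquiv, this ▸ hD, this⟩

theorem univ_open {f : E → E} {U : Set E} (hU : IsOpen U) (hf : DifferentiableOn ℂ f U)
    (hi : InjOn f U) : IsOpen (f '' U) := by
  rw [isOpen_iff_mem_nhds]
  rintro _ ⟨p, hp, rfl⟩
  obtain ⟨e, he, -⟩ := univ_equiv hU hf hi hp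
  obtain ⟨V, θ, hV, hpV, -, hm, -, hr, -⟩ := scv_local_inverse hU hf hp e he
  exact mem_of_superset (hV.mem_nhds hpV) fun y hy => ⟨θ y, hm hy, hr y hy⟩

theorem univ_inv_diff {f : E → E} {U : Set E} (hU : IsOpen U) (hf : DifferentiableOn ℂ f U)
    (hi : InjOn f U) : DifferentiableOn ℂ (Function.invFunOn f U) (f '' U) := by
  rintro _ ⟨p, hp, rfl⟩
  obtain ⟨e, he, -⟩ := univ_equiv hU hf hi hp
  obtain ⟨V, θ, hV, hpV, -, hm, hd, hr, -⟩ := scv_local_inverse hU hf hp e he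
  refine DifferentiableAt.differentiableWithinAt ?_
  refine (hd.differentiableAt (hV.mem_nhds hpV)).congr_of_eventuallyEq ?_
  filter_upwards [hV.mem_nhds hpV] with y hy
  have h1 : ∃ x ∈ U, f x = y := ⟨θ y, hm hy, hr y hy⟩
  exact hi (Function.invFunOn_mem h1) (hm hy) ((Function.invFunOn_eq h1).trans (hr y hy).symm)

theorem univ_lower {f : E → E} {U K : Set E} (hU : IsOpen U) (hf : DifferentiableOn ℂ f U)
    (hi : InjOn f U) (hK : IsCompact K) (hKU : K ⊆ U) :
    ∃ m > 0, ∀ u ∈ K, ∀ v, m * ‖v‖ ≤ ‖fderiv ℂ f u v‖ := by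
  have hc : ContinuousOn (fun x : E × E => ‖fderiv ℂ f x.1 x.2‖) (K ×ˢ sphere (0 : E) 1) := by
    refine ContinuousOn.norm ?_
    refine ContinuousOn.clm_apply ?_ continuousOn_snd
    exact (scv_fderiv_differentiableOn hU hf).continuousOn.comp continuousOn_fst
      fun x hx => hKU hx.1
  obtain ⟨m, hm, h⟩ := (hK.prod (isCompact_sphere (0 : E) 1)).exists_forall_le' hc (a := 0) (by
    rintro ⟨u, v⟩ ⟨hu, hv⟩
    have hinj := osgood _ E E rfl rfl f U hU hf hi u (hKU hu)
    rw [norm_pos_iff]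
    intro h0
    have : v = 0 := hinj (h0.trans (map_zero _).symm)
    simp [this] at hv)
  refine ⟨m, hm, fun u hu v => ?_⟩
  by_cases hv : v = 0
  · simp [hv]
  have hv' : 0 < ‖v‖ := norm_pos_iff.2 hv
  have := h (u, ((‖v‖ : ℂ)⁻¹) • v) ⟨hu, by simp [norm_smul, hv]⟩
  simp only [map_smul, norm_smul, norm_inv, Complex.norm_real, norm_norm] at this
  rwa [inv_mul_eq_div, le_div_iff₀ hv'] at this

/-- Quantitative local surjectivity, uniform on compacta and stable under perturbation. -/
theorem univ_Q {f : E → E} (hf : DifferentiableOn ℂ f (ball 0 1)) (hi : InjOn f (ball 0 1))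
    {r : ℝ} (hr0 : 0 ≤ r) (hr : r < 1) :
    ∃ ρ s0 c η : ℝ, ρ < 1 ∧ 0 < s0 ∧ r + s0 ≤ ρ ∧ 0 < c ∧ 0 < η ∧ ∀ g : E → E,
      DifferentiableOn ℂ g (ball 0 1) → (∀ z ∈ closedBall (0 : E) ρ, ‖g z - f z‖ ≤ η) →
      ∀ u ∈ closedBall (0 : E) r, ∀ s, 0 ≤ s → s ≤ s0 → ∀ y, ‖y - g u‖ ≤ c * s →
        ∃ u' ∈ closedBall u s, g u' = y := by
  have hcomp : CompleteSpace E := FiniteDimensional.complete ℂ E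
  have hprop : ProperSpace E := FiniteDimensional.proper ℂ E
  set δ := (1 - r) / 4 with hδ
  have hδ0 : 0 < δ := by rw [hδ]; linarith
  have hsub : closedBall (0 : E) (r + 2 * δ) ⊆ ball 0 1 :=
    closedBall_subset_ball (by rw [hδ]; linarith)
  obtain ⟨m, hm, hlow⟩ := univ_lower isOpen_ball hf hi (isCompact_closedBall (0 : E) (r + 2 * δ)) hsub
  have huc := (isCompact_closedBall (0 : E) (r + 2 * δ)).uniformContinuousOn_of_continuous
    ((scv_fderiv_differentiableOn isOpen_ball hf).continuousOn.mono hsub)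
  rw [Metric.uniformContinuousOn_iff] at huc
  obtain ⟨δ', hδ', huc⟩ := huc (m / 4) (by positivity)
  refine ⟨r + 2 * δ, min δ (δ' / 2), m / 2, m * δ / 8, by rw [hδ]; linarith, by positivity,
    by linarith [min_le_left δ (δ' / 2)], by positivity, by positivity, ?_⟩
  intro g hg hgf u hu s hs0 hs y hy
  have hs1 : s ≤ δ := hs.trans (min_le_left _ _)
  have hs2 : s ≤ δ' / 2 := hs.trans (min_le_right _ _)
  rw [mem_closedBall, dist_zero_right] at hu
  obtain ⟨e, he, hee⟩ := univ_equiv isOpen_ball hf hi (p := u) (hsub (by simp; linarith))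
  have hzin : ∀ z ∈ closedBall u s, ‖z‖ ≤ r + δ := fun z hz => by
    have h1 : ‖z - u‖ ≤ s := by rwa [mem_closedBall, dist_eq_norm] at hz
    have h2 : ‖z‖ ≤ ‖u‖ + ‖z - u‖ := by simpa using norm_add_le u (z - u)
    linarith
  have hbd : ∀ z ∈ closedBall u s, ‖fderiv ℂ g z - fderiv ℂ f u‖ ≤ m / 2 := by
    intro z hz
    have hzn := hzin z hz
    have hzb : z ∈ ball (0 : E) 1 := hsub (by simp; linarith)
    have hzu : dist z u < δ' := by have := mem_closedBall.1 hz; linarith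
    have h1 := huc z (by simp; linarith) u (by simp; linarith) hzu
    rw [dist_eq_norm] at h1
    have hbs : ball z δ ⊆ closedBall (0 : E) (r + 2 * δ) := fun w hw => by
      have h1 : ‖w - z‖ < δ := by rwa [mem_ball, dist_eq_norm] at hw
      have h2 : ‖w‖ ≤ ‖z‖ + ‖w - z‖ := by simpa using norm_add_le z (w - z)
      simp; linarith
    have h2 := scv_fderiv_bound (f := fun w => g w - f w) (M := m * δ / 8) hδ0
      ((hg.sub hf).mono (hbs.trans hsub)) (fun w hw => hgf w (hbs hw))
    rw [fderiv_fun_sub (hg.differentiableAt (isOpen_ball.mem_nhds hzb))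
      (hf.differentiableAt (isOpen_ball.mem_nhds hzb))] at h2
    have h3 : 2 * (m * δ / 8) / δ = m / 4 := by field_simp; ring
    calc ‖fderiv ℂ g z - fderiv ℂ f u‖ = ‖(fderiv ℂ g z - fderiv ℂ f z) +
          (fderiv ℂ f z - fderiv ℂ f u)‖ := by congr 1; abel
      _ ≤ _ := norm_add_le _ _
      _ ≤ m / 4 + m / 4 := by linarith
      _ = m / 2 := by ring
  have happ : ApproximatesLinearOn g (fderiv ℂ f u) (closedBall u s) ⟨m / 2, by positivity⟩ := by
    intro x hx y hy
    have := (convex_closedBall u s).norm_image_sub_le_of_norm_hasFDerivWithin_le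
      (𝕜 := ℂ) (f := fun w => g w - fderiv ℂ f u w) (f' := fun w => fderiv ℂ g w - fderiv ℂ f u)
      (C := m / 2) ?_ hbd hy hx
    · refine le_trans (le_of_eq ?_) this
      congr 1; rw [map_sub]; abel
    · intro w hw
      refine HasFDerivAt.hasFDerivWithinAt ?_
      refine HasFDerivAt.sub ?_ (fderiv ℂ f u).hasFDerivAt
      refine (hg.differentiableAt (isOpen_ball.mem_nhds (hsub ?_))).hasFDerivAt
      have := hzin w hw
      simp; linarith
  let R : (fderiv ℂ f u).NonlinearRightInverse :=
    { toFun := e.symm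
      nnnorm := ⟨m⁻¹, by positivity⟩
      bound' := fun y => by
        have := hlow u (by simp; linarith) (e.symm y)
        rw [← hee] at this
        simp only [ContinuousLinearEquiv.coe_coe, ContinuousLinearEquiv.apply_symm_apply] at this
        change _ ≤ m⁻¹ * ‖y‖
        rw [inv_mul_eq_div, le_div_iff₀ hm]; linarith
      right_inv' := fun y => by rw [← hee]; simp }
  obtain ⟨u', hu', h⟩ := happ.surjOn_closedBall_of_nonlinearRightInverse R hs0 subset_rfl
    (show y ∈ _ by
      rw [mem_closedBall, dist_eq_norm]
      refine hy.trans (le_of_eq ?_)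
      change _ = ((m⁻¹)⁻¹ - m / 2) * s
      rw [inv_inv]; ring)
  exact ⟨u', hu', h⟩
end Univ
end

noncomputable section

theorem compact_in_ball {E : Type*} [NormedAddCommGroup E] {K : Set E} (hK : IsCompact K)
    (h : K ⊆ ball 0 1) : ∃ r : ℝ, 0 ≤ r ∧ r < 1 ∧ K ⊆ closedBall 0 r := by
  obtain ⟨a, ha, hb⟩ := hK.exists_forall_le' (f := fun x => 1 - ‖x‖) (a := 0) (by fun_prop)
    (fun x hx => by have := h hx; simp at this; linarith)
  refine ⟨1 - min a 1, by simp, by simp [ha], fun x hx => ?_⟩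
  have := hb x hx
  have h2 := min_le_left a 1
  simp only [mem_closedBall, dist_zero_right]; linarith

theorem locUnif_iff {E F : Type*} [NormedAddCommGroup E] [ProperSpace E] [NormedAddCommGroup F]
    {f : ℕ → E → F} {g : E → F} :
    TendstoLocallyUniformlyOn f g atTop (ball 0 1) ↔ ∀ r : ℝ, 0 ≤ r → r < 1 → ∀ ε > 0,
      ∀ᶠ k in atTop, ∀ z ∈ closedBall (0 : E) r, ‖f k z - g z‖ ≤ ε := by
  rw [tendstoLocallyUniformlyOn_iff_forall_isCompact isOpen_ball]
  constructor
  · intro h r _ hr ε hε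
    have := h _ (closedBall_subset_ball hr) (isCompact_closedBall (0 : E) r)
    rw [Metric.tendstoUniformlyOn_iff] at this
    filter_upwards [this ε hε] with k hk z hz
    have := hk z hz
    rw [dist_comm, dist_eq_norm] at this
    exact this.le
  · intro h K hKb hK
    obtain ⟨r, hr0, hr, hKr⟩ := compact_in_ball hK hKb
    rw [Metric.tendstoUniformlyOn_iff]
    intro ε hε
    filter_upwards [h r hr0 hr (ε / 2) (by positivity)] with k hk z hz
    have := hk z (hKr hz)
    rw [dist_comm, dist_eq_norm]
    linarith

theorem exists_seq_r {α : Type*} {Q : α → ℝ → ℝ → Prop} {P : α → Prop}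
    (hmono : ∀ a r r' ε ε', r ≤ r' → ε' ≤ ε → Q a r' ε' → Q a r ε)
    (h : ∀ r : ℝ, 0 ≤ r → r < 1 → ∀ ε > 0, ∃ a, P a ∧ Q a r ε) :
    ∃ a : ℕ → α, (∀ k, P (a k)) ∧ ∀ r : ℝ, r < 1 → ∀ ε > 0, ∀ᶠ k in atTop, Q (a k) r ε := by
  have h' : ∀ k : ℕ, ∃ a, P a ∧ Q a (1 - 1 / ((k : ℝ) + 1)) (1 / ((k : ℝ) + 1)) := fun k => by
    have : 0 < 1 / ((k : ℝ) + 1) := by positivity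
    refine h _ ?_ (by linarith) _ this
    have : 1 / ((k : ℝ) + 1) ≤ 1 := by
      rw [div_le_one (by positivity)]; linarith [(Nat.cast_nonneg k : (0 : ℝ) ≤ k)]
    linarith
  choose a ha hq using h'
  refine ⟨a, ha, fun r hr ε hε => ?_⟩
  have ht := tendsto_one_div_add_atTop_nhds_zero_nat (𝕜 := ℝ)
  filter_upwards [ht.eventually (gt_mem_nhds hε), ht.eventually (gt_mem_nhds (sub_pos.2 hr))]
    with k h1 h2
  exact hmono _ _ _ _ _ (by linarith) h1.le (hq k)

theorem exists_seq_approx {E F : Type*} [NormedAddCommGroup E] [ProperSpace E] [NormedAddCommGroup F]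
    {P : (E → F) → Prop} {f : E → F}
    (h : ∀ r : ℝ, 0 ≤ r → r < 1 → ∀ ε > 0, ∃ g, P g ∧ ∀ z ∈ closedBall (0 : E) r, ‖g z - f z‖ ≤ ε) :
    ∃ g : ℕ → E → F, (∀ k, P (g k)) ∧ TendstoLocallyUniformlyOn g f atTop (ball 0 1) := by
  obtain ⟨a, ha, hq⟩ := exists_seq_r
    (Q := fun g r ε => ∀ z ∈ closedBall (0 : E) r, ‖g z - f z‖ ≤ ε) (P := P)
    (fun g r r' ε ε' hr hε H z hz => (H z (closedBall_subset_closedBall hr hz)).trans hε) h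
  exact ⟨a, ha, locUnif_iff.2 fun r _ hr ε hε => hq r hr ε hε⟩

section
variable {n : ℕ}

theorem inv_mem {f : En n → En n} {z : En n} (hz : z ∈ f '' Ball n) :
    Function.invFunOn f (Ball n) z ∈ Ball n := Function.invFunOn_mem hz
theorem inv_eq {f : En n → En n} {z : En n} (hz : z ∈ f '' Ball n) :
    f (Function.invFunOn f (Ball n) z) = z := Function.invFunOn_eq hz
theorem UnivalentOn.inv_unique {f : En n → En n} (hf : UnivalentOn n f) {u : En n} (hu : u ∈ Ball n) :
    Function.invFunOn f (Ball n) (f u) = u := hf.2.leftInvOn_invFunOn hu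
theorem UnivalentOn.isOpen {f : En n → En n} (hf : UnivalentOn n f) : IsOpen (f '' Ball n) :=
  univ_open isOpen_ball hf.1 hf.2
theorem UnivalentOn.inv_diff {f : En n → En n} (hf : UnivalentOn n f) :
    DifferentiableOn ℂ (Function.invFunOn f (Ball n)) (f '' Ball n) :=
  univ_inv_diff isOpen_ball hf.1 hf.2
theorem cb_sub {r : ℝ} (hr : r < 1) : closedBall (0 : En n) r ⊆ Ball n :=
  closedBall_subset_ball hr

theorem runge_iff {f : En n → En n} (hf : UnivalentOn n f) :
    RungeOn n (f '' Ball n) ↔ ∀ g : En n → En n, DifferentiableOn ℂ g (f '' Ball n) →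
      ∀ r : ℝ, 0 ≤ r → r < 1 → ∀ ε > 0, ∃ p, IsPolyMap n p ∧
        ∀ z ∈ closedBall (0 : En n) r, ‖p (f z) - g (f z)‖ ≤ ε := by
  constructor
  · intro h g hg r _ hr ε hε
    obtain ⟨p, hp, hlim⟩ := h g hg
    rw [tendstoLocallyUniformlyOn_iff_forall_isCompact hf.isOpen] at hlim
    have := hlim (f '' closedBall 0 r) (image_mono (cb_sub hr))
      ((isCompact_closedBall _ _).image_of_continuousOn (hf.1.continuousOn.mono (cb_sub hr)))
    rw [Metric.tendstoUniformlyOn_iff] at this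
    obtain ⟨k, hk⟩ := (this ε hε).exists
    refine ⟨p k, hp k, fun z hz => ?_⟩
    have := hk _ (mem_image_of_mem f hz)
    rw [dist_comm, dist_eq_norm] at this
    exact this.le
  · intro h g hg
    obtain ⟨p, hp, hq⟩ := exists_seq_r
      (Q := fun (p : En n → En n) r ε => ∀ z ∈ closedBall (0 : En n) r, ‖p (f z) - g (f z)‖ ≤ ε)
      (P := IsPolyMap n)
      (fun g r r' ε ε' hr hε H z hz => (H z (closedBall_subset_closedBall hr hz)).trans hε)
      (h g hg)
    refine ⟨p, hp, ?_⟩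
    rw [tendstoLocallyUniformlyOn_iff_forall_isCompact hf.isOpen]
    intro K hKs hK
    obtain ⟨r, hr0, hr, hKr⟩ := compact_in_ball (hK.image_of_continuousOn
      (hf.inv_diff.continuousOn.mono hKs)) (by
        rintro _ ⟨y, hy, rfl⟩; exact inv_mem (hKs hy))
    rw [Metric.tendstoUniformlyOn_iff]
    intro ε hε
    filter_upwards [hq r hr (ε / 2) (by positivity)] with k hk y hy
    have := hk _ (hKr (mem_image_of_mem _ hy))
    rw [inv_eq (hKs hy)] at this
    rw [dist_comm, dist_eq_norm]; linarith

theorem poly_uc {q : En n → En n} (hq : IsPolyMap n q) {γ : ℝ} (hγ : 0 < γ) :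
    ∃ δ > 0, ∀ u ∈ closedBall (0 : En n) 1, ∀ v ∈ closedBall (0 : En n) 1, ‖u - v‖ ≤ δ → ‖q u - q v‖ < γ := by
  have := (isCompact_closedBall (0 : En n) 1).uniformContinuousOn_of_continuous
    hq.differentiable.continuous.continuousOn
  rw [Metric.uniformContinuousOn_iff] at this
  obtain ⟨δ, hδ, h⟩ := this γ hγ
  refine ⟨δ / 2, by positivity, fun u hu v hv huv => ?_⟩
  have := h u hu v hv (by rw [dist_eq_norm]; linarith)
  rwa [dist_eq_norm] at this

theorem memF_closed (f : ℕ → En n → En n) (g : En n → En n) (hf : ∀ k, MemF n (f k))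
    (hg : UnivalentOn n g) (h : TendstoLocallyUniformlyOn f g atTop (Ball n)) : MemF n g := by
  refine ⟨hg, (runge_iff hg).2 fun H hH r hr0 hr ε hε => ?_⟩
  have hHg : DifferentiableOn ℂ (fun z => H (g z)) (ball 0 1) :=
    hH.comp hg.1 (mapsTo_image _ _)
  obtain ⟨q, hq, hqa⟩ := poly_approx hr (show 0 < ε / 3 by positivity) hHg
  obtain ⟨δ, hδ, huc⟩ := poly_uc hq (show 0 < ε / 3 by positivity)
  obtain ⟨ρ, s0, c, η, hρ, hs0, hrs, hc, hη, hQ⟩ := univ_Q hg.1 hg.2 hr0 hr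
  have hl := locUnif_iff.1 h ρ (by linarith) hρ
  have hs : 0 < min s0 δ := lt_min hs0 hδ
  obtain ⟨k, hk⟩ := (hl (min η (c * min s0 δ)) (by positivity)).exists
  have hqk : DifferentiableOn ℂ (fun y => q (Function.invFunOn (f k) (Ball n) y)) (f k '' Ball n) :=
    hq.differentiable.comp_differentiableOn (hf k).1.inv_diff
  obtain ⟨p, hp, hpa⟩ := (runge_iff (hf k).1).1 (hf k).2 _ hqk ρ (by linarith) hρ
    (ε / 3) (by positivity)
  refine ⟨p, hp, fun z hz => ?_⟩
  have hzr : ‖z‖ ≤ r := by simpa using hz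
  obtain ⟨u, hu, hue⟩ := hQ (f k) (hf k).1.1 (fun z hz => (hk z hz).trans (min_le_left _ _)) z hz
    (min s0 δ) hs.le (min_le_left _ _) (g z) (by
      rw [norm_sub_rev]
      exact (hk z (by simp; linarith)).trans (min_le_right _ _))
  rw [mem_closedBall, dist_eq_norm] at hu
  have huρ : ‖u‖ ≤ ρ := by
    have h2 : ‖u‖ ≤ ‖z‖ + ‖u - z‖ := by simpa using norm_add_le z (u - z)
    linarith [min_le_left s0 δ]
  have h1 := hpa u (by simpa using huρ)
  rw [(hf k).1.inv_unique (cb_sub hρ (by simpa using huρ)), hue] at h1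
  have h2 := huc u (by simp; linarith) z (by simp; linarith) (hu.trans (min_le_right _ _))
  have h3 := hqa z hz
  calc ‖p (g z) - H (g z)‖ = ‖(p (g z) - q u) + (q u - q z) + (q z - H (g z))‖ := by
        congr 1; abel
    _ ≤ _ := norm_add₃_le
    _ ≤ ε := by linarith

theorem real_induct {P : ℝ → Prop} (h0 : P 0)
    (hr : ∀ T, 0 ≤ T → P T → ∃ δ > 0, ∀ t, T < t → t < T + δ → P t)
    (hl : ∀ T, 0 < T → ∃ δ > 0, ∀ t, T - δ < t → t < T → 0 ≤ t → P t → P T) :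
    ∀ t, 0 ≤ t → P t := by
  by_contra! hcon
  obtain ⟨t1, ht1, hP1⟩ := hcon
  set B := {t : ℝ | 0 ≤ t ∧ ¬ P t}
  have hbd : BddBelow B := ⟨0, fun t ht => ht.1⟩
  have hne : B.Nonempty := ⟨t1, ht1, hP1⟩
  set T := sInf B
  have hT0 : 0 ≤ T := le_csInf hne fun t ht => ht.1
  have hlt : ∀ t, 0 ≤ t → t < T → P t := fun t ht htT => by
    by_contra hc
    exact absurd (csInf_le hbd (show t ∈ B from ⟨ht, hc⟩)) (not_le.2 htT)
  have hPT : P T := by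
    rcases hT0.eq_or_lt with h | h
    · rwa [← h]
    · obtain ⟨δ, hδ, H⟩ := hl T h
      have h1 : max 0 (T - δ) < T := max_lt h (by linarith)
      refine H ((max 0 (T - δ) + T) / 2) ?_ (by linarith) ?_ (hlt _ ?_ (by linarith))
      · linarith [le_max_right 0 (T - δ)]
      · linarith [le_max_left 0 (T - δ)]
      · linarith [le_max_left 0 (T - δ)]
  obtain ⟨δ, hδ, H⟩ := hr T hT0 hPT
  obtain ⟨t, ht, htT⟩ := exists_lt_of_csInf_lt hne (show sInf B < T + δ by change T < _; linarith)
  refine ht.2 ?_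
  rcases (csInf_le hbd ht).eq_or_lt with h | h
  · rwa [← h]
  · exact H t h htT

theorem chain_cont {f : ℝ → En n → En n} (hf : IsLoewnerChain n f) {ρ T η : ℝ} (hρ : ρ < 1)
    (hT : 0 ≤ T) (hη : 0 < η) : ∃ δ > 0, ∀ t, 0 ≤ t → |t - T| < δ →
      ∀ z ∈ closedBall (0 : En n) ρ, ‖f t z - f T z‖ ≤ η := by
  obtain ⟨c, hc, hcint, hb⟩ := hf.2.2 _ (cb_sub hρ) (isCompact_closedBall _ _) (T + 1) (by linarith)
  set G : ℝ → ℝ := fun x => ∫ τ in Icc 0 x, c τ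
  have hG : ContinuousOn G (Icc 0 (T + 1)) := intervalIntegral.continuousOn_primitive_Icc hcint
  have hGd : ∀ s t, 0 ≤ s → s ≤ t → t ≤ T + 1 → ∫ τ in Icc s t, c τ = G t - G s := by
    intro s t hs hst ht
    have : Icc 0 t = Icc 0 s ∪ Ioc s t := (Icc_union_Ioc_eq_Icc hs hst).symm
    simp only [G]
    rw [this, setIntegral_union, integral_Icc_eq_integral_Ioc]
    · ring
    · rw [Set.disjoint_left]; intro x hx hx2; exact absurd hx.2 (not_le.2 hx2.1)
    · exact measurableSet_Ioc
    · exact hcint.mono_set (Icc_subset_Icc le_rfl (by linarith))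
    · exact hcint.mono_set fun x hx => ⟨hs.trans hx.1.le, hx.2.trans ht⟩
  have hcT := hG T ⟨hT, by linarith⟩
  rw [Metric.continuousWithinAt_iff] at hcT
  obtain ⟨δ, hδ, h⟩ := hcT η hη
  refine ⟨min δ 1, by positivity, fun t ht htT z hz => ?_⟩
  have h1 : |t - T| < δ := htT.trans_le (min_le_left _ _)
  have h2 : |t - T| < 1 := htT.trans_le (min_le_right _ _)
  have h3 : t ≤ T + 1 := by linarith [(abs_lt.1 h2).2]
  have h4 := h (x := t) ⟨ht, h3⟩ (by rwa [Real.dist_eq])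
  rw [Real.dist_eq, abs_lt] at h4
  rcases le_total t T with hle | hle
  · have := hb z hz t T ht hle (by linarith)
    rw [hGd t T ht hle (by linarith)] at this
    linarith
  · have := hb z hz T t hT hle h3
    rw [hGd T t hT hle h3, norm_sub_rev] at this
    linarith

theorem memE_memF (g : En n → En n) (hE : MemE n g) : MemF n g := by
  obtain ⟨hg, f, hf, hf0, hrange⟩ := hE
  subst hf0
  refine ⟨hg, (runge_iff hg).2 fun h hh r hr0 hr ε hε => ?_⟩
  set inv : ℝ → En n → En n := fun t => Function.invFunOn (f t) (Ball n) with hinv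
  have him : ∀ t, 0 ≤ t → ∀ z ∈ closedBall (0 : En n) r, f 0 z ∈ f t '' Ball n := fun t ht z hz =>
    hf.2.1 0 t le_rfl ht (mem_image_of_mem _ (cb_sub hr hz))
  have hρ0 : ∀ t, 0 ≤ t → ∃ ρ : ℝ, 0 ≤ ρ ∧ ρ < 1 ∧ ∀ z ∈ closedBall (0 : En n) r,
      inv t (f 0 z) ∈ closedBall (0 : En n) ρ := by
    intro t ht
    have hc : ContinuousOn (fun z => inv t (f 0 z)) (closedBall (0 : En n) r) :=
      (hf.1 t ht).inv_diff.continuousOn.comp (hg.1.continuousOn.mono (cb_sub hr)) (him t ht)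
    obtain ⟨ρ, h0, h1, h2⟩ := compact_in_ball ((isCompact_closedBall _ _).image_of_continuousOn hc)
      (by rintro _ ⟨z, hz, rfl⟩; exact inv_mem (him t ht z hz))
    exact ⟨ρ, h0, h1, fun z hz => h2 (mem_image_of_mem _ hz)⟩
  have hgap : ∀ t, 0 ≤ t → ∀ q, IsPolyMap n q →
      (∀ z ∈ closedBall (0 : En n) r, ‖q (inv t (f 0 z)) - h (f 0 z)‖ < ε) →
      ∃ γ > 0, ∀ z ∈ closedBall (0 : En n) r, ‖q (inv t (f 0 z)) - h (f 0 z)‖ + γ ≤ ε := by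
    intro t ht q hq H
    have hc1 : ContinuousOn (fun z => f 0 z) (closedBall (0 : En n) r) :=
      hg.1.continuousOn.mono (cb_sub hr)
    have hc : ContinuousOn (fun z => inv t (f 0 z)) (closedBall (0 : En n) r) :=
      (hf.1 t ht).inv_diff.continuousOn.comp hc1 (him t ht)
    have hc2 : ContinuousOn (fun z => ε - ‖q (inv t (f 0 z)) - h (f 0 z)‖) (closedBall (0 : En n) r) :=
      continuousOn_const.sub ((hq.differentiable.continuous.comp_continuousOn hc).sub
        (hh.continuousOn.comp hc1 (him 0 le_rfl))).norm
    obtain ⟨γ, hγ, Hγ⟩ := (isCompact_closedBall (0 : En n) r).exists_forall_le' hc2 (a := 0)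
      (fun z hz => by have := H z hz; linarith)
    exact ⟨γ, hγ, fun z hz => by linarith [Hγ z hz]⟩
  have hS : ∀ t, 0 ≤ t → ∃ q, IsPolyMap n q ∧ ∀ z ∈ closedBall (0 : En n) r,
      ‖q (inv t (f 0 z)) - h (f 0 z)‖ < ε := by
    apply real_induct
    · have hHg : DifferentiableOn ℂ (fun z => h (f 0 z)) (ball 0 1) :=
        hh.comp hg.1 (mapsTo_image _ _)
      obtain ⟨q, hq, hqa⟩ := poly_approx hr (show 0 < ε / 2 by positivity) hHg
      refine ⟨q, hq, fun z hz => ?_⟩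
      rw [hinv]; simp only
      rw [hg.inv_unique (cb_sub hr hz)]
      linarith [hqa z hz]
    · rintro T hT ⟨q, hq, hqa⟩
      obtain ⟨γ, hγ, Hγ⟩ := hgap T hT q hq hqa
      obtain ⟨δ, hδ, huc⟩ := poly_uc hq hγ
      obtain ⟨ρ0, h00, h01, hρ⟩ := hρ0 T hT
      obtain ⟨ρ, s0, c, η, hρ1, hs0, hrs, hc, hη, hQ⟩ := univ_Q (hf.1 T hT).1 (hf.1 T hT).2 h00 h01
      have hs : 0 < min s0 δ := lt_min hs0 hδ
      obtain ⟨δ1, hδ1, hcont⟩ := chain_cont hf hρ1 hT (show 0 < min η (c * min s0 δ) by positivity)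
      refine ⟨δ1, hδ1, fun t htT htd => ⟨q, hq, fun z hz => ?_⟩⟩
      have ht0 : 0 ≤ t := by linarith
      have hk := hcont t ht0 (by rw [abs_of_pos] <;> linarith)
      set u := inv T (f 0 z) with hu
      have hur := hρ z hz
      have hur' : ‖u‖ ≤ ρ0 := by simpa using hur
      have hfu : f T u = f 0 z := inv_eq (him T hT z hz)
      obtain ⟨u', hu', hue⟩ := hQ (f t) (hf.1 t ht0).1
        (fun z hz => (hk z hz).trans (min_le_left _ _)) u hur
        (min s0 δ) hs.le (min_le_left _ _) (f T u) (by
          rw [norm_sub_rev]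
          exact (hk u (by simp; linarith)).trans (min_le_right _ _))
      rw [mem_closedBall, dist_eq_norm] at hu'
      have huρ : ‖u'‖ ≤ ρ := by
        have h2 : ‖u'‖ ≤ ‖u‖ + ‖u' - u‖ := by simpa using norm_add_le u (u' - u)
        linarith [min_le_left s0 δ]
      have h1 : inv t (f 0 z) = u' := by
        rw [← hfu, ← hue]
        exact (hf.1 t ht0).inv_unique (cb_sub hρ1 (by simpa using huρ))
      rw [h1]
      have h2 := huc u' (by simp; linarith) u (by simp; linarith) (hu'.trans (min_le_right _ _))
      have h3 := Hγ z hz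
      have h4 : ‖q u' - h (f 0 z)‖ ≤ ‖q u' - q u‖ + ‖q u - h (f 0 z)‖ := norm_sub_le_norm_sub_add_norm_sub _ _ _
      linarith
    · intro T hT
      obtain ⟨ρ0, h00, h01, hρ⟩ := hρ0 T hT.le
      obtain ⟨ρ, s0, c, η, hρ1, hs0, hrs, hc, hη, hQ⟩ := univ_Q (hf.1 T hT.le).1 (hf.1 T hT.le).2
        (show 0 ≤ (ρ0 + 1) / 2 by linarith) (by linarith)
      obtain ⟨δ1, hδ1, hcont⟩ := chain_cont hf hρ1 hT.le (show 0 < min η (c * s0) by positivity)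
      refine ⟨δ1, hδ1, ?_⟩
      rintro t ht1 ht2 ht0 ⟨q, hq, hqa⟩
      obtain ⟨γ, hγ, Hγ⟩ := hgap t ht0 q hq hqa
      have hk := hcont t ht0 (by rw [abs_of_neg] <;> linarith)
      have hmaps : MapsTo (f T) (ball 0 ((ρ0 + 1) / 2)) (f t '' Ball n) := by
        intro u hu
        have hu1 := ball_subset_closedBall hu
        have hur' : ‖u‖ ≤ (ρ0 + 1) / 2 := by simpa using hu1
        obtain ⟨u', hu', hue⟩ := hQ (f t) (hf.1 t ht0).1
          (fun z hz => (hk z hz).trans (min_le_left _ _)) u hu1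
          s0 hs0.le le_rfl (f T u) (by
            rw [norm_sub_rev]
            exact (hk u (by simp; linarith)).trans (min_le_right _ _))
        rw [mem_closedBall, dist_eq_norm] at hu'
        have huρ : ‖u'‖ ≤ ρ := by
          have h2 : ‖u'‖ ≤ ‖u‖ + ‖u' - u‖ := by simpa using norm_add_le u (u' - u)
          linarith
        exact ⟨u', cb_sub hρ1 (by simpa using huρ), hue⟩
      have hd : DifferentiableOn ℂ (fun u => q (inv t (f T u))) (ball 0 ((ρ0 + 1) / 2)) :=
        hq.differentiable.comp_differentiableOn ((hf.1 t ht0).inv_diff.comp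
          ((hf.1 T hT.le).1.mono (ball_subset_ball (by linarith))) hmaps)
      obtain ⟨p, hp, hpa⟩ := poly_approx (show ρ0 < (ρ0 + 1) / 2 by linarith)
        (show 0 < γ / 2 by positivity) hd
      refine ⟨p, hp, fun z hz => ?_⟩
      have h1 := hpa _ (hρ z hz)
      rw [show f T (inv T (f 0 z)) = f 0 z from inv_eq (him T hT.le z hz)] at h1
      have h3 := Hγ z hz
      have h4 := norm_sub_le_norm_sub_add_norm_sub (p (inv T (f 0 z))) (q (inv t (f 0 z))) (h (f 0 z))
      linarith
  obtain ⟨R, hR⟩ := ((isCompact_closedBall (0 : En n) r).image_of_continuousOn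
    (hg.1.continuousOn.mono (cb_sub hr))).isBounded.subset_closedBall 0
  obtain ⟨t, ht, hbt⟩ : ∃ t, 0 ≤ t ∧ closedBall (0 : En n) (R + 1) ⊆ f t '' Ball n := by
    have hU : ∀ i : {t : ℝ // 0 ≤ t}, IsOpen (f i '' Ball n) := fun i => (hf.1 i i.2).isOpen
    obtain ⟨i, hi⟩ := (isCompact_closedBall (0 : En n) (R + 1)).elim_directed_cover _ hU
      (by
        intro x _
        have : x ∈ ChainRange n f := by rw [hrange]; trivial
        simp only [ChainRange, mem_iUnion, mem_Ici] at this
        obtain ⟨t, ht, hx⟩ := this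
        exact mem_iUnion.2 ⟨⟨t, ht⟩, hx⟩)
      (by
        intro i j
        rcases le_total i j with hij | hij
        · exact ⟨j, hf.2.1 i j i.2 hij, subset_rfl⟩
        · exact ⟨i, subset_rfl, hf.2.1 j i j.2 hij⟩)
    exact ⟨i, i.2, hi⟩
  obtain ⟨q, hq, hqa⟩ := hS t ht
  obtain ⟨γ, hγ, Hγ⟩ := hgap t ht q hq hqa
  have hd : DifferentiableOn ℂ (fun u => q (inv t u)) (ball 0 (R + 1)) :=
    hq.differentiable.comp_differentiableOn ((hf.1 t ht).inv_diff.mono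
      (ball_subset_closedBall.trans hbt))
  obtain ⟨p, hp, hpa⟩ := poly_approx (show R < R + 1 by linarith) hγ hd
  refine ⟨p, hp, fun z hz => ?_⟩
  have h1 := hpa _ (hR (mem_image_of_mem _ hz))
  have h3 := Hγ z hz
  have h4 := norm_sub_le_norm_sub_add_norm_sub (p (f 0 z)) (q (inv t (f 0 z))) (h (f 0 z))
  linarith
end
end

noncomputable section

theorem strip_map : ∃ T : ℂ → ℂ, DifferentiableOn ℂ T (ball 0 1) ∧ InjOn T (ball 0 1) ∧
    (∀ u ∈ ball (0 : ℂ) 1, |(T u).re| ≤ 6 / 5 ∧ |(T u).im| ≤ 1 / 50) ∧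
    ∀ x : ℝ, |x| ≤ 1 → ∃ u : ℝ, |u| < 1 ∧ T u = x := by
  set A : ℝ := Real.exp 120 with hA
  have hA1 : 1 < A := by rw [hA]; exact Real.one_lt_exp_iff.2 (by norm_num)
  set ρ : ℝ := (A - 1) / (A + 1) with hρ
  have hρ0 : 0 < ρ := div_pos (by linarith) (by linarith)
  have hρ1 : ρ < 1 := by rw [hρ, div_lt_one (by linarith)]; linarith
  have hn : ∀ u ∈ ball (0 : ℂ) 1, ‖(ρ : ℂ) * u‖ < ρ := fun u hu => by
    have hu : ‖u‖ < 1 := by simpa using hu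
    rw [norm_mul, Complex.norm_real, Real.norm_of_nonneg hρ0.le]
    nlinarith
  have hne : ∀ u ∈ ball (0 : ℂ) 1, 1 - (ρ : ℂ) * u ≠ 0 := fun u hu h => by
    have := hn u hu
    rw [← sub_eq_zero.1 h] at this; simp at this; linarith
  have hre : ∀ u ∈ ball (0 : ℂ) 1, 0 < ((1 + (ρ : ℂ) * u) / (1 - (ρ : ℂ) * u)).re := fun u hu => by
    have h1 := hn u hu
    set a := (ρ : ℂ) * u
    have hns : 0 < Complex.normSq (1 - a) := Complex.normSq_pos.2 (hne u hu)
    rw [Complex.div_re, ← add_div]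
    refine div_pos ?_ hns
    have h2 : a.re ^ 2 + a.im ^ 2 < 1 := by
      have := Complex.sq_norm a
      rw [Complex.normSq_apply] at this
      nlinarith [norm_nonneg a]
    simp only [Complex.add_re, Complex.sub_re, Complex.one_re, Complex.add_im, Complex.sub_im,
      Complex.one_im]
    nlinarith
  have hexp : ∀ u ∈ ball (0 : ℂ) 1, Complex.exp (Complex.log ((1 + (ρ : ℂ) * u) / (1 - (ρ : ℂ) * u))) =
      (1 + (ρ : ℂ) * u) / (1 - (ρ : ℂ) * u) := fun u hu => Complex.exp_log fun h => by
    have := hre u hu; rw [h] at this; simp at this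
  refine ⟨fun u => (1 / 100 : ℂ) * Complex.log ((1 + (ρ : ℂ) * u) / (1 - (ρ : ℂ) * u)), ?_, ?_, ?_, ?_⟩
  · refine DifferentiableOn.const_mul (DifferentiableOn.clog ?_ ?_) _
    · exact DifferentiableOn.div (by fun_prop) (by fun_prop) hne
    · exact fun u hu => Or.inl (hre u hu)
  · intro u hu v hv h
    simp only at h
    have h1 := mul_left_cancel₀ (by norm_num) h
    have h2 := congrArg Complex.exp h1
    rw [hexp u hu, hexp v hv, div_eq_div_iff (hne u hu) (hne v hv)] at h2
    have h3 : (ρ : ℂ) * (u - v) = 0 := by linear_combination h2 / 2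
    have h4 : (ρ : ℂ) ≠ 0 := by exact_mod_cast hρ0.ne'
    exact sub_eq_zero.1 ((mul_eq_zero.1 h3).resolve_left h4)
  · intro u hu
    set w := (1 + (ρ : ℂ) * u) / (1 - (ρ : ℂ) * u) with hw
    have hlog : (1 / 100 : ℂ) * Complex.log w = ((1 / 100 : ℝ) : ℂ) * Complex.log w := by norm_num
    change |((1 / 100 : ℂ) * Complex.log w).re| ≤ _ ∧ |((1 / 100 : ℂ) * Complex.log w).im| ≤ _
    rw [hlog]
    simp only [Complex.re_ofReal_mul, Complex.im_ofReal_mul, abs_mul]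
    rw [Complex.log_re, Complex.log_im]
    have h1 := hn u hu
    set a := (ρ : ℂ) * u with ha
    have hAr : (1 + ρ) = A * (1 - ρ) := by rw [hρ]; field_simp; ring
    have hb1 : ‖1 + a‖ ≤ A * ‖1 - a‖ := by
      have e1 : ‖1 + a‖ ≤ 1 + ‖a‖ := by simpa using norm_add_le 1 a
      have e2 : 1 - ‖a‖ ≤ ‖1 - a‖ := by simpa using norm_sub_norm_le 1 a
      nlinarith
    have hb2 : ‖1 - a‖ ≤ A * ‖1 + a‖ := by
      have e1 : ‖1 - a‖ ≤ 1 + ‖a‖ := by simpa using norm_sub_le 1 a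
      have e2 : 1 - ‖a‖ ≤ ‖1 + a‖ := by simpa using norm_sub_norm_le 1 (-a)
      nlinarith
    have hp : 0 < ‖1 - a‖ := norm_pos_iff.2 (hne u hu)
    have hwn : ‖w‖ = ‖1 + a‖ / ‖1 - a‖ := by rw [hw, norm_div]
    have hwp : 0 < ‖w‖ := by
      refine norm_pos_iff.2 fun h => ?_
      have := hre u hu; rw [← hw, h] at this; simp at this
    have hu1 : Real.log ‖w‖ ≤ 120 := by
      rw [Real.log_le_iff_le_exp hwp, hwn, div_le_iff₀ hp]; exact hb1
    have hu2 : -120 ≤ Real.log ‖w‖ := by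
      rw [Real.le_log_iff_exp_le hwp, hwn, le_div_iff₀ hp, Real.exp_neg, inv_mul_le_iff₀ (Real.exp_pos _)]
      exact hb2
    have har : |w.arg| ≤ Real.pi / 2 := Complex.abs_arg_le_pi_div_two_iff.2 (hre u hu).le
    have := Real.pi_lt_d2
    rw [abs_of_pos (by norm_num : (0 : ℝ) < 1 / 100)]
    have := abs_le.2 ⟨hu2, hu1⟩
    constructor <;> linarith
  · intro x hx
    have hx := abs_le.1 hx
    set w := Real.exp (100 * x) with hw
    have hwp : 0 < w := Real.exp_pos _
    have hwA : w < A := Real.exp_lt_exp.2 (by linarith)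
    have hwA' : 1 < w * A := by
      rw [hw, hA, ← Real.exp_add]; exact Real.one_lt_exp_iff.2 (by linarith)
    have h1 : (w - 1) / (w + 1) < ρ := by
      rw [hρ, div_lt_div_iff₀ (by linarith) (by linarith)]; nlinarith
    have h2 : -ρ < (w - 1) / (w + 1) := by
      rw [hρ, ← neg_div, div_lt_div_iff₀ (by linarith) (by linarith)]; nlinarith
    refine ⟨(w - 1) / (w + 1) / ρ, ?_, ?_⟩
    · rw [abs_lt, lt_div_iff₀ hρ0, div_lt_iff₀ hρ0]; constructor <;> linarith
    · have h3 : (1 + (ρ : ℂ) * (((w - 1) / (w + 1) / ρ : ℝ) : ℂ)) /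
          (1 - (ρ : ℂ) * (((w - 1) / (w + 1) / ρ : ℝ) : ℂ)) = ((w : ℝ) : ℂ) := by
        have : (1 + ρ * ((w - 1) / (w + 1) / ρ)) / (1 - ρ * ((w - 1) / (w + 1) / ρ)) = w := by
          rw [mul_div_cancel₀ _ hρ0.ne']
          field_simp; ring
        exact_mod_cast congrArg (fun t : ℝ => (t : ℂ)) this
      simp only [h3]
      rw [← Complex.ofReal_log hwp.le, hw, Real.log_exp]
      push_cast; ring

theorem e1_spec : ∃ E1 : ℂ → ℂ, Differentiable ℂ E1 ∧ E1 0 ≠ 0 ∧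
    ∀ s, s * E1 s = Complex.exp (2 * Real.pi * Complex.I * s) - 1 := by
  set G : ℂ → ℂ := fun s => Complex.exp (2 * Real.pi * Complex.I * s)
  have hG : Differentiable ℂ G := by fun_prop
  refine ⟨dslope G 0, ?_, ?_, ?_⟩
  · rw [← differentiableOn_univ]
    exact (Complex.differentiableOn_dslope univ_mem).2 hG.differentiableOn
  · rw [dslope_same]
    have : HasDerivAt G (Complex.exp (2 * Real.pi * Complex.I * 0) * (2 * Real.pi * Complex.I)) 0 := by
      simpa using ((hasDerivAt_id (0 : ℂ)).const_mul (2 * Real.pi * Complex.I)).cexp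
    rw [this.deriv]; simp [Real.pi_ne_zero, Complex.I_ne_zero]
  · intro s
    have := sub_smul_dslope G 0 s
    simpa [G] using this

theorem en_two_norm {n : ℕ} {z : En n} {i j : Fin n} (hij : i ≠ j) (hz : z ∈ Ball n) :
    ‖z i‖ ^ 2 + ‖z j‖ ^ 2 < 1 := by
  have h1 : ‖z‖ < 1 := by simpa [Ball] using hz
  have h2 := EuclideanSpace.norm_sq_eq z
  have h3 : ∑ k ∈ ({i, j} : Finset (Fin n)), ‖z k‖ ^ 2 ≤ ∑ k, ‖z k‖ ^ 2 :=
    Finset.sum_le_univ_sum_of_nonneg fun _ => by positivity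
  rw [Finset.sum_pair hij] at h3
  nlinarith [norm_nonneg z]

theorem exists_nonRunge {n : ℕ} (hn : 2 ≤ n) : ∃ g, UnivalentOn n g ∧ ¬ MemF n g := by
  obtain ⟨T, hTd, hTi, hTb, hTs⟩ := strip_map
  obtain ⟨E1, hEd, hE0, hE⟩ := e1_spec
  set i0 : Fin n := ⟨0, by omega⟩ with hi0
  set i1 : Fin n := ⟨1, by omega⟩ with hi1
  have h01 : i0 ≠ i1 := by simp [hi0, hi1]
  set S : En n → ℂ := fun z => (1 - z i0 ^ 2) ^ (1 / 2 : ℂ) with hS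
  have hco : ∀ i, Differentiable ℂ (fun z : En n => z i) := fun i =>
    differentiable_euclidean.1 differentiable_id i
  have hre : ∀ z ∈ Ball n, 0 < ((1 : ℂ) - z i0 ^ 2).re := fun z hz => by
    have := en_two_norm h01 hz
    have h2 : (z i0 ^ 2).re ≤ ‖z i0‖ ^ 2 := by
      rw [← norm_pow]; exact Complex.re_le_norm _
    simp only [Complex.sub_re, Complex.one_re]
    nlinarith [sq_nonneg ‖z i1‖]
  have hSsq : ∀ z, S z ^ 2 = 1 - z i0 ^ 2 := fun z => by
    simp only [hS]
    rw [← Complex.cpow_nat_mul]; norm_num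
  have hSne : ∀ z ∈ Ball n, S z ≠ 0 := fun z hz h => by
    have := hre z hz
    rw [← hSsq z, h] at this; simp at this
  have hSd : DifferentiableOn ℂ S (Ball n) :=
    DifferentiableOn.cpow_const (((differentiable_const 1).sub ((hco i0).pow 2)).differentiableOn)
      (fun z hz => Or.inl (hre z hz))
  have hm0 : ∀ z ∈ Ball n, z i0 ∈ ball (0 : ℂ) 1 := fun z hz => by
    have := en_two_norm h01 hz
    rw [mem_ball_zero_iff]
    nlinarith [sq_nonneg ‖z i1‖, norm_nonneg (z i0)]
  have hm1 : ∀ z ∈ Ball n, z i1 / S z ∈ ball (0 : ℂ) 1 := fun z hz => by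
    have h1 := en_two_norm h01 hz
    have hp := norm_pos_iff.2 (hSne z hz)
    rw [mem_ball_zero_iff, norm_div, div_lt_one hp]
    have h2 : ‖S z‖ ^ 2 = ‖1 - z i0 ^ 2‖ := by rw [← norm_pow, hSsq]
    have h3 : 1 - ‖z i0‖ ^ 2 ≤ ‖1 - z i0 ^ 2‖ := by
      have := norm_sub_norm_le 1 (z i0 ^ 2)
      rwa [norm_one, norm_pow] at this
    nlinarith [norm_nonneg (z i1)]
  set X : En n → ℂ := fun z => T (z i0) with hX
  set Y : En n → ℂ := fun z => T (z i1 / S z) with hY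
  have hXd : DifferentiableOn ℂ X (Ball n) := hTd.comp (hco i0).differentiableOn hm0
  have hYd : DifferentiableOn ℂ Y (Ball n) :=
    hTd.comp (DifferentiableOn.congr ((hco i1).differentiableOn.mul (hSd.inv hSne))
      fun z _ => div_eq_mul_inv _ _) hm1
  set Z : En n → ℂ := fun z => X z + Complex.I * Y z with hZ
  set W : En n → ℂ := fun z => X z - Complex.I * Y z with hW
  have hZd : DifferentiableOn ℂ Z (Ball n) := hXd.add (hYd.const_mul _)
  have hWd : DifferentiableOn ℂ W (Ball n) := hXd.sub (hYd.const_mul _)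
  set g : En n → En n := fun z => WithLp.toLp 2 (fun i => if i = i0 then Z z else
    if i = i1 then W z * E1 (Z z * W z) else z i) with hg
  have hg0 : ∀ z, g z i0 = Z z := fun z => by simp [hg]
  have hg1 : ∀ z, g z i1 = W z * E1 (Z z * W z) := fun z => by simp [hg, h01.symm]
  have hg2 : ∀ z i, i ≠ i0 → i ≠ i1 → g z i = z i := fun z i h h' => by simp [hg, h, h']
  have hgd : DifferentiableOn ℂ g (Ball n) := by
    rw [differentiableOn_euclidean]
    intro i
    by_cases h : i = i0
    · subst h; simpa only [hg0] using hZd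
    by_cases h' : i = i1
    · subst h'; simp only [hg1]
      exact hWd.mul (hEd.comp_differentiableOn (hZd.mul hWd))
    · simp only [hg2 _ i h h']; exact (hco i).differentiableOn
  have hgi : InjOn g (Ball n) := by
    intro z hz w hw hzw
    have e0 : Z z = Z w := by rw [← hg0, ← hg0, hzw]
    have e1 : W z * E1 (Z z * W z) = W w * E1 (Z z * W w) := by
      have : g z i1 = g w i1 := by rw [hzw]
      rwa [hg1, hg1, ← e0] at this
    have hWe : W z = W w := by
      by_cases hZ0 : Z z = 0
      · rw [hZ0, zero_mul, zero_mul] at e1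
        exact mul_right_cancel₀ hE0 e1
      have e2 : Complex.exp (2 * Real.pi * Complex.I * (Z z * W z)) =
          Complex.exp (2 * Real.pi * Complex.I * (Z z * W w)) := by
        have := congrArg (fun t => Z z * t) e1
        simp only [← mul_assoc] at this
        rw [hE, hE] at this
        simpa [mul_assoc] using this
      rw [Complex.exp_eq_exp_iff_exists_int] at e2
      obtain ⟨m, hm⟩ := e2
      have hm' : Z z * (W z - W w) = m := by
        have h2 : (2 * Real.pi * Complex.I : ℂ) ≠ 0 := Complex.two_pi_I_ne_zero
        apply mul_left_cancel₀ h2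
        linear_combination hm
      obtain ⟨a1, a2⟩ := hTb _ (hm0 z hz)
      obtain ⟨b1, b2⟩ := hTb _ (hm1 z hz)
      obtain ⟨c1, c2⟩ := hTb _ (hm0 w hw)
      obtain ⟨d1, d2⟩ := hTb _ (hm1 w hw)
      change |(X z).re| ≤ _ at a1
      change |(X z).im| ≤ _ at a2
      change |(Y z).re| ≤ _ at b1
      change |(Y z).im| ≤ _ at b2
      change |(X w).im| ≤ _ at c2
      change |(Y w).im| ≤ _ at d2
      have hzn : ‖Z z‖ ≤ 5 / 2 := by
        have n1 := Complex.norm_le_abs_re_add_abs_im (X z)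
        have n2 := Complex.norm_le_abs_re_add_abs_im (Y z)
        have n3 : ‖Z z‖ ≤ ‖X z‖ + ‖Y z‖ := by simpa using norm_add_le (X z) (Complex.I * Y z)
        linarith
      have hwn : ‖W z - W w‖ ≤ 8 / 50 := by
        have k1 : W z - W w = 2 * (X z - X w) := by
          simp only [hZ] at e0
          simp only [hW]; linear_combination -e0
        have k2 : (X z - X w).re = (Y z - Y w).im := by
          have := congrArg Complex.re e0
          simp [hZ] at this
          simp; linarith
        have k3 := Complex.norm_le_abs_re_add_abs_im (X z - X w)
        rw [k2] at k3
        have k4 : |(Y z - Y w).im| ≤ 2 / 50 := by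
          rw [Complex.sub_im]; have := abs_sub (Y z).im (Y w).im; linarith
        have k5 : |(X z - X w).im| ≤ 2 / 50 := by
          rw [Complex.sub_im]; have := abs_sub (X z).im (X w).im; linarith
        rw [k1, norm_mul]; simp only [Complex.norm_ofNat]; linarith
      have hmn : ‖(m : ℂ)‖ < 1 := by
        rw [← hm', norm_mul]
        nlinarith [norm_nonneg (Z z), norm_nonneg (W z - W w)]
      have hm0 : m = 0 := by
        rw [Complex.norm_intCast] at hmn
        have : |m| < 1 := by exact_mod_cast hmn
        exact Int.abs_lt_one_iff.1 this
      rw [hm0] at hm'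
      simp only [Int.cast_zero] at hm'
      exact sub_eq_zero.1 ((mul_eq_zero.1 hm').resolve_left hZ0)
    have hXe : X z = X w := by
      simp only [hZ] at e0
      simp only [hW] at hWe
      linear_combination (e0 + hWe) / 2
    have hYe : Y z = Y w := by
      have : Complex.I * Y z = Complex.I * Y w := by
        simp only [hZ] at e0
        linear_combination e0 - hXe
      exact mul_left_cancel₀ Complex.I_ne_zero this
    have hz0 : z i0 = w i0 := hTi (hm0 z hz) (hm0 w hw) hXe
    have hSe : S z = S w := by simp only [hS, hz0]
    have hz1 : z i1 = w i1 := by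
      have := hTi (hm1 z hz) (hm1 w hw) hYe
      rw [hSe] at this
      exact (div_left_inj' (hSne w hw)).1 this
    ext i
    by_cases h : i = i0
    · rw [h, hz0]
    by_cases h' : i = i1
    · rw [h', hz1]
    rw [← hg2 z i h h', ← hg2 w i h h', hzw]
  have hgu : UnivalentOn n g := ⟨hgd, hgi⟩
  refine ⟨g, hgu, fun hF => ?_⟩
  -- points of the unit circle
  set ι : ℂ → En n := fun ζ => EuclideanSpace.single i0 ζ with hι
  have hpt : ∀ ζ ∈ sphere (0 : ℂ) 1, ∃ z ∈ Ball n, g z = ι ζ ∧ W z = ζ⁻¹ := by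
    intro ζ hζ
    have hζ : ‖ζ‖ = 1 := by simpa using hζ
    have hn2 : ζ.re ^ 2 + ζ.im ^ 2 = 1 := by
      have := Complex.sq_norm ζ
      rw [Complex.normSq_apply, hζ] at this; linarith
    obtain ⟨u, hu, hTu⟩ := hTs ζ.re ((Complex.abs_re_le_norm ζ).trans hζ.le)
    obtain ⟨v, hv, hTv⟩ := hTs ζ.im ((Complex.abs_im_le_norm ζ).trans hζ.le)
    have hu2 : u ^ 2 < 1 := by rw [sq_lt_one_iff_abs_lt_one]; exact hu
    have hv2 : v ^ 2 < 1 := by rw [sq_lt_one_iff_abs_lt_one]; exact hv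
    set z : En n := EuclideanSpace.single i0 (u : ℂ) +
      EuclideanSpace.single i1 ((1 - (u : ℂ) ^ 2) ^ (1 / 2 : ℂ) * (v : ℂ)) with hz
    have hz0 : z i0 = u := by simp [hz, h01]
    have hSz : S z = (1 - (u : ℂ) ^ 2) ^ (1 / 2 : ℂ) := by simp only [hS, hz0]
    have hz1 : z i1 = S z * v := by rw [hSz]; simp [hz, h01.symm]
    have hzj : ∀ i, i ≠ i0 → i ≠ i1 → z i = 0 := fun i h h' => by simp [hz, h, h']
    have hzB : z ∈ Ball n := by
      have : ‖z‖ ^ 2 < 1 := by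
        rw [EuclideanSpace.norm_sq_eq, ← Finset.sum_subset (Finset.subset_univ {i0, i1}),
          Finset.sum_pair h01, hz0, hz1, norm_mul, mul_pow, ← norm_pow (S z), hSsq, hz0]
        · rw [show (1 - (u : ℂ) ^ 2) = ((1 - u ^ 2 : ℝ) : ℂ) by push_cast; ring]
          simp only [Complex.norm_real, Real.norm_eq_abs, sq_abs]
          rw [abs_of_pos (by linarith)]
          nlinarith
        · intro i _ hi
          simp only [Finset.mem_insert, Finset.mem_singleton, not_or] at hi
          rw [hzj i hi.1 hi.2]; simp
      simp only [Ball, mem_ball_zero_iff]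
      nlinarith [norm_nonneg z]
    have hXz : X z = ζ.re := by simp only [hX, hz0, hTu]
    have hYz : Y z = ζ.im := by
      simp only [hY, hz1]
      rw [mul_div_cancel_left₀ _ (hSne z hzB), hTv]
    have hZz : Z z = ζ := by
      simp only [hZ, hXz, hYz]; rw [mul_comm]; exact Complex.re_add_im ζ
    have hζ0 : ζ ≠ 0 := by rintro rfl; simp at hζ
    have hWz : W z = ζ⁻¹ := by
      refine eq_inv_of_mul_eq_one_left ?_
      conv_lhs => rw [← Complex.re_add_im ζ]
      simp only [hW, hXz, hYz]
      have : ((ζ.re ^ 2 + ζ.im ^ 2 : ℝ) : ℂ) = 1 := by rw [hn2]; simp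
      push_cast at this
      linear_combination this - (ζ.im : ℂ) ^ 2 * Complex.I_sq
    refine ⟨z, hzB, ?_, hWz⟩
    have hE1 : E1 1 = 0 := by
      have := hE 1
      rw [one_mul, mul_one, Complex.exp_two_pi_mul_I, sub_self] at this; exact this
    ext i
    by_cases h : i = i0
    · rw [h, hg0, hZz]; simp [hι]
    by_cases h' : i = i1
    · rw [h', hg1, hZz, hWz, mul_inv_cancel₀ hζ0, hE1]; simp [hι, h01.symm]
    rw [hg2 z i h h', hzj i h h']; simp [hι, h]
  have hιc : Differentiable ℂ ι := by
    rw [differentiable_euclidean]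
    intro i
    by_cases h : i = i0
    · subst h; simp [hι]
    · simp [hι, h]
  obtain ⟨p, hp, hlim⟩ := hF.2 (fun y => ι (W (Function.invFunOn g (Ball n) y)))
    (hιc.comp_differentiableOn (hWd.comp hgu.inv_diff fun y hy => inv_mem hy))
  rw [tendstoLocallyUniformlyOn_iff_forall_isCompact hgu.isOpen] at hlim
  have := hlim (ι '' sphere 0 1) (by
    rintro _ ⟨ζ, hζ, rfl⟩
    obtain ⟨z, hz, hgz, -⟩ := hpt ζ hζ
    exact ⟨z, hz, hgz⟩) ((isCompact_sphere _ _).image hιc.continuous)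
  rw [Metric.tendstoUniformlyOn_iff] at this
  obtain ⟨k, hk⟩ := (this (1 / 2) (by norm_num)).exists
  set q : ℂ → ℂ := fun ζ => p k (ι ζ) i0 with hq
  have hqd : Differentiable ℂ q :=
    (differentiable_euclidean.1 ((hp k).differentiable.comp hιc)) i0
  have hqb : ∀ ζ ∈ sphere (0 : ℂ) 1, ‖(ζ - 0)⁻¹ - q ζ‖ ≤ 1 / 2 := by
    intro ζ hζ
    obtain ⟨z, hz, hgz, hWz⟩ := hpt ζ hζ
    have h1 := (hk _ (mem_image_of_mem _ hζ)).le
    rw [← hgz, hgu.inv_unique hz, hWz, dist_eq_norm, hgz] at h1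
    have h2 := (PiLp.norm_apply_le (ι ζ⁻¹ - p k (ι ζ)) i0).trans h1
    simpa [hι, hq] using h2
  have c1 : (∮ ζ in C(0, 1), q ζ) = 0 :=
    Complex.circleIntegral_eq_zero_of_differentiable_on_off_countable zero_le_one countable_empty
      hqd.continuous.continuousOn fun z _ => hqd z
  have c2 : (∮ ζ in C(0, 1), (ζ - 0)⁻¹) = 2 * Real.pi * Complex.I :=
    circleIntegral.integral_sub_center_inv 0 one_ne_zero
  have ci1 : CircleIntegrable q 0 1 := hqd.continuous.continuousOn.circleIntegrable zero_le_one
  have ci2 : CircleIntegrable (fun ζ : ℂ => (ζ - 0)⁻¹) 0 1 := by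
    refine ContinuousOn.circleIntegrable zero_le_one ?_
    refine ContinuousOn.inv₀ (by fun_prop) fun ζ hζ h => ?_
    rw [sub_zero] at h; subst h; simp at hζ
  have c3 := circleIntegral.integral_sub ci2 ci1
  have c4 := circleIntegral.norm_integral_le_of_norm_le_const zero_le_one hqb
  rw [c3, c1, c2, sub_zero] at c4
  simp [abs_of_pos Real.pi_pos] at c4
  linarith [Real.pi_pos]
end

noncomputable section

section Aut
variable {n : ℕ}

/-- Holomorphic automorphisms of `ℂⁿ`. -/
def IsAut (Φ : En n → En n) : Prop := Differentiable ℂ Φ ∧ Function.Bijective Φ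

theorem IsAut.comp {Φ Ψ : En n → En n} (h : IsAut Φ) (h' : IsAut Ψ) : IsAut (fun z => Φ (Ψ z)) :=
  ⟨h.1.comp h'.1, h.2.comp h'.2⟩

theorem isAut_id : IsAut (fun z : En n => z) := ⟨differentiable_id, Function.bijective_id⟩

theorem IsAut.lip {Φ : En n → En n} (h : IsAut Φ) (R : ℝ) : ∃ C, 0 ≤ C ∧
    ∀ z ∈ closedBall (0 : En n) R, ∀ w ∈ closedBall (0 : En n) R, ‖Φ z - Φ w‖ ≤ C * ‖z - w‖ := by
  have hc : Continuous (fderiv ℂ Φ) := by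
    have := (scv_fderiv_differentiableOn isOpen_univ h.1.differentiableOn).continuousOn
    rwa [← continuousOn_univ]
  obtain ⟨C, hC⟩ := (isCompact_closedBall (0 : En n) R).exists_bound_of_continuousOn hc.continuousOn
  refine ⟨max C 0, le_max_right _ _, fun z hz w hw => ?_⟩
  exact (convex_closedBall (0 : En n) R).norm_image_sub_le_of_norm_fderiv_le (𝕜 := ℂ)
    (fun x _ => h.1 x) (fun x hx => (hC x hx).trans (le_max_left _ _)) hw hz

theorem IsAut.memE {Φ : En n → En n} (h : IsAut Φ) : MemE n Φ := by
  have hne : ∀ t : ℝ, (Real.exp t : ℂ) ≠ 0 := fun t => by exact_mod_cast (Real.exp_pos t).ne'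
  have hnorm : ∀ (t : ℝ) (z : En n), ‖(Real.exp t : ℂ) • z‖ = Real.exp t * ‖z‖ := fun t z => by
    rw [norm_smul, Complex.norm_real, Real.norm_of_nonneg (Real.exp_pos t).le]
  refine ⟨⟨h.1.differentiableOn, h.2.1.injOn⟩, fun t z => Φ ((Real.exp t : ℂ) • z),
    ⟨?_, ?_, ?_⟩, ?_, ?_⟩
  · intro t _
    have hs : Differentiable ℂ (fun z : En n => (Real.exp t : ℂ) • z) := by fun_prop
    refine ⟨(h.1.comp hs).differentiableOn, ?_⟩
    intro z _ w _ hzw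
    exact smul_right_injective _ (hne t) (h.2.1 hzw)
  · rintro s t _ hst _ ⟨z, hz, rfl⟩
    refine ⟨(Real.exp (s - t) : ℂ) • z, ?_, ?_⟩
    · have hz : ‖z‖ < 1 := by simpa [Ball] using hz
      rw [Ball, mem_ball_zero_iff, hnorm]
      have : Real.exp (s - t) ≤ 1 := Real.exp_le_one_iff.2 (by linarith)
      nlinarith [Real.exp_pos (s - t), norm_nonneg z]
    · simp only [smul_smul, ← Complex.ofReal_mul, ← Real.exp_add]
      congr 4; ring
  · intro K hK _ T hT
    obtain ⟨C, hC0, hC⟩ := h.lip (Real.exp T)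
    refine ⟨fun _ => C * Real.exp T, fun _ => by positivity, ?_, ?_⟩
    · exact integrableOn_const (by simp)
    · intro z hz s t hs hst htT
      have hz : ‖z‖ < 1 := by simpa [Ball] using hK hz
      have hb : ∀ t ≤ T, (Real.exp t : ℂ) • z ∈ closedBall (0 : En n) (Real.exp T) := fun t ht => by
        rw [mem_closedBall_zero_iff, hnorm]
        have := Real.exp_le_exp.2 ht
        nlinarith [Real.exp_pos t, norm_nonneg z]
      have h1 := hC _ (hb s (by linarith)) _ (hb t htT)
      rw [← sub_smul, ← Complex.ofReal_sub, norm_smul, Complex.norm_real, Real.norm_eq_abs] at h1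
      have h2 : |Real.exp s - Real.exp t| ≤ Real.exp T * (t - s) := by
        rw [abs_sub_comm, abs_of_nonneg (by linarith [Real.exp_le_exp.2 hst])]
        have e1 : Real.exp s = Real.exp t * Real.exp (s - t) := by rw [← Real.exp_add]; ring_nf
        have e2 := Real.add_one_le_exp (s - t)
        have e3 := Real.exp_le_exp.2 htT
        have e4 := Real.exp_pos t
        nlinarith
      rw [setIntegral_const]
      simp only [Real.volume_real_Icc_of_le hst, smul_eq_mul]
      refine h1.trans ?_
      have : |Real.exp s - Real.exp t| * ‖z‖ ≤ Real.exp T * (t - s) := by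
        nlinarith [abs_nonneg (Real.exp s - Real.exp t), norm_nonneg z]
      nlinarith
  · simp
  · rw [eq_univ_iff_forall]
    intro y
    obtain ⟨w, rfl⟩ := h.2.2 y
    simp only [ChainRange, mem_iUnion, mem_Ici]
    refine ⟨‖w‖, norm_nonneg _, (Real.exp (-‖w‖) : ℂ) • w, ?_, ?_⟩
    · rw [Ball, mem_ball_zero_iff, hnorm, Real.exp_neg, inv_mul_lt_one₀ (Real.exp_pos _)]
      linarith [Real.add_one_le_exp ‖w‖]
    · simp only [smul_smul, ← Complex.ofReal_mul, ← Real.exp_add]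
      simp

/-- Vector fields infinitesimally generated by automorphisms. -/
def Gen (p : En n → En n) : Prop := Continuous p ∧ ∀ R > 0, ∀ ε > 0, ∃ h0 > 0, ∀ h : ℝ, 0 < h →
  h < h0 → ∃ Ψ : En n → En n, IsAut Ψ ∧ ∀ z, ‖z‖ ≤ R → ‖Ψ z - z - (h : ℂ) • p z‖ ≤ ε * h

theorem gen_zero : Gen (fun _ : En n => (0 : En n)) :=
  ⟨continuous_const, fun R _ ε hε => ⟨1, one_pos, fun h hh _ => ⟨_, isAut_id, fun z _ => by
    simp; positivity⟩⟩⟩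

theorem Gen.add {p1 p2 : En n → En n} (h1 : Gen p1) (h2 : Gen p2) : Gen (fun z => p1 z + p2 z) := by
  refine ⟨h1.1.add h2.1, fun R hR ε hε => ?_⟩
  obtain ⟨M, hM⟩ := (isCompact_closedBall (0 : En n) R).exists_bound_of_continuousOn h2.1.continuousOn
  have hM0 : 0 ≤ M := (norm_nonneg _).trans (hM 0 (by simp [hR.le]))
  have huc := (isCompact_closedBall (0 : En n) (R + 1)).uniformContinuousOn_of_continuous
    h1.1.continuousOn
  rw [Metric.uniformContinuousOn_iff] at huc
  obtain ⟨δ, hδ, huc⟩ := huc (ε / 3) (by positivity)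
  obtain ⟨a, ha, H1⟩ := h1.2 (R + 1) (by linarith) (ε / 3) (by positivity)
  obtain ⟨b, hb, H2⟩ := h2.2 R hR (ε / 3) (by positivity)
  set D := min 1 δ / (M + ε) with hD
  have hD0 : 0 < D := by positivity
  refine ⟨min (min a b) D, by positivity, fun h hh hlt => ?_⟩
  have hla : h < a := hlt.trans_le ((min_le_left _ _).trans (min_le_left _ _))
  have hlb : h < b := hlt.trans_le ((min_le_left _ _).trans (min_le_right _ _))
  have hlD : h < D := hlt.trans_le (min_le_right _ _)
  obtain ⟨Ψ1, hA1, hΨ1⟩ := H1 h hh hla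
  obtain ⟨Ψ2, hA2, hΨ2⟩ := H2 h hh hlb
  refine ⟨_, hA1.comp hA2, fun z hz => ?_⟩
  set w := Ψ2 z with hw
  have e2 := hΨ2 z hz
  have hhn : ∀ v : En n, ‖(h : ℂ) • v‖ = h * ‖v‖ := fun v => by
    rw [norm_smul, Complex.norm_real, Real.norm_of_nonneg hh.le]
  have hwz : ‖w - z‖ < min 1 δ := by
    have : ‖w - z‖ ≤ ‖w - z - (h : ℂ) • p2 z‖ + ‖(h : ℂ) • p2 z‖ := by
      simpa using norm_add_le (w - z - (h : ℂ) • p2 z) ((h : ℂ) • p2 z)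
    rw [hhn] at this
    have h3 := hM z (by simpa using hz)
    have h4 : h * (M + ε) < min 1 δ := by rwa [hD, lt_div_iff₀ (by positivity)] at hlD
    nlinarith
  have hw1 : ‖w‖ ≤ R + 1 := by
    have h2 : ‖w‖ ≤ ‖z‖ + ‖w - z‖ := by simpa using norm_add_le z (w - z)
    linarith [min_le_left 1 δ]
  have e1 := hΨ1 w hw1
  have e3 := huc w (by simpa using hw1) z (by simp; linarith) (by
    rw [dist_eq_norm]; exact hwz.trans_le (min_le_right _ _))
  rw [dist_eq_norm] at e3
  calc ‖Ψ1 w - z - (h : ℂ) • (p1 z + p2 z)‖ = ‖(Ψ1 w - w - (h : ℂ) • p1 w) +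
        (w - z - (h : ℂ) • p2 z) + (h : ℂ) • (p1 w - p1 z)‖ := by
          congr 1; rw [smul_add, smul_sub]; abel
    _ ≤ _ := norm_add₃_le
    _ ≤ ε / 3 * h + ε / 3 * h + h * (ε / 3) := by
      rw [hhn]; gcongr
    _ = ε * h := by ring

theorem e2_spec : ∃ E2 : ℂ → ℂ, Differentiable ℂ E2 ∧ E2 0 = 1 ∧
    (∀ s, s * E2 s = Complex.exp s - 1) ∧ ∀ s, Complex.exp s * E2 (-s) = E2 s := by
  have h0 : dslope Complex.exp 0 0 = 1 := by simp [dslope_same]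
  have h1 : ∀ s, s * dslope Complex.exp 0 s = Complex.exp s - 1 := fun s => by
    have := sub_smul_dslope Complex.exp 0 s
    simpa using this
  refine ⟨dslope Complex.exp 0, ?_, h0, h1, fun s => ?_⟩
  · rw [← differentiableOn_univ]
    exact (Complex.differentiableOn_dslope univ_mem).2 Complex.differentiable_exp.differentiableOn
  · by_cases hs : s = 0
    · subst hs; simp
    · apply mul_left_cancel₀ hs
      have h2 := h1 (-s)
      have h3 : Complex.exp s * Complex.exp (-s) = 1 := by rw [← Complex.exp_add]; simp
      rw [h1 s]
      linear_combination -Complex.exp s * h2 - h3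

theorem gen_overshear {g l : En n → ℂ} (hg : Differentiable ℂ g) (hl : Differentiable ℂ l)
    {v : En n} {μ : ℂ} (hgv : ∀ z (s : ℂ), g (z + s • v) = g z)
    (hlv : ∀ z (s : ℂ), l (z + s • v) = l z + s * μ) : Gen (fun z => (g z * l z) • v) := by
  obtain ⟨E2, hd, h0, h1, h2⟩ := e2_spec
  refine ⟨((hg.continuous.mul hl.continuous).smul continuous_const), fun R hR ε hε => ?_⟩
  let Ψ : ℂ → En n → En n := fun h z => z + (h * g z * l z * E2 (h * g z * μ)) • v
  have hcomp : ∀ h z, Ψ (-h) (Ψ h z) = z := by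
    intro h z
    simp only [Ψ]
    rw [hgv, hlv, add_assoc, ← add_smul]
    convert add_zero z
    rw [smul_eq_zero]; left
    set s := h * g z * μ with hs
    have e1 := h2 s
    have e2 := h1 s
    rw [show -h * g z * μ = -s by rw [hs]; ring]
    have e3 : l z + h * g z * l z * E2 s * μ = l z * Complex.exp s := by
      linear_combination l z * e2 + l z * E2 s * (-hs)
    rw [e3]
    linear_combination -(h * g z * l z) * e1
  have hdiff : ∀ h, Differentiable ℂ (Ψ h) := fun h => by
    simp only [Ψ]
    have a1 : Differentiable ℂ (fun z => h * g z * μ) := (hg.const_mul h).mul_const μ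
    have a2 : Differentiable ℂ (fun z => E2 (h * g z * μ)) := hd.comp a1
    exact differentiable_id.add ((((hg.const_mul h).mul hl).mul a2).smul_const v)
  have haut : ∀ h, IsAut (Ψ h) := fun h => ⟨hdiff h,
    Function.LeftInverse.injective (g := Ψ (-h)) (hcomp h),
    Function.RightInverse.surjective (g := Ψ (-h)) fun z => by simpa using hcomp (-h) z⟩
  obtain ⟨M, hM⟩ := (isCompact_closedBall (0 : En n) R).exists_bound_of_continuousOn
    ((hg.continuous.mul_const μ).continuousOn)
  obtain ⟨M', hM'⟩ := (isCompact_closedBall (0 : En n) R).exists_bound_of_continuousOn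
    ((((hg.continuous.mul hl.continuous).smul continuous_const) : Continuous
      (fun z => (g z * l z) • v)).continuousOn)
  have hM0 : 0 ≤ M := (norm_nonneg _).trans (hM 0 (by simp [hR.le]))
  have hM0' : 0 ≤ M' := (norm_nonneg _).trans (hM' 0 (by simp [hR.le]))
  have hc := hd.continuous.continuousAt (x := 0)
  rw [Metric.continuousAt_iff] at hc
  obtain ⟨δ, hδ, hc⟩ := hc (ε / (M' + 1)) (by positivity)
  refine ⟨δ / (M + 1), by positivity, fun h hh hlt => ⟨Ψ h, haut h, fun z hz => ?_⟩⟩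
  have hz' : z ∈ closedBall (0 : En n) R := by simpa using hz
  have e1 : Ψ h z - z - (h : ℂ) • (g z * l z) • v =
      ((h : ℂ) * (E2 (h * g z * μ) - 1)) • (g z * l z) • v := by
    simp only [Ψ, smul_smul, add_sub_cancel_left, ← sub_smul]
    congr 1; ring
  rw [e1, norm_smul, norm_mul, Complex.norm_real, Real.norm_of_nonneg hh.le]
  have e2 := hM' z hz'
  have e3 : ‖E2 (h * g z * μ) - 1‖ ≤ ε / (M' + 1) := by
    rw [← h0, ← dist_eq_norm]
    refine (hc ?_).le
    rw [dist_zero_right, mul_assoc, norm_mul, Complex.norm_real, Real.norm_of_nonneg hh.le]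
    have := hM z hz'
    rw [lt_div_iff₀ (by positivity)] at hlt
    nlinarith
  rw [le_div_iff₀ (by positivity)] at e3
  have e4 := norm_nonneg (E2 (h * g z * μ) - 1)
  calc h * ‖E2 (h * g z * μ) - 1‖ * ‖(g z * l z) • v‖ ≤ h * ‖E2 (h * g z * μ) - 1‖ * (M' + 1) := by
        gcongr; exact e2.trans (by linarith)
    _ ≤ ε * h := by nlinarith
end Aut
end

noncomputable section

section GenV
variable {n : ℕ}
open MvPolynomial in
theorem mkPoly_add (q q' : Fin n → MvPolynomial (Fin n) ℂ) (z : En n) :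
    mkPoly (q + q') z = mkPoly q z + mkPoly q' z := by
  ext i; simp [mkPoly]

theorem mkPoly_smul (c : ℂ) (q : Fin n → MvPolynomial (Fin n) ℂ) (z : En n) :
    mkPoly (c • q) z = c • mkPoly q z := by
  ext i; simp [mkPoly, MvPolynomial.smul_eval]

/-- Polynomial vector fields generated by automorphisms. -/
def genV (n : ℕ) : Submodule ℂ (Fin n → MvPolynomial (Fin n) ℂ) where
  carrier := {q | ∀ c : ℂ, Gen (fun z => c • mkPoly q z)}
  zero_mem' := fun c => by
    have : (fun z : En n => c • mkPoly (0 : Fin n → MvPolynomial (Fin n) ℂ) z) = fun _ => 0 := by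
      funext z; ext i; simp [mkPoly]
    rw [this]; exact gen_zero
  add_mem' := fun {q q'} h h' c => by
    simp only [mkPoly_add, smul_add]; exact (h c).add (h' c)
  smul_mem' := fun a q h c => by
    simp only [mkPoly_smul, smul_smul]; exact h (c * a)

theorem genV_overshear {G L : MvPolynomial (Fin n) ℂ} {w : Fin n → ℂ} {μ : ℂ}
    (hG : ∀ (z : Fin n → ℂ) (s : ℂ), MvPolynomial.eval (fun k => z k + s * w k) G = MvPolynomial.eval z G)
    (hL : ∀ (z : Fin n → ℂ) (s : ℂ), MvPolynomial.eval (fun k => z k + s * w k) L =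
      MvPolynomial.eval z L + s * μ) : (fun k => w k • (G * L)) ∈ genV n := by
  intro c
  have := gen_overshear (g := fun z : En n => c * MvPolynomial.eval (fun j => z j) G)
    (l := fun z : En n => MvPolynomial.eval (fun j => z j) L) (v := WithLp.toLp 2 w) (μ := μ)
    ((mv_eval_differentiable G).const_mul c) (mv_eval_differentiable L)
    (fun z s => by
      have := hG z s
      simp only [PiLp.add_apply, PiLp.smul_apply, smul_eq_mul]; rw [this])
    (fun z s => by
      have := hL z s
      simp only [PiLp.add_apply, PiLp.smul_apply, smul_eq_mul]; rw [this])
  convert this using 2 with z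
  ext i
  simp [mkPoly, MvPolynomial.smul_eval]; ring

theorem coeff_extract {N : ℕ} {a b : ℕ → ℂ} (hb : b N = 0)
    (h : ∀ c : ℂ, ∑ j ∈ Finset.range N, (c ^ (j + 1) * a j - c ^ j * b j) = 0) :
    b 0 = 0 ∧ ∀ p < N, a p = b (p + 1) := by
  set P : Polynomial ℂ := ∑ j ∈ Finset.range N, (Polynomial.C (a j) * Polynomial.X ^ (j + 1) -
    Polynomial.C (b j) * Polynomial.X ^ j) with hP
  have hP0 : P = 0 := by
    apply Polynomial.funext
    intro c
    rw [Polynomial.eval_zero, ← h c, hP, Polynomial.eval_finset_sum]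
    refine Finset.sum_congr rfl fun j _ => ?_
    simp; ring
  have hco : ∀ k, P.coeff k = 0 := fun k => by rw [hP0]; simp
  constructor
  · have := hco 0
    rcases Nat.eq_zero_or_pos N with rfl | hN
    · exact hb
    simp only [hP, Polynomial.finset_sum_coeff, Polynomial.coeff_sub, Polynomial.coeff_C_mul,
      Polynomial.coeff_X_pow, Finset.sum_sub_distrib, mul_ite, mul_one, mul_zero] at this
    rw [Finset.sum_ite_eq] at this
    simpa [hN] using this
  · intro p hp
    have := hco (p + 1)
    simp only [hP, Polynomial.finset_sum_coeff, Polynomial.coeff_sub, Polynomial.coeff_C_mul,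
      Polynomial.coeff_X_pow, Finset.sum_sub_distrib, mul_ite, mul_one, mul_zero,
      Nat.add_right_cancel_iff] at this
    rw [Finset.sum_ite_eq, Finset.sum_ite_eq] at this
    simp only [Finset.mem_range, hp, if_true] at this
    by_cases h1 : p + 1 < N
    · simp only [h1, if_true] at this
      exact sub_eq_zero.1 this
    · have h2 : p + 1 = N := by omega
      simp only [h1, if_false, sub_zero] at this
      rw [h2, hb, this]

theorem binom_solve {m : ℕ} {A B : ℕ → ℂ}
    (h1 : ∀ c : ℂ, ∑ j ∈ Finset.range (m + 1), (c ^ (j + 1) * (m.choose j * A j) -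
      c ^ j * (m.choose j * B j)) = 0)
    (h2 : ∀ c : ℂ, ∑ j ∈ Finset.range (m + 1), (c ^ (j + 1) * (m.choose j * A (j + 1)) -
      c ^ j * (m.choose j * B (j + 1))) = 0) : ∀ p ≤ m, A p = 0 := by
  obtain ⟨-, k1⟩ := coeff_extract (by simp) h1
  obtain ⟨k0, k2⟩ := coeff_extract (by simp) h2
  intro p hp
  have hc : ∀ p ≤ m, ((m.choose p : ℕ) : ℂ) ≠ 0 := fun p hp => by
    exact_mod_cast (Nat.choose_pos hp).ne'
  have hrec : ∀ p ≤ m, ((m.choose (p + 1) : ℕ) : ℂ) * (p + 1) = m.choose p * (m - p) := fun p hp => by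
    have := Nat.choose_succ_right_eq m p
    have h3 : ((m - p : ℕ) : ℂ) = m - p := by rw [Nat.cast_sub hp]
    rw [← h3]; exact_mod_cast this
  have e1 : (p + 1) * A p = (m - p) * B (p + 1) := by
    apply mul_left_cancel₀ (hc p hp)
    linear_combination (p + 1) * k1 p (by omega) + B (p + 1) * hrec p hp
  rcases p with _ | p
  · have : B 1 = 0 := by simpa using k0
    rw [zero_add, this] at e1
    simpa using e1
  · have e2 : (p + 1) * A (p + 1) = (m - p) * B (p + 2) := by
      apply mul_left_cancel₀ (hc (p + 1) hp)
      have := k2 p (by omega)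
      have h5 := hrec p (by omega)
      have h6 : (m.choose (p + 1) : ℂ) * ((p + 1) * A (p + 1)) = m.choose p * (m - p) * A (p + 1) := by
        linear_combination A (p + 1) * h5
      rw [h6]
      linear_combination (m - p) * this
    push_cast at e1
    have e3 : A (p + 1) = - B (p + 2) := by linear_combination e1 - e2
    have e4 : ((m : ℂ) + 1) * A (p + 1) = 0 := by
      linear_combination e2 + (m - p) * e3
    have : ((m : ℂ) + 1) ≠ 0 := by exact_mod_cast Nat.succ_ne_zero m
    exact (mul_eq_zero.1 e4).resolve_left this

theorem genV_top (hn : 2 ≤ n) : genV n = ⊤ := by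
  by_contra hne
  obtain ⟨l, hl0, hl⟩ := Submodule.exists_le_ker_of_lt_top _ (lt_top_iff_ne_top.2 hne)
  have hl : ∀ q ∈ genV n, l q = 0 := fun q hq => hl hq
  apply hl0
  refine LinearMap.pi_ext' fun i => MvPolynomial.linearMap_ext fun α => LinearMap.ext_ring ?_
  change l (Pi.single i (MvPolynomial.monomial α 1)) = 0
  obtain ⟨j, hij⟩ : ∃ j : Fin n, j ≠ i := by
    have : Nontrivial (Fin n) := Fin.nontrivial_iff_two_le.2 hn
    exact exists_ne i
  have hmon : ∀ α : Fin n →₀ ℕ, (MvPolynomial.monomial α (1 : ℂ)) = ∏ k, MvPolynomial.X k ^ α k := by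
    intro α
    rw [MvPolynomial.monomial_eq, map_one, one_mul, Finsupp.prod_fintype]
    intro i; simp
  by_cases hα : α i = 0
  · have := genV_overshear (n := n) (G := MvPolynomial.monomial α 1) (L := 1) (w := Pi.single i 1)
      (μ := 0) (fun z s => by
        rw [hmon]; simp only [map_prod, map_pow, MvPolynomial.eval_X]
        refine Finset.prod_congr rfl fun k _ => ?_
        by_cases hk : k = i
        · subst hk; simp [hα]
        · simp [hk]) (fun z s => by simp)
    rw [← hl _ this]
    congr 1
    funext k
    by_cases hk : k = i
    · subst hk; simp
    · simp [hk]
  set M : MvPolynomial (Fin n) ℂ := ∏ k ∈ (Finset.univ.erase i).erase j, MvPolynomial.X k ^ α k with hM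
  have hMα : MvPolynomial.monomial α (1 : ℂ) = M * MvPolynomial.X j ^ α j * MvPolynomial.X i ^ α i := by
    rw [hmon, hM, Finset.prod_erase_mul _ _ (by simp [hij]), Finset.prod_erase_mul _ _ (by simp)]
  obtain ⟨m, hm⟩ : ∃ m, α i + α j = m + 1 := ⟨α i + α j - 1, by omega⟩
  set mon : ℕ → MvPolynomial (Fin n) ℂ := fun p => M * MvPolynomial.X j ^ p * MvPolynomial.X i ^ (m + 1 - p)
  set A : ℕ → ℂ := fun p => l (Pi.single i (mon p)) with hA
  set B : ℕ → ℂ := fun p => l (Pi.single j (mon p)) with hB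
  have hw : ∀ (c : ℂ) k, (Pi.single i c - Pi.single j 1 : Fin n → ℂ) k =
      if k = i then c else if k = j then -1 else 0 := by
    intro c k
    by_cases h : k = i
    · subst h; simp [hij.symm]
    · by_cases h' : k = j
      · subst h'; simp [h]
      · simp [h, h']
  have hover : ∀ (c : ℂ) (L : MvPolynomial (Fin n) ℂ) (μ : ℂ), (∀ (z : Fin n → ℂ) (s : ℂ),
      MvPolynomial.eval (fun k => z k + s * (Pi.single i c - Pi.single j 1 : Fin n → ℂ) k) L =
      MvPolynomial.eval z L + s * μ) →
      l (fun k => (Pi.single i c - Pi.single j 1 : Fin n → ℂ) k •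
        (M * (c • MvPolynomial.X j + MvPolynomial.X i) ^ m * L)) = 0 := by
    intro c L μ hL
    refine hl _ (genV_overshear (fun z s => ?_) hL)
    simp only [hM, map_mul, map_prod, map_pow, map_add, MvPolynomial.eval_X, MvPolynomial.smul_eval, hw]
    congr 1
    · refine Finset.prod_congr rfl fun k hk => ?_
      simp only [Finset.mem_erase] at hk
      simp [hk.1, hk.2.1]
    · simp only [hij, if_true, if_false]; congr 1; ring
  have hsplit : ∀ (c : ℂ) (P : MvPolynomial (Fin n) ℂ),
      l (fun k => (Pi.single i c - Pi.single j 1 : Fin n → ℂ) k • P) =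
        c * l (Pi.single i P) - l (Pi.single j P) := by
    intro c P
    have : (fun k => (Pi.single i c - Pi.single j 1 : Fin n → ℂ) k • P) =
        c • (Pi.single i P : Fin n → MvPolynomial (Fin n) ℂ) - Pi.single j P := by
      funext k
      rw [hw]
      by_cases h : k = i
      · subst h; simp [hij.symm]
      · by_cases h' : k = j
        · subst h'; simp [h]
        · simp [h, h']
    rw [this, map_sub, map_smul, smul_eq_mul]
  have hexp : ∀ (c : ℂ) (L : MvPolynomial (Fin n) ℂ),
      M * (c • MvPolynomial.X j + MvPolynomial.X i) ^ m * L = ∑ p ∈ Finset.range (m + 1),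
        (c ^ p * m.choose p) • (M * MvPolynomial.X j ^ p * MvPolynomial.X i ^ (m - p) * L) := by
    intro c L
    rw [add_pow, Finset.mul_sum, Finset.sum_mul]
    refine Finset.sum_congr rfl fun p _ => ?_
    rw [smul_pow]
    simp only [MvPolynomial.smul_eq_C_mul, map_mul, map_pow, map_natCast]
    ring
  have hlsum : ∀ (k : Fin n) (f : ℕ → ℂ) (Q : ℕ → MvPolynomial (Fin n) ℂ),
      l (Pi.single k (∑ p ∈ Finset.range (m + 1), f p • Q p)) =
        ∑ p ∈ Finset.range (m + 1), f p * l (Pi.single k (Q p)) := by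
    intro k f Q
    have : ∀ P, l (Pi.single k P) = (l ∘ₗ LinearMap.single ℂ _ k) P := fun P => rfl
    simp only [this, map_sum, map_smul, smul_eq_mul]
  have hres := binom_solve (m := m) (A := A) (B := B) ?_ ?_ (α j) (by omega)
  · rw [hMα]
    simp only [hA, mon] at hres
    rwa [show m + 1 - α j = α i by omega] at hres
  · intro c
    have := hover c (MvPolynomial.X i) c (fun z s => by
      simp only [MvPolynomial.eval_X, hw, if_true])
    rw [hsplit, hexp, hlsum, hlsum, Finset.mul_sum, ← Finset.sum_sub_distrib] at this
    rw [← this]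
    refine Finset.sum_congr rfl fun p hp => ?_
    have hp : p ≤ m := by simpa [Nat.lt_succ_iff] using hp
    have e : M * MvPolynomial.X j ^ p * MvPolynomial.X i ^ (m - p) * MvPolynomial.X i = mon p := by
      simp only [mon]; rw [show m + 1 - p = (m - p) + 1 by omega]; ring
    rw [e]; simp only [hA, hB]; ring
  · intro c
    have := hover c (MvPolynomial.X j) (-1) (fun z s => by
      simp only [MvPolynomial.eval_X, hw, if_true, hij, if_false])
    rw [hsplit, hexp, hlsum, hlsum, Finset.mul_sum, ← Finset.sum_sub_distrib] at this
    rw [← this]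
    refine Finset.sum_congr rfl fun p hp => ?_
    have hp : p ≤ m := by simpa [Nat.lt_succ_iff] using hp
    have e : M * MvPolynomial.X j ^ p * MvPolynomial.X i ^ (m - p) * MvPolynomial.X j = mon (p + 1) := by
      simp only [mon]; rw [show m + 1 - (p + 1) = m - p by omega]; ring
    rw [e]; simp only [hA, hB]; ring

theorem gen_poly (hn : 2 ≤ n) {p : En n → En n} (hp : IsPolyMap n p) : Gen p := by
  obtain ⟨q, rfl⟩ := hp.eq_mk
  have : q ∈ genV n := by rw [genV_top hn]; trivial
  simpa using this 1
end GenV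
end

noncomputable section

section AL
variable {n : ℕ}

theorem norm_le_of_close {E : Type*} [NormedAddCommGroup E] {u v : E} {a b : ℝ} (h : ‖u‖ ≤ a)
    (h' : ‖v - u‖ ≤ b) : ‖v‖ ≤ a + b := by
  have : ‖v‖ ≤ ‖u‖ + ‖v - u‖ := by simpa using norm_add_le u (v - u)
  linarith

theorem al_step (hn : 2 ≤ n) {f : En n → En n} (hF : MemF n f) {ρ η : ℝ} (hρ0 : 0 ≤ ρ) (hρ : ρ < 1)
    (hη : 0 < η) : ∃ h0 > 0, ∀ h : ℝ, 0 < h → h < h0 → ∃ Θ, IsAut Θ ∧ ∀ w, ‖w‖ ≤ ρ →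
      ∃ w' ∈ Ball n, Θ (f w) = f w' ∧ ‖w' - ((1 + h : ℝ) : ℂ) • w‖ ≤ η * h := by
  obtain ⟨hf, hR⟩ := hF
  set δ := (1 - ρ) / 2 with hδ
  have hδ0 : 0 < δ := by rw [hδ]; linarith
  obtain ⟨ρ1, s0, c, η1, hρ1, hs0, hrs, hc, hη1, hQ⟩ := univ_Q hf.1 hf.2
    (show 0 ≤ ρ + δ by linarith) (show ρ + δ < 1 by rw [hδ]; linarith)
  have hQ := hQ f hf.1 (fun z _ => by simpa using hη1.le)
  have hG : DifferentiableOn ℂ (fun y => fderiv ℂ f (Function.invFunOn f (Ball n) y)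
      (Function.invFunOn f (Ball n) y)) (f '' Ball n) :=
    ((scv_fderiv_differentiableOn isOpen_ball hf.1).comp hf.inv_diff
      fun y hy => inv_mem hy).clm_apply hf.inv_diff
  obtain ⟨p, hp, hpa⟩ := (runge_iff hf).1 hR _ hG ρ hρ0 hρ (c * η / 4) (by positivity)
  have hfc : ∀ a < 1, ContinuousOn f (closedBall 0 a) := fun a ha => hf.1.continuousOn.mono (cb_sub ha)
  obtain ⟨M, hM⟩ := (isCompact_closedBall (0 : En n) (ρ + δ)).exists_bound_of_continuousOn
    (hfc _ (by rw [hδ]; linarith))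
  have hM0 : 0 ≤ M := (norm_nonneg _).trans (hM 0 (by simp; linarith))
  obtain ⟨h1, hh1, H⟩ := (gen_poly hn hp).2 (M + 1) (by linarith) (c * η / 4) (by positivity)
  set D := 4 * M / δ ^ 2 + 1 with hD
  have hD0 : 0 < D := by positivity
  refine ⟨min (min h1 δ) (min (s0 / η) (c * η / (2 * D))), by positivity, fun h hh hlt => ?_⟩
  obtain ⟨⟨l1, l2⟩, l3, l4⟩ : (h < h1 ∧ h < δ) ∧ h < s0 / η ∧ h < c * η / (2 * D) := by
    simpa only [lt_min_iff] using hlt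
  rw [lt_div_iff₀ hη] at l3
  rw [lt_div_iff₀ (by positivity)] at l4
  obtain ⟨Θ, hΘ, hΘa⟩ := H h hh l1
  refine ⟨Θ, hΘ, fun w hw => ?_⟩
  have hwB : w ∈ Ball n := cb_sub hρ (by simpa using hw)
  have hsm : ((1 + h : ℝ) : ℂ) • w - w = (h : ℂ) • w := by
    push_cast; rw [add_smul, one_smul]; abel
  have hhn : ∀ v : En n, ‖(h : ℂ) • v‖ = h * ‖v‖ := fun v => by
    rw [norm_smul, Complex.norm_real, Real.norm_of_nonneg hh.le]
  have hd1 : ‖((1 + h : ℝ) : ℂ) • w - w‖ ≤ h := by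
    rw [hsm, hhn]; nlinarith
  have hu : ((1 + h : ℝ) : ℂ) • w ∈ closedBall (0 : En n) (ρ + δ) := by
    rw [mem_closedBall_zero_iff]
    exact norm_le_of_close hw (hd1.trans l2.le)
  have hbs : ball w δ ⊆ closedBall (0 : En n) (ρ + δ) := fun v hv => by
    rw [mem_closedBall_zero_iff]
    rw [mem_ball, dist_eq_norm] at hv
    exact norm_le_of_close hw hv.le
  have htay := scv_taylor2 hδ0 (hf.1.mono (hbs.trans (cb_sub (by rw [hδ]; linarith))))
    (fun z hz => hM z (hbs hz)) (z := ((1 + h : ℝ) : ℂ) • w) (by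
      rw [mem_ball, dist_eq_norm]; linarith)
  have h2 := hpa w (by simpa using hw)
  simp only [hf.inv_unique hwB] at h2
  have h3 := hΘa (f w) ((hM w (by simp; linarith)).trans (by linarith))
  obtain ⟨w', hw', he⟩ := hQ _ hu (η * h) (by positivity) (by linarith) (Θ (f w)) (by
    have e1 : Θ (f w) - f (((1 + h : ℝ) : ℂ) • w) = (Θ (f w) - f w - (h : ℂ) • p (f w)) +
        (h : ℂ) • (p (f w) - fderiv ℂ f w w) -
        (f (((1 + h : ℝ) : ℂ) • w) - f w - fderiv ℂ f w (((1 + h : ℝ) : ℂ) • w - w)) := by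
      rw [hsm, map_smul, smul_sub]; abel
    rw [e1]
    refine (norm_sub_le _ _).trans ?_
    have e2 := norm_add_le (Θ (f w) - f w - (h : ℂ) • p (f w)) ((h : ℂ) • (p (f w) - fderiv ℂ f w w))
    rw [hhn] at e2
    have e3 : 4 * M / δ ^ 2 * ‖((1 + h : ℝ) : ℂ) • w - w‖ ^ 2 ≤ D * h ^ 2 := by
      gcongr; linarith
    have e4 : h * ‖p (f w) - fderiv ℂ f w w‖ ≤ h * (c * η / 4) := by gcongr
    have e5 : D * h ^ 2 ≤ c * η / 2 * h := by nlinarith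
    linarith)
  refine ⟨w', ?_, he.symm, by rwa [mem_closedBall, dist_eq_norm] at hw'⟩
  rw [mem_closedBall, dist_eq_norm] at hw'
  have := norm_le_of_close (mem_closedBall_zero_iff.1 hu) hw'
  exact cb_sub hρ1 (by rw [mem_closedBall_zero_iff]; linarith)

theorem al_start {f : En n → En n} (hf : UnivalentOn n f) : ∃ C > 0, ∃ t1 > 0, ∀ t : ℝ, 0 < t →
    t < t1 → ∃ Θ, IsAut Θ ∧ ∀ z : En n, ‖z‖ ≤ 1 → ∃ w ∈ Ball n, Θ z = f w ∧
      ‖w - (t : ℂ) • z‖ ≤ C * t ^ 2 := by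
  obtain ⟨ρ1, s0, c, η1, hρ1, hs0, hrs, hc, hη1, hQ⟩ := univ_Q hf.1 hf.2
    (show (0 : ℝ) ≤ 1 / 2 by norm_num) (by norm_num)
  have hQ := hQ f hf.1 (fun z _ => by simpa using hη1.le)
  obtain ⟨M, hM⟩ := (isCompact_closedBall (0 : En n) (1 / 2)).exists_bound_of_continuousOn
    (hf.1.continuousOn.mono (cb_sub (by norm_num)))
  have hM0 : 0 ≤ M := (norm_nonneg _).trans (hM 0 (by simp))
  have h0 : (0 : En n) ∈ Ball n := by simp [Ball]
  obtain ⟨e, -, he⟩ := univ_equiv isOpen_ball hf.1 hf.2 h0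
  set C := (16 * M + 1) / c with hC
  have hC0 : 0 < C := by positivity
  refine ⟨C, hC0, min (1 / 4) (s0 / C), by positivity, fun t ht hlt => ?_⟩
  obtain ⟨l1, l2⟩ := lt_min_iff.1 hlt
  rw [lt_div_iff₀ hC0] at l2
  have htc : (t : ℂ) ≠ 0 := by exact_mod_cast ht.ne'
  refine ⟨fun z => f 0 + e ((t : ℂ) • z), ⟨?_, ?_, ?_⟩, fun z hz => ?_⟩
  · have hs : Differentiable ℂ (fun z : En n => (t : ℂ) • z) := by fun_prop
    exact (e.differentiable.comp hs).const_add _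
  · intro z w hzw
    exact smul_right_injective _ htc (e.injective (add_left_cancel hzw))
  · intro y
    refine ⟨(t : ℂ)⁻¹ • e.symm (y - f 0), ?_⟩
    simp [smul_smul, htc]
  · have hn : ‖(t : ℂ) • z‖ ≤ t := by
      rw [norm_smul, Complex.norm_real, Real.norm_of_nonneg ht.le]; nlinarith
    have htay := scv_taylor2 (c := (0 : En n)) (R := 1 / 2) (M := M) (by norm_num)
      (hf.1.mono (ball_subset_closedBall.trans (cb_sub (by norm_num))))
      (fun z hz => hM z (ball_subset_closedBall hz)) (z := (t : ℂ) • z)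
      (by rw [mem_ball_zero_iff]; linarith)
    rw [sub_zero, ← he] at htay
    obtain ⟨w, hw, hew⟩ := hQ ((t : ℂ) • z) (by rw [mem_closedBall_zero_iff]; linarith) (C * t ^ 2)
      (by positivity) (by nlinarith) (f 0 + e ((t : ℂ) • z)) (by
        rw [norm_sub_rev, ← sub_sub]
        refine htay.trans ?_
        have e1 : c * (C * t ^ 2) = (16 * M + 1) * t ^ 2 := by rw [hC]; field_simp
        rw [e1]
        have e2 : ‖(t : ℂ) • z‖ ^ 2 ≤ t ^ 2 := by gcongr
        have e3 : 4 * M / (1 / 2 : ℝ) ^ 2 = 16 * M := by ring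
        rw [e3]
        nlinarith [sq_nonneg t])
    rw [mem_closedBall, dist_eq_norm] at hw
    refine ⟨w, ?_, hew.symm, hw⟩
    have := norm_le_of_close hn hw
    refine cb_sub hρ1 (by rw [mem_closedBall_zero_iff]; nlinarith)

theorem al_approx (hn : 2 ≤ n) {f : En n → En n} (hF : MemF n f) {r ε : ℝ} (hr0 : 0 ≤ r) (hr : r < 1)
    (hε : 0 < ε) : ∃ Φ, MemE n Φ ∧ ∀ z ∈ closedBall (0 : En n) r, ‖Φ z - f z‖ ≤ ε := by
  have hf := hF.1
  set ρ := (1 + r) / 2 with hρd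
  have hρ : ρ < 1 := by rw [hρd]; linarith
  have hrρ : r < ρ := by rw [hρd]; linarith
  have huc := (isCompact_closedBall (0 : En n) ρ).uniformContinuousOn_of_continuous
    (hf.1.continuousOn.mono (cb_sub hρ))
  rw [Metric.uniformContinuousOn_iff] at huc
  obtain ⟨δ, hδ, huc⟩ := huc ε hε
  obtain ⟨C, hC, t1, ht1, hstart⟩ := al_start hf
  set e := min (δ / 2) (ρ - r) with he
  have he0 : 0 < e := lt_min (by positivity) (by linarith)
  obtain ⟨t, ht0, htt1, htC, htone⟩ : ∃ t : ℝ, 0 < t ∧ t < t1 ∧ C * t ≤ e / 2 ∧ t < 1 := by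
    refine ⟨min (min (t1 / 2) (e / (2 * C))) (1 / 2), by positivity, ?_, ?_, ?_⟩
    · have : min (min (t1 / 2) (e / (2 * C))) (1 / 2) ≤ t1 / 2 :=
        (min_le_left _ _).trans (min_le_left _ _)
      linarith
    · have : min (min (t1 / 2) (e / (2 * C))) (1 / 2) ≤ e / (2 * C) :=
        (min_le_left _ _).trans (min_le_right _ _)
      calc _ ≤ C * (e / (2 * C)) := by gcongr
        _ = e / 2 := by field_simp
    · have : min (min (t1 / 2) (e / (2 * C))) (1 / 2) ≤ 1 / 2 := min_le_right _ _
      linarith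
  obtain ⟨Θ0, hΘ0, hΘ0a⟩ := hstart t ht0 htt1
  obtain ⟨h0, hh0, hstep⟩ := al_step hn hF (by linarith) hρ (show 0 < t * e / 2 by positivity)
  set a := Real.log (1 / t) with ha
  have ha0 : 0 < a := Real.log_pos (by rw [lt_div_iff₀ ht0]; linarith)
  have hlim : Tendsto (fun N : ℕ => Real.exp (a / N) - 1) atTop (nhds 0) := by
    have := ((Real.continuous_exp.tendsto 0).comp (tendsto_const_div_atTop_nhds_zero_nat a)).sub_const 1
    simpa using this
  obtain ⟨N, hN, hN1⟩ := ((hlim.eventually (gt_mem_nhds hh0)).and (eventually_ge_atTop 1)).exists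
  set h := Real.exp (a / N) - 1 with hh
  have hNp : (0 : ℝ) < N := by exact_mod_cast hN1
  have hhp : 0 < h := by
    rw [hh, sub_pos]; exact Real.one_lt_exp_iff.2 (by positivity)
  have hpow : (1 + h) ^ N = 1 / t := by
    rw [show 1 + h = Real.exp (a / N) by rw [hh]; ring, ← Real.exp_nat_mul, mul_div_cancel₀ _ hNp.ne',
      ha, Real.exp_log (by positivity)]
  obtain ⟨Θ, hΘ, hΘa⟩ := hstep h hhp hN
  have hiter : ∀ k ≤ N, ∃ Φ, IsAut Φ ∧ ∀ z ∈ closedBall (0 : En n) r, ∃ w ∈ Ball n, Φ z = f w ∧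
      ‖w - (((1 + h) ^ k * t : ℝ) : ℂ) • z‖ ≤ (1 + h) ^ k * (C * t ^ 2 + t * e / 2) - t * e / 2 := by
    intro k
    induction k with
    | zero =>
      intro _
      refine ⟨Θ0, hΘ0, fun z hz => ?_⟩
      obtain ⟨w, hw, h1, h2⟩ := hΘ0a z (by rw [mem_closedBall_zero_iff] at hz; linarith)
      exact ⟨w, hw, h1, by simpa using h2⟩
    | succ k ih =>
      intro hk
      obtain ⟨Φ, hΦ, hΦa⟩ := ih (by omega)
      refine ⟨_, hΘ.comp hΦ, fun z hz => ?_⟩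
      obtain ⟨w, hw, h1, h2⟩ := hΦa z hz
      rw [mem_closedBall_zero_iff] at hz
      have hpk : (1 + h) ^ k ≤ 1 / t := by
        rw [← hpow]; exact pow_le_pow_right₀ (by linarith) (by omega)
      have hpk0 : 0 < (1 + h) ^ k := by positivity
      have hpt : (1 + h) ^ k * t ≤ 1 := by rwa [le_div_iff₀ ht0] at hpk
      have hb : (1 + h) ^ k * (C * t ^ 2 + t * e / 2) ≤ e := by
        have : (1 + h) ^ k * (C * t ^ 2 + t * e / 2) = ((1 + h) ^ k * t) * (C * t + e / 2) := by ring
        rw [this]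
        have : 0 ≤ C * t + e / 2 := by positivity
        nlinarith
      have hzn : ‖(((1 + h) ^ k * t : ℝ) : ℂ) • z‖ ≤ r := by
        rw [norm_smul, Complex.norm_real, Real.norm_of_nonneg (by positivity)]
        nlinarith [norm_nonneg z]
      have hwρ : ‖w‖ ≤ ρ := by
        have := norm_le_of_close hzn h2
        have h4 : e ≤ ρ - r := min_le_right _ _
        have : 0 < t * e / 2 := by positivity
        linarith
      obtain ⟨w', hw', h3, h4⟩ := hΘa w hwρ
      refine ⟨w', hw', by rw [h1, h3], ?_⟩
      have e1 : w' - (((1 + h) ^ (k + 1) * t : ℝ) : ℂ) • z = (w' - ((1 + h : ℝ) : ℂ) • w) +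
          ((1 + h : ℝ) : ℂ) • (w - (((1 + h) ^ k * t : ℝ) : ℂ) • z) := by
        rw [smul_sub, smul_smul, ← Complex.ofReal_mul, pow_succ]
        rw [show (1 + h) ^ k * (1 + h) * t = (1 + h) * ((1 + h) ^ k * t) by ring]
        abel
      rw [e1]
      refine (norm_add_le _ _).trans ?_
      rw [norm_smul, Complex.norm_real, Real.norm_of_nonneg (by positivity)]
      calc _ ≤ t * e / 2 * h + (1 + h) * ((1 + h) ^ k * (C * t ^ 2 + t * e / 2) - t * e / 2) := by
            gcongr
        _ = _ := by ring
  obtain ⟨Φ, hΦ, hΦa⟩ := hiter N le_rfl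
  refine ⟨Φ, hΦ.memE, fun z hz => ?_⟩
  obtain ⟨w, hw, h1, h2⟩ := hΦa z hz
  rw [mem_closedBall_zero_iff] at hz
  rw [hpow] at h2
  have e1 : 1 / t * t = 1 := by field_simp
  rw [e1, Complex.ofReal_one, one_smul] at h2
  have e2 : 1 / t * (C * t ^ 2 + t * e / 2) = C * t + e / 2 := by field_simp
  rw [e2] at h2
  have e3 : 0 < t * e / 2 := by positivity
  have h3 : ‖w - z‖ ≤ e := by linarith
  have hwρ : ‖w‖ ≤ ρ := by
    have := norm_le_of_close hz h3
    have h4 : e ≤ ρ - r := min_le_right _ _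
    linarith
  rw [h1, ← dist_eq_norm]
  refine (huc w (by simpa using hwρ) z (by simp; linarith) ?_).le
  rw [dist_eq_norm]
  have h4 : e ≤ δ / 2 := min_le_left _ _
  linarith
end AL
end

noncomputable section

theorem montel {ι : Type*} (U : Ultrafilter ι) {h : ι → ℂ → ℂ} {W : Set ℂ} (hW : IsOpen W)
    (hd : ∀ k, DifferentiableOn ℂ (h k) W) {M : ℝ} (hM : ∀ k, ∀ z ∈ W, ‖h k z‖ ≤ M) :
    ∃ g : ℂ → ℂ, TendstoLocallyUniformlyOn h g (U : Filter ι) W := by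
  have hp : ∀ z, ∃ g : ℂ, z ∈ W → Tendsto (fun k => h k z) (U : Filter ι) (nhds g) := by
    intro z
    by_cases hz : z ∈ W
    · obtain ⟨g, -, hg⟩ := (isCompact_closedBall (0 : ℂ) M).ultrafilter_le_nhds
        (U.map (fun k => h k z)) (by
          rw [le_principal_iff]
          exact Filter.mem_map.2 (Filter.Eventually.of_forall
            (fun k => mem_closedBall_zero_iff.2 (hM k z hz))))
      exact ⟨g, fun _ => hg⟩
    · exact ⟨0, fun h => absurd h hz⟩
  choose g hg using hp
  refine ⟨g, ?_⟩
  rw [Metric.tendstoLocallyUniformlyOn_iff]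
  intro ε hε x hx
  obtain ⟨R, hR, hRW⟩ := Metric.isOpen_iff.1 hW x hx
  have hLip : ∀ k, ∀ y ∈ ball x R, dist (h k y) (h k x) ≤ (2 * (|M| + 1)) / R * dist y x := by
    intro k y hy
    refine Complex.dist_le_div_mul_dist_of_mapsTo_ball ((hd k).mono hRW) ?_ hy
    intro w hw
    rw [mem_closedBall, dist_eq_norm]
    have h1 := hM k w (hRW hw)
    have h2 := hM k x hx
    have h3 := norm_sub_le (h k w) (h k x)
    have h4 := le_abs_self M
    linarith
  set L := (2 * (|M| + 1)) / R with hL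
  have hL0 : 0 < L := by rw [hL]; positivity
  set δ := min R (ε / (4 * L)) with hδ
  have hδ0 : 0 < δ := by rw [hδ]; positivity
  have hLδ : ∀ y ∈ ball x δ, ∀ k, dist (h k y) (h k x) ≤ ε / 4 := by
    intro y hy k
    have hy1 : dist y x < δ := hy
    refine (hLip k y (hy1.trans_le (min_le_left _ _))).trans ?_
    have : dist y x ≤ ε / (4 * L) := hy1.le.trans (min_le_right _ _)
    calc L * dist y x ≤ L * (ε / (4 * L)) := by gcongr
      _ = ε / 4 := by field_simp
  refine ⟨ball x δ, mem_nhdsWithin_of_mem_nhds (ball_mem_nhds _ hδ0), ?_⟩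
  have h1 : ∀ᶠ k in (U : Filter ι), dist (h k x) (g x) < ε / 4 :=
    (hg x hx).eventually (ball_mem_nhds _ (by positivity))
  filter_upwards [h1] with k hk y hy
  have hyW : y ∈ W := hRW (ball_subset_ball (min_le_left _ _) hy)
  have h2 : dist (g y) (g x) ≤ ε / 4 :=
    le_of_tendsto ((hg y hyW).dist (hg x hx)) (Eventually.of_forall (hLδ y hy))
  have h3 := hLδ y hy k
  have h4 := dist_triangle4 (g y) (g x) (h k x) (h k y)
  rw [dist_comm (g x), dist_comm (h k x) (h k y)] at h4
  linarith

theorem hurwitz_inj {ι : Type*} {l : Filter ι} [l.NeBot] {h : ι → ℂ → ℂ} {g : ℂ → ℂ} {W : Set ℂ}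
    (hW : IsOpen W) (hc : IsPreconnected W)
    (hd : ∀ k, DifferentiableOn ℂ (h k) W) (hi : ∀ k, InjOn (h k) W)
    (hg : TendstoLocallyUniformlyOn h g l W) {p : ℂ} (hp : p ∈ W) (hg0 : deriv g p ≠ 0) :
    InjOn g W := by
  have hgd : DifferentiableOn ℂ g W := hg.differentiableOn (Eventually.of_forall hd) hW
  have hpt : ∀ z ∈ W, Tendsto (fun k => h k z) l (nhds (g z)) := fun z hz =>
    hg.tendsto_at hz
  intro a ha b hb hab
  by_contra hne
  have han : AnalyticOnNhd ℂ g W := hgd.analyticOnNhd hW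
  have hiso : ∀ᶠ z in nhdsWithin a {a}ᶜ, g z ≠ g a := by
    rcases (han a ha).eventually_eq_or_eventually_ne (analyticAt_const (v := g a)) with h1 | h1
    · exfalso
      have := han.eqOn_of_preconnected_of_eventuallyEq (analyticOnNhd_const (v := g a)) hc ha h1
      have h2 : g =ᶠ[nhds p] fun _ => g a := this.eventuallyEq_of_mem (hW.mem_nhds hp)
      rw [h2.deriv_eq] at hg0
      simp at hg0
    · exact h1
  rw [eventually_nhdsWithin_iff, Metric.eventually_nhds_iff_ball] at hiso
  obtain ⟨R1, hR1, hR1'⟩ := hiso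
  obtain ⟨R2, hR2, hR2W⟩ := Metric.isOpen_iff.1 hW a ha
  have hab0 : 0 < dist a b := dist_pos.2 hne
  set R := min (min R1 R2) (dist a b) / 2 with hR
  have hR0 : 0 < R := by rw [hR]; positivity
  have e1 := min_le_left (min R1 R2) (dist a b)
  have e2 := min_le_right (min R1 R2) (dist a b)
  have e3 := min_le_left R1 R2
  have e4 := min_le_right R1 R2
  have hRR1 : R < R1 := by linarith
  have hRR2 : R < R2 := by linarith
  have hRab : R < dist a b := by linarith
  have hcW : closedBall a R ⊆ W := (closedBall_subset_ball hRR2).trans hR2W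
  have hsW : sphere a R ⊆ W := sphere_subset_closedBall.trans hcW
  have hpos : ∀ z ∈ sphere a R, 0 < ‖g z - g a‖ := by
    intro z hz
    rw [norm_pos_iff, sub_ne_zero]
    refine hR1' z ?_ ?_
    · rw [mem_ball]; rw [mem_sphere] at hz; linarith
    · rintro rfl
      simp at hz; linarith
  obtain ⟨m, hm0, hm⟩ := (isCompact_sphere a R).exists_forall_le' (a := 0)
    ((hgd.continuousOn.mono hsW).sub continuousOn_const).norm hpos
  have hu : ∀ᶠ k in l, ∀ z ∈ sphere a R, dist (g z) (h k z) < m / 4 := by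
    have := (tendstoLocallyUniformlyOn_iff_forall_isCompact hW).1 hg (sphere a R) hsW
      (isCompact_sphere a R)
    exact Metric.tendstoUniformlyOn_iff.1 this (m / 4) (by positivity)
  have hu1 : ∀ᶠ k in l, dist (h k a) (g a) < m / 4 :=
    (hpt a ha).eventually (ball_mem_nhds _ (by positivity))
  have hu2 : ∀ᶠ k in l, dist (h k b) (g b) < m / 4 :=
    (hpt b hb).eventually (ball_mem_nhds _ (by positivity))
  obtain ⟨k, hk, hk1, hk2⟩ := (hu.and (hu1.and hu2)).exists
  rw [← hab] at hk2
  have H := persist_zero (g := fun z => h k z - h k b) (c := a) (m := m / 2) hR0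
    (((hd k).mono hcW).sub_const _) ?_ ?_
  · obtain ⟨z, hz, hz0⟩ := H
    have hzb : z = b := hi k (hcW (ball_subset_closedBall hz)) hb (sub_eq_zero.1 hz0)
    rw [hzb, mem_ball, dist_comm] at hz
    linarith
  · intro z hz
    have h1 : m ≤ ‖g z - g a‖ := hm z hz
    have h2 := hk z hz
    rw [← dist_eq_norm] at h1 ⊢
    have h3 := dist_triangle4 (g z) (h k z) (h k b) (g a)
    linarith
  · rw [← dist_eq_norm]
    have h3 := dist_triangle_right (h k a) (h k b) (g a)
    linarith

/-- quantitative stability in the Schwarz lemma -/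
theorem schwarz_stab {χ : ℂ → ℂ} (hd : DifferentiableOn ℂ χ (ball 0 1))
    (hm : MapsTo χ (ball 0 1) (ball 0 1)) (h0 : χ 0 = 0) {m : ℝ} (hm1 : m ≤ 1)
    (h' : HasDerivAt χ (m : ℂ) 0) {r : ℝ} (hr : r < 1) {z : ℂ} (hz : ‖z‖ ≤ r) :
    ‖χ z - z‖ ≤ 3 / (1 - r) * (1 - m) := by
  have hr' : 0 < 1 - r := by linarith
  have hzb : z ∈ ball (0 : ℂ) 1 := by rw [mem_ball_zero_iff]; linarith
  set p := dslope χ 0 with hp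
  have hp0 : p 0 = m := by rw [hp, dslope_same, h'.deriv]
  have hpd : DifferentiableOn ℂ p (ball 0 1) :=
    (Complex.differentiableOn_dslope (isOpen_ball.mem_nhds (by simp))).2 hd
  have hp1 : ∀ w ∈ ball (0 : ℂ) 1, ‖p w‖ ≤ 1 := by
    intro w hw
    have := Complex.norm_dslope_le_div_of_mapsTo_ball (R₂ := 1) hd
      (by rw [h0]; exact hm.mono_right ball_subset_closedBall) hw
    simpa using this
  have key : ∀ ε > 0, ‖p z - m‖ ≤ 2 * (1 - m + ε) * ‖z‖ / (1 - ‖z‖) := by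
    intro ε hε
    refine Complex.borelCaratheodory_zero (f := fun w => p w - m) (by linarith)
      (hpd.sub_const _) ?_ one_pos hzb (by simp [hp0])
    intro w hw
    have h1 := (Complex.re_le_norm (p w)).trans (hp1 w hw)
    simp only [mem_ofPred_eq, Complex.sub_re, Complex.ofReal_re]
    linarith
  have hz1 : 0 < 1 - ‖z‖ := by linarith
  have key2 : ‖p z - m‖ ≤ 2 * (1 - m) * ‖z‖ / (1 - ‖z‖) := by
    have ht : Tendsto (fun ε : ℝ => 2 * (1 - m + ε) * ‖z‖ / (1 - ‖z‖)) (nhdsWithin 0 (Ioi 0))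
        (nhds (2 * (1 - m + 0) * ‖z‖ / (1 - ‖z‖))) := by
      refine Tendsto.mono_left (Continuous.tendsto (by fun_prop) 0) nhdsWithin_le_nhds
    rw [add_zero] at ht
    exact ge_of_tendsto ht (eventually_nhdsWithin_of_forall key)
  have hχ : χ z - z = z * (p z - 1) := by
    have := sub_smul_dslope χ 0 z
    rw [h0, sub_zero, sub_zero, smul_eq_mul] at this
    rw [← this]; ring
  have hm0 : 0 ≤ 1 - m := by linarith
  have h3 : ‖p z - 1‖ ≤ 2 * (1 - m) * ‖z‖ / (1 - ‖z‖) + (1 - m) := by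
    have e : p z - 1 = (p z - m) + ((m - 1 : ℝ) : ℂ) := by push_cast; ring
    rw [e]
    refine (norm_add_le _ _).trans (add_le_add key2 ?_)
    rw [Complex.norm_real, Real.norm_eq_abs, abs_of_nonpos (by linarith)]; linarith
  rw [hχ, norm_mul]
  have h4 : 2 * (1 - m) * ‖z‖ / (1 - ‖z‖) ≤ 2 / (1 - r) * (1 - m) := by
    rw [div_mul_eq_mul_div, div_le_div_iff₀ hz1 hr']
    have : ‖z‖ * (1 - r) ≤ 1 - ‖z‖ := by nlinarith [norm_nonneg z]
    nlinarith [norm_nonneg z]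
  have h5 : 1 - m ≤ 1 / (1 - r) * (1 - m) := by
    have : 1 ≤ 1 / (1 - r) := by rw [le_div_iff₀ hr']; linarith [norm_nonneg z]
    nlinarith
  have h6 : ‖z‖ * ‖p z - 1‖ ≤ ‖p z - 1‖ := by nlinarith [norm_nonneg (p z - 1)]
  calc _ ≤ _ := h6
    _ ≤ _ := h3
    _ ≤ 2 / (1 - r) * (1 - m) + 1 / (1 - r) * (1 - m) := add_le_add h4 h5
    _ = _ := by ring
end

noncomputable section

/-- `W` is homeomorphic to the plane. -/
def PlaneLike (W : Set ℂ) : Prop := ∃ k h : ℂ → ℂ, Continuous k ∧ (∀ w, k w ∈ W) ∧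
  ContinuousOn h W ∧ ∀ w ∈ W, k (h w) = w

theorem PlaneLike.preconnected {W : Set ℂ} (hW : PlaneLike W) : IsPreconnected W := by
  obtain ⟨k, h, hk, hkW, -, hkh⟩ := hW
  have : W = range k := by
    ext w
    constructor
    · intro hw; exact ⟨h w, hkh w hw⟩
    · rintro ⟨w, rfl⟩; exact hkW w
  rw [this]
  exact isPreconnected_range hk

theorem sqrt_diff {W : Set ℂ} (hW : IsOpen W) {g q : ℂ → ℂ} (hg : DifferentiableOn ℂ g W)
    (hg0 : ∀ z ∈ W, g z ≠ 0) (hq : ContinuousOn q W) (hqg : ∀ z ∈ W, q z ^ 2 = g z) {a : ℂ}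
    (ha : a ∈ W) : HasDerivAt q (deriv g a / (2 * q a)) a := by
  have hqa : q a ≠ 0 := by
    intro h
    apply hg0 a ha
    rw [← hqg a ha, h]; simp
  have hWn := hW.mem_nhds ha
  have hqc : Tendsto q (nhdsWithin a {a}ᶜ) (nhds (q a)) :=
    ((hq.continuousAt hWn).tendsto).mono_left nhdsWithin_le_nhds
  have hsum : Tendsto (fun z => q z + q a) (nhdsWithin a {a}ᶜ) (nhds (2 * q a)) := by
    have := hqc.add_const (q a)
    rwa [← two_mul] at this
  have h2 : (2 * q a) ≠ 0 := by simpa using hqa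
  have hgs := hasDerivAt_iff_tendsto_slope.1 (hg.differentiableAt hWn).hasDerivAt
  rw [hasDerivAt_iff_tendsto_slope]
  refine (hgs.div hsum h2).congr' ?_
  have e1 : ∀ᶠ z in nhdsWithin a {a}ᶜ, q z + q a ≠ 0 := hsum.eventually_ne h2
  have e2 : ∀ᶠ z in nhdsWithin a {a}ᶜ, z ∈ W := mem_nhdsWithin_of_mem_nhds hWn
  filter_upwards [e1, e2] with z hz hzW
  change slope g a z / (q z + q a) = slope q a z
  simp only [slope_def_field]
  rw [← hqg z hzW, ← hqg a ha]
  by_cases hza : z - a = 0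
  · simp [hza]
  field_simp
  ring

theorem PlaneLike.sqrt {W : Set ℂ} (hW : PlaneLike W) (hWo : IsOpen W) {g : ℂ → ℂ}
    (hg : DifferentiableOn ℂ g W) (hg0 : ∀ z ∈ W, g z ≠ 0) :
    ∃ q : ℂ → ℂ, (∀ z ∈ W, q z ^ 2 = g z) ∧ DifferentiableOn ℂ q W ∧
      ∀ z ∈ W, HasDerivAt q (deriv g z / (2 * q z)) z := by
  obtain ⟨k, h, hk, hkW, hh, hkh⟩ := hW
  have hsc : IsSimplyConnected (univ : Set ℂ) := by
    have : ContractibleSpace (univ : Set ℂ) :=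
      (Homeomorph.Set.univ ℂ).contractibleSpace
    exact (inferInstance : SimplyConnectedSpace (univ : Set ℂ))
  obtain ⟨f, hf, hf2⟩ := Complex.exists_continuousOn_pow_eq hsc isOpen_univ (g := fun w => g (k w))
    ((hg.continuousOn.comp hk.continuousOn (fun w _ => hkW w)))
    (by rintro ⟨w, -, hw⟩; exact hg0 _ (hkW w) hw) two_ne_zero
  have hfc : Continuous f := continuousOn_univ.1 hf
  have hq1 : ∀ z ∈ W, (fun z => f (h z)) z ^ 2 = g z := by
    intro z hz
    simp only [hf2, hkh z hz]
  have hd : ∀ z ∈ W, HasDerivAt (fun z => f (h z)) (deriv g z / (2 * f (h z))) z :=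
    fun z hz => sqrt_diff hWo hg hg0 (hfc.comp_continuousOn hh) hq1 hz
  exact ⟨fun z => f (h z), hq1, fun z hz => (hd z hz).differentiableAt.differentiableWithinAt, hd⟩

/-- disc automorphism -/
def mob (c z : ℂ) : ℂ := (z - c) / (1 - (starRingEnd ℂ) c * z)

theorem mob_den {c z : ℂ} (hc : ‖c‖ < 1) (hz : ‖z‖ < 1) : 1 - (starRingEnd ℂ) c * z ≠ 0 := by
  intro h
  have h1 : (starRingEnd ℂ) c * z = 1 := (sub_eq_zero.1 h).symm
  have h2 : ‖(starRingEnd ℂ) c * z‖ = 1 := by rw [h1]; simp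
  rw [norm_mul, RCLike.norm_conj] at h2
  nlinarith [norm_nonneg c, norm_nonneg z]

theorem mob_lt {c z : ℂ} (hc : ‖c‖ < 1) (hz : ‖z‖ < 1) : ‖mob c z‖ < 1 := by
  have hd := mob_den hc hz
  rw [mob, norm_div, div_lt_one (norm_pos_iff.2 hd)]
  have e : Complex.normSq (1 - (starRingEnd ℂ) c * z) - Complex.normSq (z - c) =
      (1 - Complex.normSq c) * (1 - Complex.normSq z) := by
    simp [Complex.normSq_apply]; ring
  rw [Complex.normSq_eq_norm_sq, Complex.normSq_eq_norm_sq, Complex.normSq_eq_norm_sq,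
    Complex.normSq_eq_norm_sq] at e
  have h1 : 0 < (1 - ‖c‖ ^ 2) * (1 - ‖z‖ ^ 2) := by
    apply mul_pos <;> nlinarith [norm_nonneg c, norm_nonneg z]
  exact lt_of_pow_lt_pow_left₀ 2 (norm_nonneg _) (by linarith)

theorem mob_inj {c z w : ℂ} (hc : ‖c‖ < 1) (hz : ‖z‖ < 1) (hw : ‖w‖ < 1) (h : mob c z = mob c w) :
    z = w := by
  have h1 := mob_den hc hz
  have h2 := mob_den hc hw
  have h3 := mob_den hc hc
  rw [mob, mob, div_eq_div_iff h1 h2] at h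
  have h4 : (z - w) * (1 - (starRingEnd ℂ) c * c) = 0 := by linear_combination h
  rcases mul_eq_zero.1 h4 with h5 | h5
  · exact sub_eq_zero.1 h5
  · exact absurd h5 h3

theorem mob_deriv {c z : ℂ} (hc : ‖c‖ < 1) (hz : ‖z‖ < 1) :
    HasDerivAt (mob c) ((1 - (starRingEnd ℂ) c * c) / (1 - (starRingEnd ℂ) c * z) ^ 2) z := by
  have h1 := mob_den hc hz
  have := ((hasDerivAt_id z).sub_const c).div
    (((hasDerivAt_id z).const_mul ((starRingEnd ℂ) c)).const_sub 1) h1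
  refine this.congr_deriv ?_
  simp only [id]
  congr 1
  ring

/-- The extremal family. -/
def RFam (W : Set ℂ) (h : ℂ → ℂ) : Prop := DifferentiableOn ℂ h W ∧ InjOn h W ∧
  MapsTo h W (ball 0 1) ∧ h 0 = 0

theorem koebe_step {W : Set ℂ} (hWo : IsOpen W) (hP : PlaneLike W) (h0 : (0 : ℂ) ∈ W)
    {h : ℂ → ℂ} (hh : RFam W h) {c : ℂ} (hc : c ∈ ball (0 : ℂ) 1) (hcW : c ∉ h '' W) :
    ∃ G, RFam W G ∧ ‖deriv h 0‖ < ‖deriv G 0‖ := by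
  obtain ⟨hd, hi, hm, hz⟩ := hh
  have hc1 : ‖c‖ < 1 := mem_ball_zero_iff.1 hc
  have hm1 : ∀ z ∈ W, ‖h z‖ < 1 := fun z hz => mem_ball_zero_iff.1 (hm hz)
  have hc0 : c ≠ 0 := by
    rintro rfl
    exact hcW ⟨0, h0, hz⟩
  set g : ℂ → ℂ := fun z => mob c (h z) with hg
  have hgD : ∀ z ∈ W, HasDerivAt g ((1 - (starRingEnd ℂ) c * c) /
      (1 - (starRingEnd ℂ) c * h z) ^ 2 * deriv h z) z := by
    intro z hzW
    exact (mob_deriv hc1 (hm1 z hzW)).comp z (hd.differentiableAt (hWo.mem_nhds hzW)).hasDerivAt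
  have hg0 : ∀ z ∈ W, g z ≠ 0 := by
    intro z hzW h1
    simp only [hg, mob, div_eq_zero_iff, mob_den hc1 (hm1 z hzW), or_false] at h1
    exact hcW ⟨z, hzW, sub_eq_zero.1 h1⟩
  obtain ⟨q, hq, hqd, hqD⟩ := hP.sqrt hWo
    (fun z hz => (hgD z hz).differentiableAt.differentiableWithinAt) hg0
  have hq1 : ∀ z ∈ W, ‖q z‖ < 1 := by
    intro z hzW
    have h1 : ‖g z‖ < 1 := mob_lt hc1 (hm1 z hzW)
    rw [← hq z hzW, norm_pow] at h1
    by_contra! h2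
    nlinarith
  set b := q 0 with hb
  have hb1 : ‖b‖ < 1 := hq1 0 h0
  have hb2 : b ^ 2 = - c := by
    rw [hb, hq 0 h0, hg]; simp [mob, hz]
  have hb0 : b ≠ 0 := by
    intro h1
    rw [h1] at hb2
    simp at hb2
    exact hc0 hb2
  refine ⟨fun z => mob b (q z), ⟨?_, ?_, ?_, ?_⟩, ?_⟩
  · intro z hzW
    exact ((mob_deriv hb1 (hq1 z hzW)).comp z (hqD z hzW)).differentiableAt.differentiableWithinAt
  · intro z hzW w hwW hzw
    have h1 : q z = q w := mob_inj hb1 (hq1 z hzW) (hq1 w hwW) hzw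
    have h2 : g z = g w := by rw [← hq z hzW, ← hq w hwW, h1]
    exact hi hzW hwW (mob_inj hc1 (hm1 z hzW) (hm1 w hwW) h2)
  · intro z hzW
    exact mem_ball_zero_iff.2 (mob_lt hb1 (hq1 z hzW))
  · simp [mob, ← hb]
  · have hD := ((mob_deriv hb1 (hq1 0 h0)).comp 0 (hqD 0 h0))
    have hD2 : deriv (fun z => mob b (q z)) 0 = _ := hD.deriv
    rw [hD2, (hgD 0 h0).deriv, hz, ← hb]
    have hdh : deriv h 0 ≠ 0 := osgood_one hWo hd hi h0
    have hbr : 0 < ‖b‖ := norm_pos_iff.2 hb0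
    have hcb : ‖c‖ = ‖b‖ ^ 2 := by rw [← norm_pow, hb2, norm_neg]
    have e1 : ‖(1 - (starRingEnd ℂ) c * c : ℂ)‖ = 1 - ‖b‖ ^ 4 := by
      rw [RCLike.conj_mul]
      have : (1 - (‖c‖ : ℂ) ^ 2) = ((1 - ‖b‖ ^ 4 : ℝ) : ℂ) := by rw [hcb]; push_cast; ring
      erw [this]
      rw [Complex.norm_real, Real.norm_eq_abs, abs_of_pos]
      have : ‖b‖ ^ 4 < 1 := pow_lt_one₀ hbr.le hb1 (by norm_num)
      linarith
    have e2 : (1 - (starRingEnd ℂ) b * b : ℂ) = ((1 - ‖b‖ ^ 2 : ℝ) : ℂ) := by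
      rw [RCLike.conj_mul]; push_cast; rfl
    have hb3 : 0 < 1 - ‖b‖ ^ 2 := by nlinarith
    rw [e2, mul_zero, sub_zero, one_pow, div_one]
    simp only [norm_mul, norm_div, norm_pow, e1, Complex.norm_real, Real.norm_eq_abs,
      abs_of_pos hb3, Complex.norm_ofNat]
    have h5 : 0 < ‖deriv h 0‖ := norm_pos_iff.2 hdh
    have e3 : (1 - ‖b‖ ^ 2) / (1 - ‖b‖ ^ 2) ^ 2 * ((1 - ‖b‖ ^ 4) * ‖deriv h 0‖ / (2 * ‖b‖)) =
        (1 + ‖b‖ ^ 2) / (2 * ‖b‖) * ‖deriv h 0‖ := by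
      field_simp
      ring
    rw [e3]
    have h6 : 1 < (1 + ‖b‖ ^ 2) / (2 * ‖b‖) := by
      rw [lt_div_iff₀ (by positivity)]
      nlinarith
    nlinarith

theorem riemann_ext {W : Set ℂ} (hWo : IsOpen W) (hP : PlaneLike W) (h0 : (0 : ℂ) ∈ W)
    (hb : Bornology.IsBounded W) : ∃ h, RFam W h ∧ h '' W = ball 0 1 := by
  obtain ⟨R, hR0, hR⟩ := hb.subset_ball_lt 0 0
  obtain ⟨s, hs, hsW⟩ := Metric.isOpen_iff.1 hWo 0 h0
  set A : Set ℝ := {x | ∃ h, RFam W h ∧ x = ‖deriv h 0‖} with hA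
  have hRc : (R : ℂ) ≠ 0 := by exact_mod_cast hR0.ne'
  have hne : (1 / R) ∈ A := by
    refine ⟨fun z => z / R, ⟨?_, ?_, ?_, ?_⟩, ?_⟩
    · fun_prop
    · intro z _ w _ hzw
      simpa [hRc] using hzw
    · intro z hz
      have := mem_ball_zero_iff.1 (hR hz)
      rw [mem_ball_zero_iff, norm_div, Complex.norm_real, Real.norm_eq_abs, abs_of_pos hR0,
        div_lt_one hR0]
      exact this
    · simp
    · simp [abs_of_pos hR0]
  have hbd : BddAbove A := by
    refine ⟨1 / s, ?_⟩
    rintro _ ⟨h, ⟨hd, hi, hm, hz⟩, rfl⟩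
    refine Complex.norm_deriv_le_div_of_mapsTo_ball (hd.mono hsW) ?_ hs
    rw [hz]
    exact fun z hz => ball_subset_closedBall (hm (hsW hz))
  obtain ⟨u, -, hu, huA⟩ := exists_seq_tendsto_sSup ⟨_, hne⟩ hbd
  choose h hF hu' using huA
  obtain ⟨g, hg⟩ := montel (hyperfilter ℕ) hWo (fun k => (hF k).1) (M := 1)
    (fun k z hz => (mem_ball_zero_iff.1 ((hF k).2.2.1 hz)).le)
  have hgd : DifferentiableOn ℂ g W :=
    hg.differentiableOn (Eventually.of_forall (fun k => (hF k).1)) hWo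
  have hpt : ∀ z ∈ W, Tendsto (fun k => h k z) (hyperfilter ℕ : Filter ℕ) (nhds (g z)) :=
    fun z hz => hg.tendsto_at hz
  have hder : ‖deriv g 0‖ = sSup A := by
    have h1 := (hg.deriv (Eventually.of_forall (fun k => (hF k).1)) hWo).tendsto_at h0
    have h2 := h1.norm
    have h3 : Tendsto u (hyperfilter ℕ : Filter ℕ) (nhds (sSup A)) :=
      hu.mono_left (by rw [← Nat.cofinite_eq_atTop]; exact hyperfilter_le_cofinite)
    refine tendsto_nhds_unique h2 (h3.congr (fun k => ?_))
    rw [hu' k]; rfl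
  have hpos : 0 < ‖deriv g 0‖ := by
    rw [hder]
    exact lt_of_lt_of_le (by positivity) (le_csSup hbd hne)
  have hgi : InjOn g W := hurwitz_inj hWo hP.preconnected (fun k => (hF k).1)
    (fun k => (hF k).2.1) hg h0 (norm_pos_iff.1 hpos)
  have hg0 : g 0 = 0 := by
    refine tendsto_nhds_unique (hpt 0 h0) ?_
    simp only [(hF _).2.2.2]
    exact tendsto_const_nhds
  have hle : ∀ z ∈ W, ‖g z‖ ≤ 1 := fun z hz =>
    le_of_tendsto (hpt z hz).norm
      (Eventually.of_forall (fun k => (mem_ball_zero_iff.1 ((hF k).2.2.1 hz)).le))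
  have hlt : MapsTo g W (ball 0 1) := by
    intro z hz
    rw [mem_ball_zero_iff]
    refine lt_of_le_of_ne (hle z hz) (fun h1 => ?_)
    have := Complex.eqOn_of_isPreconnected_of_isMaxOn_norm hP.preconnected hWo hgd hz
      (fun w hw => by simpa [h1] using hle w hw)
    have h2 := this h0
    simp only [hg0, Function.const_apply] at h2
    rw [← h2] at h1
    simp at h1
  have hgF : RFam W g := ⟨hgd, hgi, hlt, hg0⟩
  refine ⟨g, hgF, Subset.antisymm hlt.image_subset ?_⟩
  intro c hc
  by_contra hcW
  obtain ⟨G, hG, hGg⟩ := koebe_step hWo hP h0 hgF hc hcW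
  rw [hder] at hGg
  exact absurd (le_csSup hbd ⟨G, hG, rfl⟩) (not_le.2 hGg)

/-- `F` is the normalized Riemann map of `W`, with derivative `a` at the origin. -/
def Riem (W : Set ℂ) (F : ℂ → ℂ) (a : ℝ) : Prop := DifferentiableOn ℂ F (ball 0 1) ∧
  InjOn F (ball 0 1) ∧ F '' ball 0 1 = W ∧ F 0 = 0 ∧ 0 < a ∧ HasDerivAt F (a : ℂ) 0

theorem rotate {F : ℂ → ℂ} (hF : DifferentiableOn ℂ F (ball 0 1)) (hi : InjOn F (ball 0 1)) :
    ∃ l : ℂ, ‖l‖ = 1 ∧ ∃ a : ℝ, 0 < a ∧ HasDerivAt (fun z => F (l * z)) (a : ℂ) 0 := by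
  have h0 : (0 : ℂ) ∈ ball (0 : ℂ) 1 := by simp
  have hd := osgood_one isOpen_ball hF hi h0
  have hp : 0 < ‖deriv F 0‖ := norm_pos_iff.2 hd
  have hpc : (‖deriv F 0‖ : ℂ) ≠ 0 := by exact_mod_cast hp.ne'
  refine ⟨‖deriv F 0‖ / deriv F 0, ?_, ‖deriv F 0‖, hp, ?_⟩
  · rw [norm_div, Complex.norm_real, norm_norm, div_self hp.ne']
  · have h1 : HasDerivAt F (deriv F 0) ((‖deriv F 0‖ : ℂ) / deriv F 0 * 0) := by
      rw [mul_zero]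
      exact (hF.differentiableAt (isOpen_ball.mem_nhds h0)).hasDerivAt
    have h2 := h1.comp (0 : ℂ) ((hasDerivAt_id (0 : ℂ)).const_mul ((‖deriv F 0‖ : ℂ) / deriv F 0))
    refine h2.congr_deriv ?_
    field_simp

theorem rot_mem {l z : ℂ} (hl : ‖l‖ = 1) : l * z ∈ ball (0 : ℂ) 1 ↔ z ∈ ball (0 : ℂ) 1 := by
  simp [hl]

theorem rot_image {l : ℂ} (hl : ‖l‖ = 1) (F : ℂ → ℂ) :
    (fun z => F (l * z)) '' ball 0 1 = F '' ball 0 1 := by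
  have hl0 : l ≠ 0 := by rintro rfl; simp at hl
  ext w
  constructor
  · rintro ⟨z, hz, rfl⟩; exact ⟨l * z, (rot_mem hl).2 hz, rfl⟩
  · rintro ⟨z, hz, rfl⟩
    refine ⟨l⁻¹ * z, ?_, by simp [hl0]⟩
    rw [← rot_mem hl]; simpa [hl0] using hz

theorem rot_univ {l : ℂ} (hl : ‖l‖ = 1) {F : ℂ → ℂ} (hF : DifferentiableOn ℂ F (ball 0 1))
    (hi : InjOn F (ball 0 1)) : DifferentiableOn ℂ (fun z => F (l * z)) (ball 0 1) ∧
      InjOn (fun z => F (l * z)) (ball 0 1) := by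
  have hl0 : l ≠ 0 := by rintro rfl; simp at hl
  refine ⟨hF.comp (by fun_prop) (fun z hz => (rot_mem hl).2 hz), ?_⟩
  intro z hz w hw h
  have := hi ((rot_mem hl).2 hz) ((rot_mem hl).2 hw) h
  exact mul_left_cancel₀ hl0 this

theorem riemann {W : Set ℂ} (hWo : IsOpen W) (hP : PlaneLike W) (h0 : (0 : ℂ) ∈ W)
    (hb : Bornology.IsBounded W) : ∃ F a, Riem W F a := by
  obtain ⟨h, ⟨hd, hi, hm, hz⟩, him⟩ := riemann_ext hWo hP h0 hb
  set F := Function.invFunOn h W with hF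
  have hFd : DifferentiableOn ℂ F (ball 0 1) := by
    rw [← him]; exact univ_inv_diff hWo hd hi
  have hl : LeftInvOn F h W := hi.leftInvOn_invFunOn
  have hr : RightInvOn F h (ball 0 1) := by
    intro w hw
    rw [← him] at hw
    exact Function.invFunOn_eq hw
  have hFi : InjOn F (ball 0 1) := hr.injOn
  have hFim : F '' ball 0 1 = W := by
    rw [← him, hl.image_image]
  have hF0 : F 0 = 0 := by
    have := hl h0
    rwa [hz] at this
  obtain ⟨l, hl1, a, ha, hda⟩ := rotate hFd hFi
  obtain ⟨r1, r2⟩ := rot_univ hl1 hFd hFi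
  exact ⟨fun z => F (l * z), a, r1, r2, by rw [rot_image hl1, hFim], by simp [hF0], ha, hda⟩
end

noncomputable section

/-- univalent on the disc and fixing the origin -/
def U0 (f : ℂ → ℂ) : Prop := DifferentiableOn ℂ f (ball 0 1) ∧ InjOn f (ball 0 1) ∧ f 0 = 0

/-- inverted exterior of `f (closedBall 0 ρ)` -/
def Exr (f : ℂ → ℂ) (ρ : ℝ) : Set ℂ := {w | ∀ z ∈ closedBall (0 : ℂ) ρ, w * f z ≠ 1}

theorem Exr_zero (f : ℂ → ℂ) (ρ : ℝ) : (0 : ℂ) ∈ Exr f ρ := by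
  intro z _; simp

theorem Exr_anti (f : ℂ → ℂ) {ρ σ : ℝ} (h : ρ ≤ σ) : Exr f σ ⊆ Exr f ρ :=
  fun _ hw z hz => hw z (closedBall_subset_closedBall h hz)

theorem cb1 {r : ℝ} (hr : r < 1) : closedBall (0 : ℂ) r ⊆ ball 0 1 := closedBall_subset_ball hr

theorem U0.cont {f : ℂ → ℂ} (hf : U0 f) {z : ℂ} (hz : z ∈ ball (0 : ℂ) 1) : ContinuousAt f z :=
  (hf.1.differentiableAt (isOpen_ball.mem_nhds hz)).continuousAt

theorem U0.ne {f : ℂ → ℂ} (hf : U0 f) {z : ℂ} (hz : z ∈ ball (0 : ℂ) 1) (h0 : z ≠ 0) : f z ≠ 0 := by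
  intro h
  exact h0 (hf.2.1 hz (by simp) (by rw [h, hf.2.2]))

theorem Exr_open {f : ℂ → ℂ} (hf : U0 f) {ρ : ℝ} (hρ : ρ < 1) : IsOpen (Exr f ρ) := by
  rw [isOpen_iff_mem_nhds]
  intro w hw
  refine IsCompact.eventually_forall_of_forall_eventually (isCompact_closedBall (0 : ℂ) ρ) ?_
  intro z hz
  have hc : ContinuousAt (fun p : ℂ × ℂ => p.1 * f p.2) (w, z) :=
    continuousAt_fst.mul (ContinuousAt.comp' (f := Prod.snd) (g := f)
      (hf.cont (cb1 hρ hz)) continuousAt_snd)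
  exact hc.eventually_ne (hw z hz)

theorem Exr_bdd {f : ℂ → ℂ} (hf : U0 f) {ρ : ℝ} (hρ0 : 0 < ρ) (hρ : ρ < 1) :
    Bornology.IsBounded (Exr f ρ) := by
  have ho : IsOpen (f '' ball 0 ρ) := univ_open isOpen_ball (hf.1.mono (ball_subset_ball hρ.le))
    (hf.2.1.mono (ball_subset_ball hρ.le))
  obtain ⟨δ, hδ, hδ'⟩ := Metric.isOpen_iff.1 ho 0 ⟨0, by simpa using hρ0, hf.2.2⟩
  refine (isBounded_closedBall (x := (0 : ℂ)) (r := 2 / δ)).subset ?_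
  intro w hw
  by_contra h
  rw [mem_closedBall_zero_iff, not_le] at h
  have hw0 : 0 < ‖w‖ := lt_trans (by positivity) h
  have : w⁻¹ ∈ ball (0 : ℂ) δ := by
    rw [mem_ball_zero_iff, norm_inv, inv_lt_comm₀ hw0 hδ]
    refine lt_trans ?_ h
    rw [div_eq_mul_inv]
    nlinarith [inv_pos.2 hδ]
  obtain ⟨z, hz, hzw⟩ := hδ' this
  refine hw z (ball_subset_closedBall hz) ?_
  rw [hzw, mul_inv_cancel₀ (norm_pos_iff.1 hw0)]

open Classical in
/-- transplantation of a map of the punctured disc -/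
def kk (f X : ℂ → ℂ) (w : ℂ) : ℂ :=
  if w ≠ 0 ∧ w⁻¹ ∈ f '' ball 0 1 then (f (X (Function.invFunOn f (ball 0 1) w⁻¹)))⁻¹ else w

theorem kk_spec {f : ℂ → ℂ} (hf : U0 f) (X : ℂ → ℂ) {w z : ℂ} (hz : z ∈ ball (0 : ℂ) 1)
    (h : w * f z = 1) : kk f X w = (f (X z))⁻¹ := by
  have hw : w ≠ 0 := by rintro rfl; simp at h
  have h1 : w⁻¹ = f z := by rw [eq_inv_of_mul_eq_one_left h, inv_inv]
  have h2 : Function.invFunOn f (ball 0 1) (f z) = z := hf.2.1.leftInvOn_invFunOn hz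
  rw [kk, if_pos ⟨hw, by rw [h1]; exact ⟨z, hz, rfl⟩⟩, h1, h2]

theorem kk_spec2 {f : ℂ → ℂ} (X : ℂ → ℂ) {w : ℂ}
    (h : ∀ z ∈ ball (0 : ℂ) 1, w * f z ≠ 1) : kk f X w = w := by
  rw [kk, if_neg]
  rintro ⟨h1, z, hz, h2⟩
  exact h z hz (by rw [h2, mul_inv_cancel₀ h1])

theorem kk_cont {f : ℂ → ℂ} (hf : U0 f) {X : ℂ → ℂ} {σ : ℝ} (hσ : σ < 1)
    (hX : ∀ z, σ ≤ ‖z‖ → X z = z) {w : ℂ}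
    (h : ∀ z ∈ ball (0 : ℂ) 1, w * f z = 1 → ContinuousAt X z ∧ X z ∈ ball (0 : ℂ) 1 ∧ X z ≠ 0) :
    ContinuousAt (kk f X) w := by
  by_cases hc : ∃ z ∈ ball (0 : ℂ) 1, w * f z = 1
  · obtain ⟨z, hz, hzw⟩ := hc
    obtain ⟨h1, h2, h3⟩ := h z hz hzw
    have hw : w ≠ 0 := by rintro rfl; simp at hzw
    have e1 : w⁻¹ = f z := by rw [eq_inv_of_mul_eq_one_left hzw, inv_inv]
    have e2 : Function.invFunOn f (ball 0 1) (f z) = z := hf.2.1.leftInvOn_invFunOn hz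
    have ho : IsOpen (f '' ball 0 1) := univ_open isOpen_ball hf.1 hf.2.1
    have hm : f z ∈ f '' ball 0 1 := ⟨z, hz, rfl⟩
    have hci : ContinuousAt (fun w : ℂ => w⁻¹) w := continuousAt_inv₀ hw
    have hev : ∀ᶠ v in nhds w, kk f X v = (f (X (Function.invFunOn f (ball 0 1) v⁻¹)))⁻¹ := by
      have a1 : ∀ᶠ v in nhds w, v ≠ 0 := eventually_ne_nhds hw
      have a2 : ∀ᶠ v in nhds w, v⁻¹ ∈ f '' ball 0 1 :=
        hci.eventually (ho.mem_nhds (by show w⁻¹ ∈ _; rw [e1]; exact hm))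
      filter_upwards [a1, a2] with v b1 b2
      rw [kk, if_pos ⟨b1, b2⟩]
    refine ContinuousAt.congr_of_eventuallyEq ?_ hev
    have c1 : ContinuousAt (Function.invFunOn f (ball 0 1)) (w⁻¹) := by
      rw [e1]
      exact ((univ_inv_diff isOpen_ball hf.1 hf.2.1).differentiableAt (ho.mem_nhds hm)).continuousAt
    have c2 : ContinuousAt (fun v => Function.invFunOn f (ball 0 1) v⁻¹) w :=
      ContinuousAt.comp' (g := Function.invFunOn f (ball 0 1)) (f := fun w : ℂ => w⁻¹) c1 hci
    have c3 : ContinuousAt (fun v => X (Function.invFunOn f (ball 0 1) v⁻¹)) w :=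
      ContinuousAt.comp' (g := X) (by rw [e1, e2]; exact h1) c2
    have c4 : ContinuousAt (fun v => f (X (Function.invFunOn f (ball 0 1) v⁻¹))) w :=
      ContinuousAt.comp' (g := f) (by rw [e1, e2]; exact hf.cont h2) c3
    refine c4.inv₀ ?_
    rw [e1, e2]
    exact hf.ne h2 h3
  · push Not at hc
    have hw : w ∈ Exr f σ := fun z hz => hc z (cb1 hσ hz)
    have hev : ∀ᶠ v in nhds w, kk f X v = v := by
      filter_upwards [(Exr_open hf hσ).mem_nhds hw] with v hv
      by_cases hv2 : ∃ z ∈ ball (0 : ℂ) 1, v * f z = 1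
      · obtain ⟨z, hz, hzv⟩ := hv2
        have : σ ≤ ‖z‖ := by
          by_contra! h3
          exact hv z (mem_closedBall_zero_iff.2 h3.le) hzv
        rw [kk_spec hf X hz hzv, hX z this]
        exact (eq_inv_of_mul_eq_one_left hzv).symm
      · push Not at hv2
        exact kk_spec2 X hv2
    exact continuousAt_id.congr_of_eventuallyEq hev

/-- radial map -/
def radial (m : ℝ → ℝ) (z : ℂ) : ℂ := ((m ‖z‖ / ‖z‖ : ℝ) : ℂ) * z

theorem radial_cont {m : ℝ → ℝ} (hm : Continuous m) {z : ℂ} (hz : z ≠ 0) :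
    ContinuousAt (radial m) z := by
  have hz' : ‖z‖ ≠ 0 := norm_ne_zero_iff.2 hz
  have h1 : ContinuousAt (fun z : ℂ => m ‖z‖ / ‖z‖) z :=
    (hm.comp continuous_norm).continuousAt.div continuous_norm.continuousAt hz'
  exact (Complex.continuous_ofReal.continuousAt.comp' h1).mul continuousAt_id

theorem radial_norm {m : ℝ → ℝ} {z : ℂ} (hz : z ≠ 0) (h : 0 ≤ m ‖z‖) : ‖radial m z‖ = m ‖z‖ := by
  have hz' : 0 < ‖z‖ := norm_pos_iff.2 hz
  rw [radial, norm_mul, Complex.norm_real, Real.norm_eq_abs, abs_of_nonneg (by positivity)]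
  field_simp

theorem radial_id {m : ℝ → ℝ} {z : ℂ} (h : m ‖z‖ = ‖z‖) : radial m z = z := by
  rcases eq_or_ne z 0 with rfl | hz
  · simp [radial]
  have hz' : ‖z‖ ≠ 0 := norm_ne_zero_iff.2 hz
  rw [radial, h, div_self hz']; simp

theorem radial_comp {m l : ℝ → ℝ} {z : ℂ} (hz : z ≠ 0) (h : 0 < l ‖z‖) (hml : m (l ‖z‖) = ‖z‖) :
    radial m (radial l z) = z := by
  have hz' : ‖z‖ ≠ 0 := norm_ne_zero_iff.2 hz
  rw [radial, radial_norm hz h.le, hml, radial, ← mul_assoc, ← Complex.ofReal_mul]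
  have : ‖z‖ / l ‖z‖ * (l ‖z‖ / ‖z‖) = 1 := by field_simp
  rw [this]; simp

theorem Exr_planeLike {f : ℂ → ℂ} (hf : U0 f) {ρ : ℝ} (hρ0 : 0 < ρ) (hρ : ρ < 1) :
    PlaneLike (Exr f ρ) := by
  set σ := (1 + ρ) / 2 with hσd
  have hσ : σ < 1 := by rw [hσd]; linarith
  have hρσ : 0 < σ - ρ := by rw [hσd]; linarith
  have hσ0 : 0 < σ := by linarith
  set l : ℝ → ℝ := fun x => max x (ρ + x * ((σ - ρ) / σ)) with hl
  set m : ℝ → ℝ := fun y => min y ((y - ρ) * (σ / (σ - ρ))) with hm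
  have ht : 0 < (σ - ρ) / σ := by positivity
  have hlid : ∀ x, σ ≤ x → l x = x := by
    intro x hx
    refine max_eq_left ?_
    rw [← sub_nonneg]
    have : x - (ρ + x * ((σ - ρ) / σ)) = (x - σ) * (ρ / σ) := by field_simp; ring
    rw [this]
    exact mul_nonneg (by linarith) (by positivity)
  have hl1 : ∀ x, 0 < x → x < 1 → ρ < l x ∧ l x < 1 := by
    intro x h0 h1
    refine ⟨lt_max_of_lt_right (by nlinarith [mul_pos h0 ht]), ?_⟩
    rcases le_or_gt σ x with h | h
    · rw [hlid x h]; exact h1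
    · refine max_lt h1 ?_
      have : x * ((σ - ρ) / σ) < σ * ((σ - ρ) / σ) := by gcongr
      have e : σ * ((σ - ρ) / σ) = σ - ρ := by field_simp
      linarith
  have hmid : ∀ x, σ ≤ x → m x = x := by
    intro x hx
    refine min_eq_left ?_
    rw [← sub_nonneg]
    have : (x - ρ) * (σ / (σ - ρ)) - x = (x - σ) * (ρ / (σ - ρ)) := by field_simp; ring
    rw [this]
    exact mul_nonneg (by linarith) (by positivity)
  have hm1 : ∀ x, ρ < x → x < 1 → 0 < m x ∧ m x < 1 := by
    intro x h0 h1
    exact ⟨lt_min (by linarith) (mul_pos (by linarith) (by positivity)),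
      (min_le_left _ _).trans_lt h1⟩
  have hlm : ∀ x, ρ < x → l (m x) = x := by
    intro x h0
    rcases le_or_gt σ x with h | h
    · rw [hmid x h, hlid x h]
    · have e : m x = (x - ρ) * (σ / (σ - ρ)) := by
        refine min_eq_right ?_
        rw [← sub_nonneg]
        have : x - (x - ρ) * (σ / (σ - ρ)) = (σ - x) * (ρ / (σ - ρ)) := by field_simp; ring
        rw [this]
        exact mul_nonneg (by linarith) (by positivity)
      have e2 : ρ + m x * ((σ - ρ) / σ) = x := by rw [e]; field_simp; ring
      have : m x ≤ x := min_le_left _ _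
      simp only [hl]
      rw [e2]
      exact max_eq_right this
  have hlc : Continuous l := by fun_prop
  have hmc : Continuous m := by fun_prop
  have nz : ∀ {w z : ℂ}, w * f z = 1 → z ≠ 0 := by
    rintro w z h rfl
    rw [hf.2.2] at h; simp at h
  have hgt : ∀ {w z : ℂ}, w ∈ Exr f ρ → w * f z = 1 → ρ < ‖z‖ := by
    intro w z hw h
    by_contra! h3
    exact hw z (mem_closedBall_zero_iff.2 h3) h
  refine ⟨kk f (radial l), kk f (radial m), ?_, ?_, ?_, ?_⟩
  · rw [continuous_iff_continuousAt]
    intro w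
    refine kk_cont hf hσ (fun z hz => radial_id (hlid _ hz)) ?_
    intro z hz hzw
    have h0 := nz hzw
    have hb := hl1 ‖z‖ (norm_pos_iff.2 h0) (mem_ball_zero_iff.1 hz)
    have hn := radial_norm (m := l) h0 (by linarith)
    refine ⟨radial_cont hlc h0, ?_, ?_⟩
    · rw [mem_ball_zero_iff, hn]; exact hb.2
    · rw [← norm_pos_iff, hn]; linarith
  · intro w
    by_cases hc : ∃ z ∈ ball (0 : ℂ) 1, w * f z = 1
    · obtain ⟨z, hz, hzw⟩ := hc
      have h0 := nz hzw
      have hb := hl1 ‖z‖ (norm_pos_iff.2 h0) (mem_ball_zero_iff.1 hz)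
      have hn := radial_norm (m := l) h0 (by linarith)
      rw [kk_spec hf _ hz hzw]
      intro u hu hu1
      have hX : radial l z ∈ ball (0 : ℂ) 1 := by rw [mem_ball_zero_iff, hn]; exact hb.2
      have hX0 : f (radial l z) ≠ 0 := hf.ne hX (by rw [← norm_pos_iff, hn]; linarith)
      have h1 : f u = f (radial l z) := by
        field_simp at hu1
        exact hu1
      have h2 := hf.2.1 (cb1 hρ hu) hX h1
      rw [mem_closedBall_zero_iff, h2, hn] at hu
      linarith
    · push Not at hc
      rw [kk_spec2 _ hc]
      exact fun z hz => hc z (cb1 hρ hz)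
  · intro w hw
    refine (kk_cont hf hσ (fun z hz => radial_id (hmid _ hz)) ?_).continuousWithinAt
    intro z hz hzw
    have h0 := nz hzw
    have hb := hm1 ‖z‖ (hgt hw hzw) (mem_ball_zero_iff.1 hz)
    have hn := radial_norm (m := m) h0 (by linarith)
    refine ⟨radial_cont hmc h0, ?_, ?_⟩
    · rw [mem_ball_zero_iff, hn]; exact hb.2
    · rw [← norm_pos_iff, hn]; linarith
  · intro w hw
    by_cases hc : ∃ z ∈ ball (0 : ℂ) 1, w * f z = 1
    · obtain ⟨z, hz, hzw⟩ := hc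
      have h0 := nz hzw
      have hb := hm1 ‖z‖ (hgt hw hzw) (mem_ball_zero_iff.1 hz)
      have hn := radial_norm (m := m) h0 (by linarith)
      have hX : radial m z ∈ ball (0 : ℂ) 1 := by rw [mem_ball_zero_iff, hn]; exact hb.2
      have hX0 : f (radial m z) ≠ 0 := hf.ne hX (by rw [← norm_pos_iff, hn]; linarith)
      rw [kk_spec hf _ hz hzw, kk_spec hf _ hX (inv_mul_cancel₀ hX0),
        radial_comp h0 hb.1 (hlm _ (hgt hw hzw))]
      exact (eq_inv_of_mul_eq_one_left hzw).symm
    · push Not at hc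
      rw [kk_spec2 _ hc, kk_spec2 _ hc]

theorem Exr_riem {f : ℂ → ℂ} (hf : U0 f) {ρ : ℝ} (hρ0 : 0 < ρ) (hρ : ρ < 1) :
    ∃ F a, Riem (Exr f ρ) F a :=
  riemann (Exr_open hf hρ) (Exr_planeLike hf hρ0 hρ) (Exr_zero f ρ) (Exr_bdd hf hρ0 hρ)
end

noncomputable section

theorem Riem.u0 {W : Set ℂ} {F : ℂ → ℂ} {a : ℝ} (h : Riem W F a) : U0 F := ⟨h.1, h.2.1, h.2.2.2.1⟩

theorem subord {F : ℂ → ℂ} (hF : U0 F) {a : ℝ} (ha : 0 < a) (hFa : HasDerivAt F (a : ℂ) 0)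
    {g : ℂ → ℂ} (hg : DifferentiableOn ℂ g (ball 0 1)) (hm : MapsTo g (ball 0 1) (F '' ball 0 1))
    (hg0 : g 0 = 0) {b : ℂ} (hb : HasDerivAt g b 0) :
    ∃ χ : ℂ → ℂ, DifferentiableOn ℂ χ (ball 0 1) ∧ MapsTo χ (ball 0 1) (ball 0 1) ∧ χ 0 = 0 ∧
      (∀ z ∈ ball (0 : ℂ) 1, F (χ z) = g z) ∧ HasDerivAt χ (b / a) 0 ∧ ‖b‖ ≤ a := by
  have h0 : (0 : ℂ) ∈ ball (0 : ℂ) 1 := by simp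
  have hac : (a : ℂ) ≠ 0 := by exact_mod_cast ha.ne'
  set χ : ℂ → ℂ := fun z => Function.invFunOn F (ball 0 1) (g z) with hχ
  have hd : DifferentiableOn ℂ χ (ball 0 1) := (univ_inv_diff isOpen_ball hF.1 hF.2.1).comp hg hm
  have hχm : MapsTo χ (ball 0 1) (ball 0 1) := fun z hz => Function.invFunOn_mem (hm hz)
  have he : ∀ z ∈ ball (0 : ℂ) 1, F (χ z) = g z := fun z hz => Function.invFunOn_eq (hm hz)
  have hχ0 : χ 0 = 0 := by
    have h1 : F (χ 0) = F 0 := by rw [he 0 h0, hg0, hF.2.2]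
    exact hF.2.1 (hχm h0) h0 h1
  have hχd : HasDerivAt χ (deriv χ 0) 0 :=
    (hd.differentiableAt (isOpen_ball.mem_nhds h0)).hasDerivAt
  have hcomp : HasDerivAt g (a * deriv χ 0) 0 := by
    have h1 : HasDerivAt F (a : ℂ) (χ 0) := by rw [hχ0]; exact hFa
    refine (h1.comp 0 hχd).congr_of_eventuallyEq ?_
    filter_upwards [isOpen_ball.mem_nhds h0] with z hz
    exact (he z hz).symm
  have hbe : b = a * deriv χ 0 := hb.unique hcomp
  refine ⟨χ, hd, hχm, hχ0, he, ?_, ?_⟩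
  · rw [hbe, mul_div_cancel_left₀ _ hac]; exact hχd
  · have h1 : ‖deriv χ 0‖ ≤ 1 := Complex.norm_deriv_le_one_of_mapsTo_ball hd
      (by rw [hχ0]; exact hχm.mono_right ball_subset_closedBall) one_pos
    rw [hbe, norm_mul, Complex.norm_real, Real.norm_eq_abs, abs_of_pos ha]
    nlinarith

theorem Exr_compact {ψ : ℂ → ℂ} (hψ : U0 ψ) {r : ℝ} (hr1 : r < 1) {C : Set ℂ}
    (hC : IsCompact C) (hCr : C ⊆ Exr ψ r) : ∃ r', r < r' ∧ r' < 1 ∧ C ⊆ Exr ψ r' := by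
  set r1 := (1 + r) / 2 with hr1d
  have h1 : r < r1 := by rw [hr1d]; linarith
  have h2 : r1 < 1 := by rw [hr1d]; linarith
  set S : Set (ℂ × ℂ) := (closedBall 0 r1 ×ˢ C) ∩ (fun p : ℂ × ℂ => p.2 * ψ p.1) ⁻¹' {1} with hS
  have hcp : IsCompact (closedBall (0 : ℂ) r1 ×ˢ C) := (isCompact_closedBall _ _).prod hC
  have hSc : IsCompact S := by
    refine hcp.of_isClosed_subset (ContinuousOn.preimage_isClosed_of_isClosed ?_ hcp.isClosed
      isClosed_singleton) inter_subset_left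
    refine continuousOn_snd.mul ?_
    exact (hψ.1.continuousOn.mono (cb1 h2)).comp continuousOn_fst (fun p hp => hp.1)
  rcases S.eq_empty_or_nonempty with hE | hE
  · refine ⟨r1, h1, h2, ?_⟩
    intro w hw z hz hwz
    have : (z, w) ∈ S := ⟨⟨hz, hw⟩, hwz⟩
    rw [hE] at this
    exact this
  · obtain ⟨p, hp, hpm⟩ := hSc.exists_isMinOn hE (f := fun p : ℂ × ℂ => ‖p.1‖)
      (by fun_prop)
    have hp1 : r < ‖p.1‖ := by
      by_contra! h
      exact hCr hp.1.2 p.1 (mem_closedBall_zero_iff.2 h) hp.2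
    have hp2 : ‖p.1‖ ≤ r1 := mem_closedBall_zero_iff.1 hp.1.1
    refine ⟨(r + ‖p.1‖) / 2, by linarith, by linarith, ?_⟩
    intro w hw z hz hwz
    rw [mem_closedBall_zero_iff] at hz
    have hz' : (z, w) ∈ S := ⟨⟨mem_closedBall_zero_iff.2 (by linarith), hw⟩, hwz⟩
    have := hpm hz'
    simp only [mem_ofPred_eq] at this
    linarith

section fam
variable {ψ : ℂ → ℂ} {F : ℝ → ℂ → ℂ} {a : ℝ → ℝ}

theorem a_right (hψ : U0 ψ) (hR : ∀ r, 0 < r → r < 1 → Riem (Exr ψ r) (F r) (a r)) {r v : ℝ}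
    (hr0 : 0 < r) (hr1 : r < 1) (hv : v < a r) : ∃ r', r < r' ∧ r' < 1 ∧ v ≤ a r' := by
  have hRr := hR r hr0 hr1
  have ha : 0 < a r := hRr.2.2.2.2.1
  set s := max (v / a r) (1 / 2) with hs
  have hs0 : 0 < s := lt_max_of_lt_right (by norm_num)
  have hs1 : s < 1 := max_lt ((div_lt_one ha).2 hv) (by norm_num)
  have hsv : v ≤ s * a r := by
    have : v / a r ≤ s := le_max_left _ _
    rwa [div_le_iff₀ ha] at this
  obtain ⟨r', h1, h2, h3⟩ := Exr_compact hψ hr1 (C := F r '' closedBall 0 s)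
    ((isCompact_closedBall _ _).image_of_continuousOn
      (hRr.1.continuousOn.mono (cb1 hs1))) (by
        rw [← hRr.2.2.1]
        exact image_mono (cb1 hs1))
  refine ⟨r', h1, h2, ?_⟩
  have hR' := hR r' (hr0.trans h1) h2
  have hmem : ∀ z ∈ ball (0 : ℂ) 1, (s : ℂ) * z ∈ closedBall (0 : ℂ) s := by
    intro z hz
    rw [mem_ball_zero_iff] at hz
    rw [mem_closedBall_zero_iff, norm_mul, Complex.norm_real, Real.norm_eq_abs, abs_of_pos hs0]
    nlinarith
  have H := subord hR'.u0 hR'.2.2.2.2.1 hR'.2.2.2.2.2 (g := fun z => F r (s * z))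
    (b := a r * s) ?_ ?_ ?_ ?_
  · obtain ⟨-, -, -, -, -, -, H⟩ := H
    rw [norm_mul, Complex.norm_real, Complex.norm_real, Real.norm_eq_abs, Real.norm_eq_abs,
      abs_of_pos ha, abs_of_pos hs0] at H
    linarith
  · exact hRr.1.comp (by fun_prop) (fun z hz => cb1 hs1 (hmem z hz))
  · intro z hz
    rw [hR'.2.2.1]
    exact h3 ⟨_, hmem z hz, rfl⟩
  · simp [hRr.2.2.2.1]
  · have e1 : HasDerivAt (F r) (a r : ℂ) ((s : ℂ) * 0) := by rw [mul_zero]; exact hRr.2.2.2.2.2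
    have := e1.comp (0 : ℂ) ((hasDerivAt_id (0 : ℂ)).const_mul (s : ℂ))
    exact this.congr_deriv (by simp)

theorem a_anti (hR : ∀ r, 0 < r → r < 1 → Riem (Exr ψ r) (F r) (a r)) {r r' : ℝ}
    (hr0 : 0 < r) (hrr : r ≤ r') (hr1 : r' < 1) : a r' ≤ a r := by
  have h1 := hR r hr0 (hrr.trans_lt hr1)
  have h2 := hR r' (hr0.trans_le hrr) hr1
  obtain ⟨-, -, -, -, -, -, H⟩ := subord h1.u0 h1.2.2.2.2.1 h1.2.2.2.2.2 h2.1
    (by rw [h1.2.2.1]; intro z hz; exact Exr_anti ψ hrr (by rw [← h2.2.2.1]; exact ⟨z, hz, rfl⟩))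
    h2.2.2.2.1 h2.2.2.2.2.2
  rwa [Complex.norm_real, Real.norm_eq_abs, abs_of_pos h2.2.2.2.2.1] at H

theorem a_left (hψ : U0 ψ) (hR : ∀ r, 0 < r → r < 1 → Riem (Exr ψ r) (F r) (a r)) {r v : ℝ}
    (hr0 : 0 < r) (hr1 : r < 1) (hv : ∀ r', 0 < r' → r' < r → v ≤ a r') : v ≤ a r := by
  have hRr := hR r hr0 hr1
  rcases le_or_gt v 0 with hv0 | hv0
  · exact hv0.trans hRr.2.2.2.2.1.le
  set ρ : ℕ → ℝ := fun k => r * (1 - 1 / ((k : ℝ) + 2)) with hρ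
  have hk2 : ∀ k : ℕ, 0 < 1 / ((k : ℝ) + 2) ∧ 1 / ((k : ℝ) + 2) ≤ 1 / 2 := by
    intro k
    have : (0 : ℝ) ≤ k := Nat.cast_nonneg k
    refine ⟨by positivity, ?_⟩
    exact one_div_le_one_div_of_le (by norm_num) (by linarith)
  have hρ1 : ∀ k, r / 2 ≤ ρ k ∧ ρ k < r := by
    intro k
    have := hk2 k
    constructor <;> simp only [hρ] <;> nlinarith
  have hρt : Tendsto ρ atTop (nhds r) := by
    have h1 : Tendsto (fun k : ℕ => 1 / ((k : ℝ) + 2)) atTop (nhds 0) := by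
      refine Tendsto.const_div_atTop ?_ 1
      exact tendsto_atTop_add_const_right _ _ tendsto_natCast_atTop_atTop
    have := (h1.const_sub 1).const_mul r
    simpa [hρ] using this
  have hRk : ∀ k, Riem (Exr ψ (ρ k)) (F (ρ k)) (a (ρ k)) := fun k =>
    hR _ (by linarith [(hρ1 k).1]) (by linarith [(hρ1 k).2])
  have hmem : ∀ k, ∀ z ∈ ball (0 : ℂ) 1, F (ρ k) z ∈ Exr ψ (ρ k) := by
    intro k z hz
    rw [← (hRk k).2.2.1]; exact ⟨z, hz, rfl⟩
  obtain ⟨M, hM⟩ := (Exr_bdd hψ (half_pos hr0) (by linarith)).exists_norm_le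
  obtain ⟨g, hg⟩ := montel (hyperfilter ℕ) isOpen_ball (h := fun k => F (ρ k))
    (fun k => (hRk k).1) (M := M) (fun k z hz => hM _ (Exr_anti ψ (hρ1 k).1 (hmem k z hz)))
  have hle : (hyperfilter ℕ : Filter ℕ) ≤ atTop := by
    rw [← Nat.cofinite_eq_atTop]; exact hyperfilter_le_cofinite
  have h0 : (0 : ℂ) ∈ ball (0 : ℂ) 1 := by simp
  have hgd : DifferentiableOn ℂ g (ball 0 1) :=
    hg.differentiableOn (Eventually.of_forall (fun k => (hRk k).1)) isOpen_ball
  have hpt : ∀ z ∈ ball (0 : ℂ) 1, Tendsto (fun k => F (ρ k) z) (hyperfilter ℕ : Filter ℕ)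
      (nhds (g z)) := fun z hz => hg.tendsto_at hz
  have hder : v ≤ ‖deriv g 0‖ := by
    have h1 := (hg.deriv (Eventually.of_forall (fun k => (hRk k).1)) isOpen_ball).tendsto_at h0
    refine ge_of_tendsto h1.norm (Eventually.of_forall (fun k => ?_))
    simp only [Function.comp_apply, (hRk k).2.2.2.2.2.deriv, Complex.norm_real, Real.norm_eq_abs]
    exact (hv _ (by linarith [(hρ1 k).1]) (hρ1 k).2).trans (le_abs_self _)
  have hgi : InjOn g (ball 0 1) := hurwitz_inj isOpen_ball (convex_ball _ _).isPreconnected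
    (fun k => (hRk k).1) (fun k => (hRk k).2.1) hg h0 (norm_pos_iff.1 (hv0.trans_le hder))
  have hg0 : g 0 = 0 := by
    refine tendsto_nhds_unique (hpt 0 h0) ?_
    simp only [(hRk _).2.2.2.1]
    exact tendsto_const_nhds
  have hgo : IsOpen (g '' ball 0 1) := univ_open isOpen_ball hgd hgi
  -- interior points
  have key : ∀ z ∈ ball (0 : ℂ) 1, ∀ u, ‖u‖ < r → g z * ψ u ≠ 1 := by
    intro z hz u hu h1
    set ρ1 := (‖u‖ + r) / 2 with hρ1d
    have hb : ball (0 : ℂ) ρ1 ⊆ ball 0 1 := ball_subset_ball (by linarith)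
    have ho : IsOpen (ψ '' ball 0 ρ1) := univ_open isOpen_ball (hψ.1.mono hb) (hψ.2.1.mono hb)
    have hgz : g z ≠ 0 := by intro h; rw [h] at h1; simp at h1
    have e1 : (g z)⁻¹ = ψ u := by rw [eq_inv_of_mul_eq_one_left h1, inv_inv]
    have ht := (hpt z hz).inv₀ hgz
    rw [e1] at ht
    have a1 := ht.eventually (ho.mem_nhds ⟨u, by rw [mem_ball_zero_iff]; linarith, rfl⟩)
    have a2 : ∀ᶠ k in (hyperfilter ℕ : Filter ℕ), ρ1 < ρ k :=
      (hρt.mono_left hle).eventually (lt_mem_nhds (by linarith))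
    have a3 : ∀ᶠ k in (hyperfilter ℕ : Filter ℕ), F (ρ k) z ≠ 0 := (hpt z hz).eventually_ne hgz
    obtain ⟨k, ⟨u', hu', h2⟩, h3, h4⟩ := (a1.and (a2.and a3)).exists
    refine hmem k z hz u' ?_ ?_
    · rw [mem_ball_zero_iff] at hu'
      rw [mem_closedBall_zero_iff]; linarith
    · rw [h2, mul_inv_cancel₀ h4]
  have hmaps : MapsTo g (ball 0 1) (F r '' ball 0 1) := by
    rw [hRr.2.2.1]
    intro z hz u hu h1
    rw [mem_closedBall_zero_iff] at hu
    have hψu : ψ u ≠ 0 := by intro h; rw [h] at h1; simp at h1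
    have hub : u ∈ ball (0 : ℂ) 1 := by rw [mem_ball_zero_iff]; linarith
    have e1 : g z = (ψ u)⁻¹ := eq_inv_of_mul_eq_one_left h1
    have hc : ContinuousAt (fun τ : ℝ => (ψ ((τ : ℂ) * u))⁻¹) 1 := by
      refine ContinuousAt.inv₀ ?_ (by simpa using hψu)
      refine ContinuousAt.comp' (g := ψ) (by simpa using hψ.cont hub) ?_
      fun_prop
    have e2 : (fun τ : ℝ => (ψ ((τ : ℂ) * u))⁻¹) 1 = g z := by simp [e1]
    have ev : ∀ᶠ τ : ℝ in nhds 1, (ψ ((τ : ℂ) * u))⁻¹ ∈ g '' ball 0 1 := by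
      refine hc.eventually (hgo.mem_nhds ?_)
      rw [e2]; exact ⟨z, hz, rfl⟩
    have ev2 : ∀ᶠ τ : ℝ in nhds 1, ψ ((τ : ℂ) * u) ≠ 0 := by
      refine ContinuousAt.eventually_ne ?_ (by simpa using hψu)
      refine ContinuousAt.comp' (g := ψ) (by simpa using hψ.cont hub) ?_
      fun_prop
    have ev3 : ∀ᶠ τ : ℝ in nhds 1, 0 < τ := lt_mem_nhds one_pos
    have ev4 : ∀ᶠ τ : ℝ in nhdsWithin 1 (Iio 1), τ < 1 := self_mem_nhdsWithin
    obtain ⟨τ, ⟨b1, b2, b3⟩, b4⟩ :=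
      (((ev.and (ev2.and ev3)).filter_mono nhdsWithin_le_nhds).and ev4).exists
    obtain ⟨z', hz', hzz⟩ := b1
    refine key z' hz' ((τ : ℂ) * u) ?_ ?_
    · rw [norm_mul, Complex.norm_real, Real.norm_eq_abs, abs_of_pos b3]
      nlinarith [norm_nonneg u]
    · rw [hzz, inv_mul_cancel₀ b2]
  obtain ⟨-, -, -, -, -, -, H⟩ := subord hRr.u0 hRr.2.2.2.2.1 hRr.2.2.2.2.2 hgd hmaps hg0
    (hgd.differentiableAt (isOpen_ball.mem_nhds h0)).hasDerivAt
  exact hder.trans H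

theorem Exr_big (hψ : U0 ψ) (R : ℝ) {r0 : ℝ} (hr0 : 0 < r0) :
    ∃ r, 0 < r ∧ r < r0 ∧ ball (0 : ℂ) R ⊆ Exr ψ r := by
  have hc := hψ.cont (z := 0) (by simp)
  rw [ContinuousAt, hψ.2.2] at hc
  have := hc.eventually (ball_mem_nhds (0 : ℂ) (show 0 < 1 / (|R| + 1) by positivity))
  obtain ⟨δ, hδ, hδ'⟩ := Metric.eventually_nhds_iff_ball.1 this
  have hm : 0 < min δ r0 := lt_min hδ hr0
  refine ⟨min δ r0 / 2, by linarith, by linarith [min_le_right δ r0], ?_⟩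
  intro w hw z hz h
  rw [mem_ball_zero_iff] at hw
  rw [mem_closedBall_zero_iff] at hz
  have h1 := hδ' z (by rw [mem_ball_zero_iff]; linarith [min_le_left δ r0])
  rw [dist_zero_right] at h1
  have h2 : ‖w‖ * ‖ψ z‖ = 1 := by rw [← norm_mul, h]; simp
  have h3 : ‖w‖ < |R| + 1 := by linarith [le_abs_self R]
  have h4 : (|R| + 1) * (1 / (|R| + 1)) = 1 := by field_simp
  nlinarith [norm_nonneg w, norm_nonneg (ψ z), abs_nonneg R]

theorem a_big (hψ : U0 ψ) (hR : ∀ r, 0 < r → r < 1 → Riem (Exr ψ r) (F r) (a r)) (v : ℝ) {r0 : ℝ}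
    (hr0 : 0 < r0) (hr1 : r0 < 1) : ∃ r, 0 < r ∧ r < r0 ∧ v ≤ a r := by
  obtain ⟨r, h1, h2, h3⟩ := Exr_big hψ (|v| + 1) hr0
  refine ⟨r, h1, h2, ?_⟩
  have hRr := hR r h1 (h2.trans hr1)
  set R : ℝ := |v| + 1 with hRd
  have hR0 : 0 < R := by positivity
  have H := subord hRr.u0 hRr.2.2.2.2.1 hRr.2.2.2.2.2 (g := fun z => (R : ℂ) * z) (b := R)
    (by fun_prop) ?_ (by simp) ?_
  · obtain ⟨-, -, -, -, -, -, H⟩ := H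
    rw [Complex.norm_real, Real.norm_eq_abs, abs_of_pos hR0] at H
    linarith [le_abs_self v]
  · rw [hRr.2.2.1]
    intro z hz
    apply h3
    rw [mem_ball_zero_iff] at hz ⊢
    rw [norm_mul, Complex.norm_real, Real.norm_eq_abs, abs_of_pos hR0]
    nlinarith
  · simpa using (hasDerivAt_id (0 : ℂ)).const_mul (R : ℂ)

theorem a_level (hψ : U0 ψ) (hR : ∀ r, 0 < r → r < 1 → Riem (Exr ψ r) (F r) (a r)) {v r0 : ℝ}
    (hr0 : 0 < r0) (hr1 : r0 < 1) (hv : a r0 ≤ v) : ∃ r, 0 < r ∧ r ≤ r0 ∧ a r = v := by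
  set S : Set ℝ := {r | 0 < r ∧ r ≤ r0 ∧ v ≤ a r} with hS
  obtain ⟨r1, h1, h2, h3⟩ := a_big hψ hR v hr0 hr1
  have hne : S.Nonempty := ⟨r1, h1, h2.le, h3⟩
  have hbd : BddAbove S := ⟨r0, fun r hr => hr.2.1⟩
  set s := sSup S with hs
  have hs0 : 0 < s := h1.trans_le (le_csSup hbd ⟨h1, h2.le, h3⟩)
  have hsr : s ≤ r0 := csSup_le hne (fun r hr => hr.2.1)
  have hs1 : s < 1 := hsr.trans_lt hr1
  have hge : v ≤ a s := by
    refine a_left hψ hR hs0 hs1 (fun r' h0 hlt => ?_)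
    obtain ⟨q, hq, hq2⟩ := exists_lt_of_lt_csSup hne hlt
    exact hq.2.2.trans (a_anti hR h0 hq2.le (hq.2.1.trans_lt hr1))
  refine ⟨s, hs0, hsr, le_antisymm ?_ hge⟩
  by_contra! hlt
  obtain ⟨r', g1, g2, g3⟩ := a_right hψ hR hs0 hs1 hlt
  have hsr' : s < r0 := by
    refine lt_of_le_of_ne hsr (fun h => ?_)
    rw [h] at hlt; linarith
  have hmem : min r' r0 ∈ S := ⟨lt_min (hs0.trans g1) hr0, min_le_right _ _,
    g3.trans (a_anti hR (lt_min (hs0.trans g1) hr0) (min_le_left _ _) g2)⟩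
  have := le_csSup hbd hmem
  have h5 : s < min r' r0 := lt_min g1 hsr'
  linarith
end fam
end

noncomputable section

theorem lip1 {g : ℂ → ℂ} {M ρ : ℝ} (hg : DifferentiableOn ℂ g (ball 0 1))
    (hM : ∀ z ∈ ball (0 : ℂ) 1, ‖g z‖ ≤ M) (hρ : ρ < 1) {z w : ℂ} (hz : ‖z‖ ≤ ρ) (hw : ‖w‖ ≤ ρ) :
    ‖g z - g w‖ ≤ 2 * M / (1 - ρ) * ‖z - w‖ := by
  have hp : 0 < (1 - ρ) / 2 := by linarith
  refine Convex.norm_image_sub_le_of_norm_deriv_le (s := closedBall (0 : ℂ) ρ) (𝕜 := ℂ) ?_ ?_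
    (convex_closedBall _ _) (by simpa using hw) (by simpa using hz)
  · intro x hx
    exact hg.differentiableAt (isOpen_ball.mem_nhds (cb1 hρ hx))
  · intro x hx
    have hx' : ‖x‖ ≤ ρ := by simpa using hx
    have hsub : closedBall x ((1 - ρ) / 2) ⊆ ball (0 : ℂ) 1 := by
      intro y hy
      rw [mem_closedBall, dist_eq_norm] at hy
      rw [mem_ball_zero_iff]
      calc ‖y‖ = ‖(y - x) + x‖ := by simp
        _ ≤ ‖y - x‖ + ‖x‖ := norm_add_le _ _
        _ < 1 := by linarith
    have := Complex.norm_deriv_le_of_forall_mem_sphere_norm_le (f := g) (c := x) (C := M) hp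
      (DifferentiableOn.diffContOnCl (hg.mono (closure_ball_subset_closedBall.trans hsub)))
      (fun y hy => hM y (hsub (sphere_subset_closedBall hy)))
    refine this.trans (le_of_eq ?_)
    have : 1 - ρ ≠ 0 := by linarith
    field_simp

theorem schwarz_le {χ : ℂ → ℂ} (hd : DifferentiableOn ℂ χ (ball 0 1))
    (hm : MapsTo χ (ball 0 1) (ball 0 1)) (h0 : χ 0 = 0) {z : ℂ} (hz : z ∈ ball (0 : ℂ) 1) :
    ‖χ z‖ ≤ ‖z‖ := by
  rw [mem_ball_zero_iff] at hz
  exact Complex.norm_le_norm_of_mapsTo_ball hd (fun x hx => ball_subset_closedBall (hm hx)) h0 hz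

/-- comparison of two nested normalized univalent maps -/
theorem nested_est {F G : ℂ → ℂ} {a b M ρ : ℝ} (hF : U0 F) (hG : U0 G) (hb : 0 < b)
    (ha : 0 < a)
    (hFa : HasDerivAt F (a : ℂ) 0) (hGb : HasDerivAt G (b : ℂ) 0)
    (hsub : F '' ball 0 1 ⊆ G '' ball 0 1) (hM : ∀ z ∈ ball (0 : ℂ) 1, ‖G z‖ ≤ M)
    (hρ : ρ < 1) {z : ℂ} (hz : ‖z‖ ≤ ρ) :
    a ≤ b ∧ ‖F z - G z‖ ≤ 2 * M / (1 - ρ) * (3 / (1 - ρ) * (1 - a / b)) := by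
  obtain ⟨χ, c1, c2, c3, c4, c5, c6⟩ := subord hG hb hGb hF.1
    (fun z hz => hsub ⟨z, hz, rfl⟩) hF.2.2 hFa
  rw [Complex.norm_real, Real.norm_eq_abs, abs_of_pos ha] at c6
  refine ⟨c6, ?_⟩
  have hzb : z ∈ ball (0 : ℂ) 1 := by rw [mem_ball_zero_iff]; linarith
  have hM0 : 0 ≤ M := (norm_nonneg _).trans (hM z hzb)
  have c5' : HasDerivAt χ ((a / b : ℝ) : ℂ) 0 := by push_cast; exact c5
  have h1 := schwarz_stab c1 c2 c3 ((div_le_one hb).2 c6) c5' hρ hz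
  rw [← c4 z hzb]
  refine (lip1 hG.1 hM hρ ((schwarz_le c1 c2 c3 hzb).trans hz) hz).trans ?_
  have : 0 < 1 - ρ := by linarith
  gcongr

theorem chain1 {ψ : ℂ → ℂ} (hψ : U0 ψ) {r0 : ℝ} (hr0 : 0 < r0) (hr1 : r0 < 1) :
    ∃ (G : ℝ → ℂ → ℂ) (a0 : ℝ), Riem (Exr ψ r0) (G 0) a0 ∧
      (∀ t, 0 ≤ t → DifferentiableOn ℂ (G t) (ball 0 1) ∧ InjOn (G t) (ball 0 1)) ∧
      (∀ s t, 0 ≤ s → s ≤ t → G s '' ball 0 1 ⊆ G t '' ball 0 1) ∧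
      (∀ w, ∃ t, 0 ≤ t ∧ w ∈ G t '' ball 0 1) ∧
      ∀ ρ, ρ < 1 → ∀ T, 0 < T → ∃ C, 0 ≤ C ∧ ∀ z, ‖z‖ ≤ ρ → ∀ s t, 0 ≤ s → s ≤ t → t ≤ T →
        ‖G s z - G t z‖ ≤ C * (t - s) := by
  have hex : ∀ r, ∃ F a, 0 < r → r < 1 → Riem (Exr ψ r) F a := by
    intro r
    by_cases h : 0 < r ∧ r < 1
    · obtain ⟨F, a, H⟩ := Exr_riem hψ h.1 h.2
      exact ⟨F, a, fun _ _ => H⟩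
    · exact ⟨0, 0, fun h1 h2 => (h ⟨h1, h2⟩).elim⟩
  choose F a hR using hex
  have hlev : ∀ t, ∃ r, 0 ≤ t → (0 < r ∧ r ≤ r0 ∧ a r = a r0 + t) ∧ (t = 0 → r = r0) := by
    intro t
    by_cases h : t = 0
    · exact ⟨r0, fun _ => ⟨⟨hr0, le_rfl, by simp [h]⟩, fun _ => rfl⟩⟩
    · by_cases h' : 0 ≤ t
      · obtain ⟨r, H⟩ := a_level hψ hR hr0 hr1 (v := a r0 + t) (by linarith)
        exact ⟨r, fun _ => ⟨H, fun h'' => (h h'').elim⟩⟩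
      · exact ⟨0, fun h'' => (h' h'').elim⟩
  choose r hr using hlev
  have hrp : ∀ t, 0 ≤ t → 0 < r t := fun t ht => (hr t ht).1.1
  have hr_lt : ∀ t, 0 ≤ t → r t < 1 := fun t ht => (hr t ht).1.2.1.trans_lt hr1
  have hra : ∀ t, 0 ≤ t → a (r t) = a r0 + t := fun t ht => (hr t ht).1.2.2
  have hRt : ∀ t, 0 ≤ t → Riem (Exr ψ (r t)) (F (r t)) (a (r t)) :=
    fun t ht => hR _ (hrp t ht) (hr_lt t ht)
  have ha0 : 0 < a r0 := (hR r0 hr0 hr1).2.2.2.2.1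
  have hmono : ∀ s t, 0 ≤ s → s ≤ t → r t ≤ r s := by
    intro s t hs hst
    rcases hst.eq_or_lt with h | h
    · rw [h]
    by_contra hc
    push Not at hc
    have := a_anti hR (hrp s hs) hc.le (hr_lt t (hs.trans hst))
    rw [hra s hs, hra t (hs.trans hst)] at this
    linarith
  have himg : ∀ s t, 0 ≤ s → s ≤ t → F (r s) '' ball 0 1 ⊆ F (r t) '' ball 0 1 := by
    intro s t hs hst
    rw [(hRt s hs).2.2.1, (hRt t (hs.trans hst)).2.2.1]
    exact Exr_anti ψ (hmono s t hs hst)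
  refine ⟨fun t => F (r t), a r0, ?_, fun t ht => ⟨(hRt t ht).1, (hRt t ht).2.1⟩, himg, ?_, ?_⟩
  · have := hRt 0 le_rfl
    simp only [(hr 0 le_rfl).2 rfl] at this ⊢
    exact this
  · intro w
    obtain ⟨q, q1, q2, q3⟩ := Exr_big hψ (‖w‖ + 1) hr0
    refine ⟨|a q - a r0| + 1, by positivity, ?_⟩
    have ht : 0 ≤ |a q - a r0| + 1 := by positivity
    show w ∈ F (r (|a q - a r0| + 1)) '' ball 0 1
    rw [(hRt _ ht).2.2.1]
    refine Exr_anti ψ ?_ (q3 (by simp))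
    by_contra hc
    push Not at hc
    have := a_anti hR q1 hc.le (hr_lt _ ht)
    rw [hra _ ht] at this
    linarith [le_abs_self (a q - a r0)]
  · intro ρ hρ T hT
    obtain ⟨M, hM⟩ := (Exr_bdd hψ (hrp T hT.le) (hr_lt T hT.le)).exists_norm_le
    have hM0 : 0 ≤ M := (norm_nonneg _).trans (hM 0 (Exr_zero ψ _))
    have hρ' : 0 < 1 - ρ := by linarith
    refine ⟨2 * M / (1 - ρ) * (3 / (1 - ρ) * (1 / a r0)), by positivity, ?_⟩
    intro z hz s t hs hst htT
    have ht := hs.trans hst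
    have H := (nested_est (hRt s hs).u0 (hRt t ht).u0 (hRt t ht).2.2.2.2.1
      (hRt s hs).2.2.2.2.1 (hRt s hs).2.2.2.2.2 (hRt t ht).2.2.2.2.2 (himg s t hs hst) (M := M)
      (fun z hz => hM _ (by
        rw [← (hRt T hT.le).2.2.1]; exact himg t T ht htT ⟨z, hz, rfl⟩)) hρ hz).2
    refine H.trans ?_
    rw [hra s hs, hra t ht, mul_assoc, mul_assoc]
    gcongr
    have h1 : 1 - (a r0 + s) / (a r0 + t) = (t - s) / (a r0 + t) := by
      field_simp
      ring
    rw [h1, one_div_mul_eq_div]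
    gcongr
    · linarith
end

noncomputable section

theorem dil_u0 {f : ℂ → ℂ} (hf : U0 f) {q : ℝ} (hq0 : 0 < q) (hq : q < 1) {A : ℝ}
    (hfA : HasDerivAt f (A : ℂ) 0) :
    U0 (fun z => f ((q : ℂ) * z)) ∧ HasDerivAt (fun z => f ((q : ℂ) * z)) ((q * A : ℝ) : ℂ) 0 ∧
      ∀ z ∈ ball (0 : ℂ) 1, ‖(q : ℂ) * z‖ < q := by
  have hn : ∀ z ∈ ball (0 : ℂ) 1, ‖(q : ℂ) * z‖ < q := by
    intro z hz
    rw [mem_ball_zero_iff] at hz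
    rw [norm_mul, Complex.norm_real, Real.norm_eq_abs, abs_of_pos hq0]
    nlinarith
  have hb : ∀ z ∈ ball (0 : ℂ) 1, (q : ℂ) * z ∈ ball (0 : ℂ) 1 := fun z hz => by
    rw [mem_ball_zero_iff]; exact (hn z hz).trans hq
  have hqc : (q : ℂ) ≠ 0 := by exact_mod_cast hq0.ne'
  refine ⟨⟨hf.1.comp (by fun_prop) hb, ?_, by simp [hf.2.2]⟩, ?_, hn⟩
  · intro z hz w hw h
    exact mul_left_cancel₀ hqc (hf.2.1 (hb z hz) (hb w hw) h)
  · have e1 : HasDerivAt f (A : ℂ) ((q : ℂ) * 0) := by rw [mul_zero]; exact hfA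
    have := e1.comp (0 : ℂ) ((hasDerivAt_id (0 : ℂ)).const_mul (q : ℂ))
    exact this.congr_deriv (by push_cast; ring)

theorem dens1 {f : ℂ → ℂ} (hf : U0 f) {A : ℝ} (hA : 0 < A) (hfA : HasDerivAt f (A : ℂ) 0)
    {r ε : ℝ} (hr0 : 0 ≤ r) (hr : r < 1) (hε : 0 < ε) :
    ∃ (ψ : ℂ → ℂ) (r0 : ℝ), U0 ψ ∧ 0 < r0 ∧ r0 < 1 ∧ ∀ F a, Riem (Exr ψ r0) F a →
      ∀ z, ‖z‖ ≤ r → ‖F z - f z‖ ≤ ε := by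
  have huc : UniformContinuousOn f (closedBall 0 r) :=
    (isCompact_closedBall _ _).uniformContinuousOn_of_continuous (hf.1.continuousOn.mono (cb1 hr))
  obtain ⟨δ, hδ, hδ'⟩ := Metric.uniformContinuousOn_iff.1 huc ε hε
  have hr' : 0 < 1 - r := by linarith
  obtain ⟨η, hη0, hη1, hη⟩ : ∃ η : ℝ, 0 < η ∧ η < 1 ∧ 3 / (1 - r) * η + η < δ := by
    set K := 3 / (1 - r) + 1 with hK
    have hK0 : 0 < K := by positivity
    refine ⟨min (1 / 2) (δ / (2 * K)), by positivity,
      (min_le_left _ _).trans_lt (by norm_num), ?_⟩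
    have h1 : min (1 / 2) (δ / (2 * K)) ≤ δ / (2 * K) := min_le_right _ _
    have h2 : K * (δ / (2 * K)) = δ / 2 := by field_simp
    have h3 : K * min (1 / 2) (δ / (2 * K)) ≤ δ / 2 := by
      rw [← h2]; gcongr
    have h4 : 3 / (1 - r) * min (1 / 2) (δ / (2 * K)) + min (1 / 2) (δ / (2 * K))
      = K * min (1 / 2) (δ / (2 * K)) := by rw [hK]; ring
    rw [h4]; linarith
  set q := 1 - η with hq
  have hq0 : 0 < q := by linarith
  have hq1 : q < 1 := by linarith
  have hqq0 : 0 < q * q := by positivity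
  have hqq : q * q < q := by nlinarith
  have hqq1 : q * q < 1 := by linarith
  obtain ⟨ψ, b, hψ⟩ := Exr_riem hf hqq0 hqq1
  have hψ0 := hψ.u0
  set D : Set ℂ := {w | ∀ z ∈ ball (0 : ℂ) q, w * f z ≠ 1} with hD
  have hDs : D ⊆ Exr f (q * q) := fun w hw z hz => hw z (closedBall_subset_ball hqq hz)
  have hfo : IsOpen (f '' ball 0 q) := univ_open isOpen_ball (hf.1.mono (ball_subset_ball hq1.le))
    (hf.2.1.mono (ball_subset_ball hq1.le))
  have hDc : IsClosed D := by
    rw [← isOpen_compl_iff]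
    have h1 : Dᶜ = {(0 : ℂ)}ᶜ ∩ (fun w : ℂ => w⁻¹) ⁻¹' (f '' ball 0 q) := by
      ext w
      simp only [hD, mem_compl_iff, mem_setOf_eq, not_forall, not_not, mem_inter_iff,
        mem_singleton_iff, mem_preimage, mem_image]
      constructor
      · rintro ⟨z, hz, h⟩
        exact ⟨left_ne_zero_of_mul_eq_one h, z, hz, eq_inv_of_mul_eq_one_right h⟩
      · rintro ⟨h0, z, hz, h⟩
        exact ⟨z, hz, by rw [h]; exact mul_inv_cancel₀ h0⟩
    rw [h1]
    exact ContinuousOn.isOpen_inter_preimage continuousOn_inv₀ isOpen_compl_singleton hfo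
  have hDk : IsCompact D :=
    Metric.isCompact_of_isClosed_isBounded hDc ((Exr_bdd hf hqq0 hqq1).subset hDs)
  have hDi : D ⊆ ψ '' ball 0 1 := by rw [hψ.2.2.1]; exact hDs
  obtain ⟨s, hs1, hs⟩ : ∃ s, s < 1 ∧ ∀ w ∈ D, ∃ u, ‖u‖ ≤ s ∧ ψ u = w := by
    have hcont : ContinuousOn (Function.invFunOn ψ (ball 0 1)) D :=
      (univ_inv_diff isOpen_ball hψ0.1 hψ0.2.1).continuousOn.mono hDi
    have hk := hDk.image_of_continuousOn hcont
    have hsub : Function.invFunOn ψ (ball 0 1) '' D ⊆ ball 0 1 := by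
      rintro _ ⟨w, hw, rfl⟩
      exact Function.invFunOn_mem (hDi hw)
    obtain ⟨s, hs1, hs⟩ : ∃ s, s < 1 ∧ ∀ u ∈ Function.invFunOn ψ (ball 0 1) '' D, ‖u‖ ≤ s := by
      rcases (Function.invFunOn ψ (ball 0 1) '' D).eq_empty_or_nonempty with he | hne
      · exact ⟨0, one_pos, by simp [he]⟩
      · obtain ⟨u, hu, hu'⟩ := hk.exists_isMaxOn hne continuous_norm.continuousOn
        exact ⟨‖u‖, by simpa using hsub hu, fun v hv => hu' hv⟩
    exact ⟨s, hs1, fun w hw => ⟨_, hs _ ⟨w, hw, rfl⟩, Function.invFunOn_eq (hDi hw)⟩⟩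
  refine ⟨ψ, max s (1 / 2), hψ0, lt_max_of_lt_right (by norm_num), max_lt hs1 (by norm_num), ?_⟩
  intro F a hF z hz
  set r0 := max s (1 / 2) with hr0d
  have hr01 : r0 < 1 := max_lt hs1 (by norm_num)
  have hzb : z ∈ ball (0 : ℂ) 1 := by rw [mem_ball_zero_iff]; linarith
  obtain ⟨u1, d1, n1⟩ := dil_u0 hf hq0 hq1 hfA
  obtain ⟨u2, d2, n2⟩ := dil_u0 hf hqq0 hqq1 hfA
  have H1 := subord hF.u0 hF.2.2.2.2.1 hF.2.2.2.2.2 u2.1 ?_ u2.2.2 d2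
  swap
  · intro x hx
    rw [hF.2.2.1]
    intro u hu h
    have h1 : ψ u ∈ Exr f (q * q) := by rw [← hψ.2.2.1]; exact ⟨u, cb1 hr01 hu, rfl⟩
    refine h1 (((q * q : ℝ) : ℂ) * x) ?_ (by rw [mul_comm]; exact h)
    rw [mem_closedBall_zero_iff]; exact (n2 x hx).le
  obtain ⟨-, -, -, -, -, -, H1⟩ := H1
  rw [Complex.norm_real, Real.norm_eq_abs, abs_of_pos (by positivity)] at H1
  have H2 := subord u1 (mul_pos hq0 hA) d1 hF.1 ?_ hF.2.2.2.1 hF.2.2.2.2.2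
  swap
  · intro x hx
    have hx' : F x ∈ Exr ψ r0 := by rw [← hF.2.2.1]; exact ⟨x, hx, rfl⟩
    by_contra hc
    have hnot : F x ∉ f '' ball 0 q := by
      rintro ⟨y, hy, h⟩
      refine hc ⟨(q : ℂ)⁻¹ * y, ?_, ?_⟩
      · rw [mem_ball_zero_iff] at hy ⊢
        rw [norm_mul, norm_inv, Complex.norm_real, Real.norm_eq_abs, abs_of_pos hq0,
          inv_mul_lt_one₀ hq0]
        exact hy
      · have hqc : (q : ℂ) ≠ 0 := by exact_mod_cast hq0.ne'
        simp only [mul_inv_cancel_left₀ hqc]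
        exact h
    have hne : F x ≠ 0 := by
      intro h
      exact hnot ⟨0, by simpa using hq0, by rw [h, hf.2.2]⟩
    have hinD : (F x)⁻¹ ∈ D := by
      intro y hy h
      refine hnot ⟨y, hy, ?_⟩
      have := eq_inv_of_mul_eq_one_right h
      rw [this, inv_inv]
    obtain ⟨u, hu, hu'⟩ := hs _ hinD
    refine hx' u ?_ (by rw [hu']; exact mul_inv_cancel₀ hne)
    rw [mem_closedBall_zero_iff]; exact hu.trans (le_max_left _ _)
  obtain ⟨χ, c1, c2, c3, c4, c5, c6⟩ := H2
  have ha : 0 < a := hF.2.2.2.2.1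
  rw [Complex.norm_real, Real.norm_eq_abs, abs_of_pos ha] at c6
  have c5' : HasDerivAt χ ((a / (q * A) : ℝ) : ℂ) 0 := by push_cast; push_cast at c5; exact c5
  have hqA : 0 < q * A := mul_pos hq0 hA
  have h1 := schwarz_stab c1 c2 c3 ((div_le_one hqA).2 c6) c5' hr hz
  have h2 : 1 - a / (q * A) ≤ η := by
    have : q ≤ a / (q * A) := by rw [le_div_iff₀ hqA]; linarith
    linarith
  have h3 : ‖χ z - z‖ ≤ 3 / (1 - r) * η := h1.trans (by gcongr)
  have h4 : ‖χ z‖ ≤ r := (schwarz_le c1 c2 c3 hzb).trans hz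
  have h5 : ‖(q : ℂ) * χ z‖ ≤ r := by
    rw [norm_mul, Complex.norm_real, Real.norm_eq_abs, abs_of_pos hq0]
    nlinarith [norm_nonneg (χ z)]
  have h6 : ‖(q : ℂ) * χ z - z‖ < δ := by
    have e : (q : ℂ) * χ z - z = (χ z - z) - ((η : ℝ) : ℂ) * χ z := by rw [hq]; push_cast; ring
    rw [e]
    refine (norm_sub_le _ _).trans_lt ?_
    rw [norm_mul, Complex.norm_real, Real.norm_eq_abs, abs_of_pos hη0]
    nlinarith [norm_nonneg (χ z)]
  have h7 := hδ' ((q : ℂ) * χ z) (by simpa using h5) z (by simpa using hz)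
    (by rw [dist_eq_norm]; exact h6)
  rw [dist_eq_norm] at h7
  rw [← c4 z hzb]
  exact h7.le
end

def e1 : En 1 ≃ₗᵢ[ℂ] ℂ where
  toFun z := z 0
  invFun c := WithLp.toLp 2 (fun _ => c)
  map_add' x y := by simp
  map_smul' c x := by simp
  left_inv x := by
    ext i
    fin_cases i
    rfl
  right_inv c := rfl
  norm_map' x := by
    show ‖x 0‖ = ‖x‖
    rw [EuclideanSpace.norm_eq]
    simp

theorem chain_const (C s t : ℝ) (h : s ≤ t) : ∫ _ in Set.Icc s t, C = C * (t - s) := by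
  simp [h, mul_comm]

theorem transfer1 {G : ℝ → ℂ → ℂ}
    (h1 : ∀ t, 0 ≤ t → DifferentiableOn ℂ (G t) (ball 0 1) ∧ InjOn (G t) (ball 0 1))
    (h2 : ∀ s t, 0 ≤ s → s ≤ t → G s '' ball 0 1 ⊆ G t '' ball 0 1)
    (h3 : ∀ w, ∃ t, 0 ≤ t ∧ w ∈ G t '' ball 0 1)
    (h4 : ∀ ρ, ρ < 1 → ∀ T, 0 < T → ∃ C, 0 ≤ C ∧ ∀ z, ‖z‖ ≤ ρ → ∀ s t, 0 ≤ s → s ≤ t → t ≤ T →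
        ‖G s z - G t z‖ ≤ C * (t - s)) {l c : ℂ} (hl : ‖l‖ = 1) :
    MemE 1 (fun z => e1.symm (G 0 (l * e1 z) + c)) := by
  have hl0 : l ≠ 0 := by rintro rfl; simp at hl
  have hb : ∀ z, z ∈ Ball 1 ↔ l * e1 z ∈ ball (0 : ℂ) 1 := by
    intro z
    rw [rot_mem hl, mem_ball_zero_iff, LinearIsometryEquiv.norm_map, Ball, mem_ball_zero_iff]
  have him : ∀ t w, w ∈ (fun z => e1.symm (G t (l * e1 z) + c)) '' Ball 1 ↔
      e1 w - c ∈ G t '' ball 0 1 := by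
    intro t w
    constructor
    · rintro ⟨z, hz, rfl⟩
      exact ⟨_, (hb z).1 hz, by simp⟩
    · rintro ⟨u, hu, h⟩
      refine ⟨e1.symm (l⁻¹ * u), ?_, ?_⟩
      · rw [hb]; simpa [hl0] using hu
      · simp [hl0, h]
  have hun : ∀ t, 0 ≤ t → UnivalentOn 1 (fun z => e1.symm (G t (l * e1 z) + c)) := by
    intro t ht
    constructor
    · have d1 : DifferentiableOn ℂ (fun z : En 1 => l * e1 z) (Ball 1) :=
        (e1.toContinuousLinearEquiv.differentiable.const_mul l).differentiableOn
      have d2 : DifferentiableOn ℂ (fun z : En 1 => G t (l * e1 z) + c) (Ball 1) :=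
        ((h1 t ht).1.comp d1 (fun z hz => (hb z).1 hz)).add_const c
      exact e1.symm.toContinuousLinearEquiv.differentiable.comp_differentiableOn d2
    · intro z hz w hw h
      have := e1.symm.injective h
      have := (h1 t ht).2 ((hb z).1 hz) ((hb w).1 hw) (add_right_cancel this)
      exact e1.injective (mul_left_cancel₀ hl0 this)
  refine ⟨hun 0 le_rfl, fun t z => e1.symm (G t (l * e1 z) + c), ⟨hun, ?_, ?_⟩, rfl, ?_⟩
  · intro s t hs hst w hw
    exact (him t w).2 (h2 s t hs hst ((him s w).1 hw))
  · intro K hK hKc T hT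
    obtain ⟨ρ, -, hρ, hKρ⟩ := compact_in_ball hKc hK
    obtain ⟨C, hC, H⟩ := h4 ρ hρ T hT
    refine ⟨fun _ => C, fun _ => hC, by simp, ?_⟩
    intro z hz s t hs hst ht
    rw [chain_const C s t hst]
    have hz' : ‖l * e1 z‖ ≤ ρ := by
      rw [norm_mul, hl, one_mul, LinearIsometryEquiv.norm_map]
      simpa using hKρ hz
    have := H _ hz' s t hs hst ht
    rw [← map_sub, LinearIsometryEquiv.norm_map, add_sub_add_right_eq_sub]
    exact this
  · rw [eq_univ_iff_forall]
    intro w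
    obtain ⟨t, ht, h⟩ := h3 (e1 w - c)
    exact mem_iUnion₂.2 ⟨t, ht, (him t w).2 h⟩

theorem dens_one {f : En 1 → En 1} (hf : UnivalentOn 1 f) {r ε : ℝ} (hr0 : 0 ≤ r) (hr : r < 1)
    (hε : 0 < ε) : ∃ Φ, MemE 1 Φ ∧ ∀ z ∈ closedBall (0 : En 1) r, ‖Φ z - f z‖ ≤ ε := by
  set c : ℂ := e1 (f 0) with hc
  set F : ℂ → ℂ := fun w => e1 (f (e1.symm w)) - c with hF
  have hb : ∀ w ∈ ball (0 : ℂ) 1, e1.symm w ∈ Ball 1 := by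
    intro w hw
    rw [Ball, mem_ball_zero_iff, LinearIsometryEquiv.norm_map]; simpa using hw
  have hFd : DifferentiableOn ℂ F (ball 0 1) := by
    have d1 : DifferentiableOn ℂ (fun w : ℂ => e1.symm w) (ball 0 1) :=
      e1.symm.toContinuousLinearEquiv.differentiable.differentiableOn
    exact (e1.toContinuousLinearEquiv.differentiable.comp_differentiableOn
      (hf.1.comp d1 hb)).sub_const c
  have hFi : InjOn F (ball 0 1) := by
    intro z hz w hw h
    have := e1.injective (sub_left_injective h)
    exact e1.symm.injective (hf.2 (hb z hz) (hb w hw) this)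
  obtain ⟨l, hl, A, hA, hFA⟩ := rotate hFd hFi
  obtain ⟨r1, r2⟩ := rot_univ hl hFd hFi
  have hl0 : l ≠ 0 := by rintro rfl; simp at hl
  have hU : U0 (fun z => F (l * z)) := ⟨r1, r2, by simp [hF, hc]⟩
  obtain ⟨ψ, r0, hψ, p0, p1, H⟩ := dens1 hU hA hFA hr0 hr hε
  obtain ⟨G, a0, hG, g1, g2, g3, g4⟩ := chain1 hψ p0 p1
  have hl' : ‖l⁻¹‖ = 1 := by rw [norm_inv, hl, inv_one]
  refine ⟨_, transfer1 g1 g2 g3 g4 (c := c) hl', ?_⟩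
  intro z hz
  have hz' : ‖l⁻¹ * e1 z‖ ≤ r := by
    rw [norm_mul, hl', one_mul, LinearIsometryEquiv.norm_map]; simpa using hz
  have h := H _ _ hG _ hz'
  rw [← LinearIsometryEquiv.norm_map e1, map_sub, LinearIsometryEquiv.apply_symm_apply]
  refine (le_of_eq ?_).trans h
  congr 1
  simp only [hF, mul_inv_cancel_left₀ hl0, LinearIsometryEquiv.symm_apply_apply]
  ring

theorem dens_zero (f : En 0 → En 0) : MemE 0 f := by
  have hu : UnivalentOn 0 f := by
    refine ⟨?_, fun x _ y _ _ => Subsingleton.elim _ _⟩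
    have : f = fun _ => 0 := funext fun x => Subsingleton.elim _ _
    rw [this]
    exact differentiableOn_const 0
  refine ⟨hu, fun _ => f, ⟨fun _ _ => hu, fun s t _ _ => subset_rfl, ?_⟩, rfl, ?_⟩
  · intro K _ _ T _
    refine ⟨fun _ => 0, fun _ => le_rfl, by simp, ?_⟩
    intro z _ s t _ _ _
    simp
  · rw [eq_univ_iff_forall]
    intro w
    exact mem_iUnion₂.2 ⟨0, by simp, 0, by simp [Ball], Subsingleton.elim _ _⟩

/-- E(𝔹ₙ) ⊆ F(𝔹ₙ), E(𝔹ₙ) is dense in F(𝔹ₙ), F(𝔹ₙ) is relatively closed in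
U(𝔹ₙ) (all w.r.t. locally uniform convergence on 𝔹ₙ), and for n ≥ 2 the
closure of E(𝔹ₙ) is a proper subset of U(𝔹ₙ). -/
theorem memE_dense_in_memF_and_memF_closed (n : ℕ) :
    (∀ f, MemE n f → MemF n f) ∧
    (∀ f, MemF n f → ∃ g : ℕ → En n → En n, (∀ k, MemE n (g k)) ∧
      TendstoLocallyUniformlyOn g f atTop (Ball n)) ∧
    (∀ (f : ℕ → En n → En n) (g : En n → En n), (∀ k, MemF n (f k)) →
      UnivalentOn n g → TendstoLocallyUniformlyOn f g atTop (Ball n) → MemF n g) ∧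
    (2 ≤ n → ∃ g : En n → En n, UnivalentOn n g ∧
      ¬ ∃ f : ℕ → En n → En n, (∀ k, MemE n (f k)) ∧
        TendstoLocallyUniformlyOn f g atTop (Ball n)) := by
  have hEF : ∀ f, MemE n f → MemF n f := fun f hf => memE_memF f hf
  refine ⟨hEF, ?_, fun f g hf hg h => memF_closed f g hf hg h, ?_⟩
  · intro f hf
    refine exists_seq_approx (P := MemE n) ?_
    intro r hr0 hr ε hε
    rcases n with _ | _ | n
    · exact ⟨f, dens_zero f, fun z _ => by simp [hε.le]⟩
    · exact dens_one hf.1 hr0 hr hε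
    · exact al_approx (by omega) hf hr0 hr hε
  · intro hn
    obtain ⟨g, hg, hg'⟩ := exists_nonRunge hn
    refine ⟨g, hg, ?_⟩
    rintro ⟨f, hf, hl⟩
    exact hg' (memF_closed f g (fun k => hEF _ (hf k)) hg hl)


end
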